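/- Let Δ be a connected simplicial complex with dim Δ ≥ 2 and assume 𝕜[Δ] is not Gorenstein. If 𝕜[Δ] is Gorenstein on the punctured spectrum, then Δ is a 𝕜-homology manifold. -/

import Mathlib

/-! # Preliminaries

Self-contained definitions: simplicial complexes, simplicial homology, Stanley–Reisner rings,
canonical modules, canonical traces, and the various Gorenstein-type conditions. -/

open CategoryTheory

/-- An abstract simplicial complex on the vertex set `Fin n` (the empty set is a face). -/
structure SC (n : ℕ) where
  faces : Finset (Finset (Fin n))
  empty_mem : ∅ ∈ faces
  down_closed : ∀ {σ τ : Finset (Fin n)}, σ ∈ faces → τ ⊆ σ → τ ∈ faces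

namespace SC

variable {n : ℕ} (Δ : SC n)

/-- The dimension of a simplicial complex, as an integer (the complex `{∅}` has
dimension `-1`). -/
def dim : ℤ := ((Δ.faces.sup Finset.card : ℕ) : ℤ) - 1

/-- `v` is a vertex of `Δ`. -/
def IsVertex (v : Fin n) : Prop := {v} ∈ Δ.faces

/-- A facet is a face which is maximal by inclusion. -/
def IsFacet (σ : Finset (Fin n)) : Prop :=
  σ ∈ Δ.faces ∧ ∀ τ ∈ Δ.faces, σ ⊆ τ → σ = τ

/-- A cone point is a vertex contained in every facet. -/
def IsConePoint (v : Fin n) : Prop :=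
  Δ.IsVertex v ∧ ∀ σ, Δ.IsFacet σ → v ∈ σ

/-- A simplicial complex is connected if it has a vertex and any two vertices are joined
by a path of edges. -/
def Connected : Prop :=
  (∃ v, Δ.IsVertex v) ∧ ∀ u v, Δ.IsVertex u → Δ.IsVertex v →
    Relation.ReflTransGen (fun a b => ({a, b} : Finset (Fin n)) ∈ Δ.faces) u v

/-- A simplicial complex is strongly connected if any two facets are joined by a chain of
facets in which consecutive facets intersect in a face of dimension `dim Δ - 1`. -/
def StronglyConnected : Prop :=
  ∀ σ τ, Δ.IsFacet σ → Δ.IsFacet τ →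
    Relation.ReflTransGen
      (fun α β => Δ.IsFacet α ∧ Δ.IsFacet β ∧ ((α ∩ β).card : ℤ) - 1 = Δ.dim - 1) σ τ

/-- A pseudomanifold: strongly connected, and every face of dimension `dim Δ - 1` is
contained in exactly two facets. -/
def IsPseudomanifold : Prop :=
  Δ.StronglyConnected ∧
    ∀ τ ∈ Δ.faces, (τ.card : ℤ) - 1 = Δ.dim - 1 →
      {σ : Finset (Fin n) | Δ.IsFacet σ ∧ τ ⊆ σ}.ncard = 2

/-- The link of a face `σ` of `Δ`. -/
def link (σ : Finset (Fin n)) (hσ : σ ∈ Δ.faces) : SC n where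
  faces := Δ.faces.filter fun τ => τ ∩ σ = ∅ ∧ τ ∪ σ ∈ Δ.faces
  empty_mem := by
    simp only [Finset.mem_filter]
    exact ⟨Δ.empty_mem, by simp, by simpa using hσ⟩
  down_closed := by
    intro σ' τ' h hsub
    simp only [Finset.mem_filter] at h ⊢
    refine ⟨Δ.down_closed h.1 hsub, ?_, ?_⟩
    · have := h.2.1
      rw [Finset.eq_empty_iff_forall_notMem] at this ⊢
      intro x hx
      exact this x (Finset.mem_inter.mpr
        ⟨hsub (Finset.mem_inter.mp hx).1, (Finset.mem_inter.mp hx).2⟩)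
    · exact Δ.down_closed h.2.2 (Finset.union_subset_union hsub (le_refl σ))

/-- A complex is normal if the link of every face of dimension `≤ dim Δ - 2` is connected. -/
def Normal : Prop :=
  ∀ σ (hσ : σ ∈ Δ.faces), (σ.card : ℤ) - 1 ≤ Δ.dim - 2 → (Δ.link σ hσ).Connected

/-! ## Simplicial homology -/

/-- Faces of `Δ` of cardinality `c` containing the face `σ`.  These index a basis of the
`c`-th chain group of the pair `(Δ, cost_Δ σ)` (for `σ = ∅` this is the augmented
(reduced) chain complex of `Δ`, since the empty face is included in chain degree `0`). -/
def RFace (σ : Finset (Fin n)) (c : ℕ) : Type :=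
  {τ : Finset (Fin n) // τ ∈ Δ.faces ∧ σ ⊆ τ ∧ τ.card = c}

instance (σ : Finset (Fin n)) (c : ℕ) : Fintype (Δ.RFace σ c) :=
  inferInstanceAs (Fintype {τ : Finset (Fin n) // τ ∈ Δ.faces ∧ σ ⊆ τ ∧ τ.card = c})

instance (σ : Finset (Fin n)) (c : ℕ) : DecidableEq (Δ.RFace σ c) :=
  inferInstanceAs (DecidableEq {τ : Finset (Fin n) // τ ∈ Δ.faces ∧ σ ⊆ τ ∧ τ.card = c})

variable (R : Type) [CommRing R]

/-- Chains of the pair `(Δ, cost_Δ σ)` with coefficients in `R`. -/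
abbrev relChain (σ : Finset (Fin n)) (c : ℕ) : Type := Δ.RFace σ c → R

/-- The matrix of the simplicial boundary map of the pair `(Δ, cost_Δ σ)`: the coefficient of
`ρ` in `∂ τ` is `(-1)^j` if `ρ` is obtained from `τ` by deleting its `(j+1)`-st vertex (the
deleted vertex not belonging to `σ`), and `0` otherwise. -/
def relBMat (σ : Finset (Fin n)) (i : ℕ) :
    Matrix (Δ.RFace σ i) (Δ.RFace σ (i + 1)) R :=
  fun ρ τ => ∑ v ∈ τ.1, if v ∉ σ ∧ τ.1.erase v = ρ.1
    then (-1 : R) ^ ((τ.1.filter (fun w => w < v)).card) else 0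

/-- The boundary map of the chain complex of the pair `(Δ, cost_Δ σ)`. -/
noncomputable def relBoundary (σ : Finset (Fin n)) (i : ℕ) :
    Δ.relChain R σ (i + 1) →ₗ[R] Δ.relChain R σ i :=
  (Δ.relBMat R σ i).mulVecLin

/-- The relative simplicial homology `H_d(Δ, cost_Δ σ; R)` (`d ≥ 0`). -/
noncomputable def relHomology (σ : Finset (Fin n)) (d : ℕ) : Type :=
  LinearMap.ker (Δ.relBoundary R σ d) ⧸
    Submodule.comap (LinearMap.ker (Δ.relBoundary R σ d)).subtype
      (LinearMap.range (Δ.relBoundary R σ (d + 1)))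

noncomputable instance (σ : Finset (Fin n)) (d : ℕ) : AddCommGroup (Δ.relHomology R σ d) :=
  inferInstanceAs (AddCommGroup (LinearMap.ker (Δ.relBoundary R σ d) ⧸
    Submodule.comap (LinearMap.ker (Δ.relBoundary R σ d)).subtype
      (LinearMap.range (Δ.relBoundary R σ (d + 1)))))

noncomputable instance (σ : Finset (Fin n)) (d : ℕ) : Module R (Δ.relHomology R σ d) :=
  inferInstanceAs (Module R (LinearMap.ker (Δ.relBoundary R σ d) ⧸
    Submodule.comap (LinearMap.ker (Δ.relBoundary R σ d)).subtype
      (LinearMap.range (Δ.relBoundary R σ (d + 1)))))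

/-- Reduced simplicial homology `H̃_d(Δ; R)` for `d ≥ 0`: the homology of the augmented chain
complex, i.e. of the pair `(Δ, cost_Δ ∅)`. -/
noncomputable abbrev reducedHomology (d : ℕ) : Type := Δ.relHomology R ∅ d

/-- Reduced simplicial homology in degree `-1`. -/
noncomputable def reducedHomologyNeg : Type :=
  (⊤ : Submodule R (Δ.relChain R ∅ 0)) ⧸
    Submodule.comap (⊤ : Submodule R (Δ.relChain R ∅ 0)).subtype
      (LinearMap.range (Δ.relBoundary R ∅ 0))

noncomputable instance : AddCommGroup (Δ.reducedHomologyNeg R) :=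
  inferInstanceAs (AddCommGroup ((⊤ : Submodule R (Δ.relChain R ∅ 0)) ⧸
    Submodule.comap (⊤ : Submodule R (Δ.relChain R ∅ 0)).subtype
      (LinearMap.range (Δ.relBoundary R ∅ 0))))

noncomputable instance : Module R (Δ.reducedHomologyNeg R) :=
  inferInstanceAs (Module R ((⊤ : Submodule R (Δ.relChain R ∅ 0)) ⧸
    Submodule.comap (⊤ : Submodule R (Δ.relChain R ∅ 0)).subtype
      (LinearMap.range (Δ.relBoundary R ∅ 0))))

/-- Cycles of the non-augmented chain complex of `Δ` in dimension `d` (for `d = 0` every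
`0`-chain is a cycle). -/
noncomputable def cyclesUnred (d : ℕ) : Submodule R (Δ.relChain R ∅ (d + 1)) :=
  if d = 0 then ⊤ else LinearMap.ker (Δ.relBoundary R ∅ d)

/-- (Unreduced) simplicial homology `H_d(Δ; R)`. -/
noncomputable def homologyUnred (d : ℕ) : Type :=
  Δ.cyclesUnred R d ⧸
    Submodule.comap (Δ.cyclesUnred R d).subtype (LinearMap.range (Δ.relBoundary R ∅ (d + 1)))

noncomputable instance (d : ℕ) : AddCommGroup (Δ.homologyUnred R d) :=
  inferInstanceAs (AddCommGroup (Δ.cyclesUnred R d ⧸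
    Submodule.comap (Δ.cyclesUnred R d).subtype (LinearMap.range (Δ.relBoundary R ∅ (d + 1)))))

noncomputable instance (d : ℕ) : Module R (Δ.homologyUnred R d) :=
  inferInstanceAs (Module R (Δ.cyclesUnred R d ⧸
    Submodule.comap (Δ.cyclesUnred R d).subtype (LinearMap.range (Δ.relBoundary R ∅ (d + 1)))))

/-- `Δ` is `R`-orientable if `H_d(Δ; R) ≠ 0`, where `d = dim Δ`. -/
def Orientable : Prop :=
  ∃ d : ℕ, Δ.dim = (d : ℤ) ∧ Nontrivial (Δ.homologyUnred R d)

/-- A `k`-homology sphere condition for a single complex `Γ`: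
`H̃_i(Γ; k) = k` for `i = dim Γ` and `0` otherwise. -/
def HomologySphereCond (Γ : SC n) : Prop :=
  (∀ i : ℕ, ((i : ℤ) = Γ.dim → Nonempty ((Γ.reducedHomology R i) ≃ₗ[R] R)) ∧
    ((i : ℤ) ≠ Γ.dim → Subsingleton (Γ.reducedHomology R i))) ∧
  ((-1 : ℤ) = Γ.dim → Nonempty ((Γ.reducedHomologyNeg R) ≃ₗ[R] R)) ∧
  ((-1 : ℤ) ≠ Γ.dim → Subsingleton (Γ.reducedHomologyNeg R))

/-- `Δ` is a `k`-homology manifold: it is connected and the link of every nonempty face has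
the reduced homology of a sphere of its dimension. -/
def IsHomologyManifold : Prop :=
  Δ.Connected ∧ ∀ σ (hσ : σ ∈ Δ.faces), σ ≠ ∅ → HomologySphereCond R (Δ.link σ hσ)

/-- `Δ` is isomorphic to the disjoint union of `m` vertices. -/
def IsDisjointVertices (m : ℕ) : Prop :=
  ∃ v : Fin m → Fin n, Function.Injective v ∧
    ∀ σ : Finset (Fin n), σ ∈ Δ.faces ↔ (σ = ∅ ∨ ∃ i, σ = {v i})

/-- `Δ` is isomorphic to a path of length `m` (with `m` edges and `m+1` vertices). -/
def IsPathComplex (m : ℕ) : Prop :=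
  ∃ v : Fin (m + 1) → Fin n, Function.Injective v ∧
    ∀ σ : Finset (Fin n), σ ∈ Δ.faces ↔
      (σ = ∅ ∨ (∃ i, σ = {v i}) ∨ ∃ i : Fin m, σ = {v i.castSucc, v i.succ})

end SC

/-! ## Commutative algebra -/

/-- The `i`-th Ext module `Ext^i_R(M, N)` of two `R`-modules, as an object of `ModuleCat R`. -/
noncomputable def extMod (R : Type) [CommRing R] (M N : Type) [AddCommGroup M] [Module R M]
    [AddCommGroup N] [Module R N] (i : ℕ) : ModuleCat R :=
  ((Ext R (ModuleCat R) i).obj (Opposite.op (ModuleCat.of R M))).obj (ModuleCat.of R N)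

/-- The trace ideal of an `R`-module `M`: the sum of the images of all `R`-linear maps
`M → R`. -/
noncomputable def traceIdeal (R : Type) [CommRing R] (M : Type) [AddCommGroup M] [Module R M] :
    Ideal R :=
  ⨆ f : M →ₗ[R] R, LinearMap.range f

/-- A Noetherian ring `R` with a distinguished maximal ideal `𝔪` (a local ring, or a graded
ring with its graded maximal ideal) is Cohen--Macaulay when `depth = dim`, i.e. (by the
Ext-characterisation of depth) `Ext^i_R(R/𝔪, R) = 0` for all `i < dim R`. -/
def IsCohenMacaulayAt (R : Type) [CommRing R] (𝔪 : Ideal R) : Prop :=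
  IsNoetherianRing R ∧
    ∀ i : ℕ, (i : WithBot (WithTop ℕ)) < ringKrullDim R → Subsingleton (extMod R (R ⧸ 𝔪) R i)

/-- A Noetherian ring `R` with a distinguished maximal ideal `𝔪` (a local ring, or a graded
ring with its graded maximal ideal) is Gorenstein when `Ext^i_R(R/𝔪, R)` vanishes for
`i ≠ dim R` and is isomorphic to `R/𝔪` for `i = dim R`. -/
def IsGorensteinAt (R : Type) [CommRing R] (𝔪 : Ideal R) : Prop :=
  IsNoetherianRing R ∧
    ∀ i : ℕ, ((i : WithBot (WithTop ℕ)) = ringKrullDim R →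
        Nonempty ((extMod R (R ⧸ 𝔪) R i) ≃ₗ[R] (R ⧸ 𝔪))) ∧
      ((i : WithBot (WithTop ℕ)) ≠ ringKrullDim R → Subsingleton (extMod R (R ⧸ 𝔪) R i))

/-- A Noetherian local ring is Gorenstein. -/
def IsGorensteinLocalRing (A : Type) [CommRing A] [IsLocalRing A] : Prop :=
  IsGorensteinAt A (IsLocalRing.maximalIdeal A)

section Graded

variable (k : Type) [Field k] {n : ℕ}

/-- An ideal of a polynomial ring is homogeneous (graded) if it contains all homogeneous
components of its elements. -/
def IsHomogIdeal (I : Ideal (MvPolynomial (Fin n) k)) : Prop :=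
  ∀ p ∈ I, ∀ d : ℕ, MvPolynomial.homogeneousComponent d p ∈ I

/-- The graded (irrelevant) maximal ideal of `k[x_1,…,x_n]/I`, generated by the images of the
variables. -/
noncomputable def quotMax (I : Ideal (MvPolynomial (Fin n) k)) :
    Ideal (MvPolynomial (Fin n) k ⧸ I) :=
  Ideal.span (Set.range fun i : Fin n => Ideal.Quotient.mk I (MvPolynomial.X i))

/-- The degree `j` component of the standard graded ring `k[x_1,…,x_n]/I`, as a
`k`-subspace. -/
noncomputable def quotGrade (I : Ideal (MvPolynomial (Fin n) k)) (j : ℕ) :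
    Submodule k (MvPolynomial (Fin n) k ⧸ I) :=
  (MvPolynomial.homogeneousSubmodule (Fin n) k j).map (Ideal.Quotient.mkₐ k I).toLinearMap

/-- The `ℤ^n`-graded component of `k[x_1,…,x_n]/I` of multidegree `a`: the `k`-line spanned by
the image of the monomial `x^a`. -/
noncomputable def quotMonomialGrade (I : Ideal (MvPolynomial (Fin n) k)) (a : Fin n → ℕ) :
    Submodule k (MvPolynomial (Fin n) k ⧸ I) :=
  Submodule.span k
    {Ideal.Quotient.mk I (MvPolynomial.monomial (Finsupp.equivFunOnFinite.symm a) (1 : k))}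

/-- The standard graded ring `R = k[x_1,…,x_n]/I` is Gorenstein on the punctured spectrum if
`R_𝔭` is Gorenstein for every graded prime `𝔭` other than the graded maximal ideal. -/
def GorensteinPunctured (I : Ideal (MvPolynomial (Fin n) k)) : Prop :=
  ∀ (𝔭 : Ideal (MvPolynomial (Fin n) k ⧸ I)) [𝔭.IsPrime],
    IsHomogIdeal k (𝔭.comap (Ideal.Quotient.mk I)) → 𝔭 ≠ quotMax k I →
      IsGorensteinLocalRing (Localization.AtPrime 𝔭)

/-- `ω` is a canonical module of the standard graded ring `R = k[x_1,…,x_n]/I`, `d = dim R`,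
when `ω ≅ Ext^{n-d}_S(R, S)` for `S = k[x_1,…,x_n]` (by graded local duality this is, up to
shift, the Matlis dual of the top local cohomology module `H^d_𝔪(R)`). -/
def IsCanonicalModuleQ (I : Ideal (MvPolynomial (Fin n) k)) (ω : Type) [AddCommGroup ω]
    [Module (MvPolynomial (Fin n) k ⧸ I) ω] : Prop :=
  Module.Finite (MvPolynomial (Fin n) k ⧸ I) ω ∧
    ∃ d : ℕ, ringKrullDim (MvPolynomial (Fin n) k ⧸ I) = (d : WithBot (WithTop ℕ)) ∧
      letI : Module (MvPolynomial (Fin n) k) ω := Module.compHom ω (Ideal.Quotient.mk I)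
      Nonempty (ω ≃ₗ[MvPolynomial (Fin n) k]
        (extMod (MvPolynomial (Fin n) k) (MvPolynomial (Fin n) k ⧸ I)
          (MvPolynomial (Fin n) k) (n - d)))

/-- A `ℤ`-grading on a module `ω` over `R = k[x_1,…,x_n]/I` compatible with the standard
grading of `R`. -/
def IsCompatibleGrading (I : Ideal (MvPolynomial (Fin n) k)) (ω : Type) [AddCommGroup ω]
    [Module (MvPolynomial (Fin n) k ⧸ I) ω] [Module k ω] (gr : ℤ → Submodule k ω) : Prop :=
  DirectSum.IsInternal gr ∧
    ∀ (i : ℕ) (j : ℤ) (r : MvPolynomial (Fin n) k ⧸ I) (m : ω),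
      r ∈ quotGrade k I i → m ∈ gr j → r • m ∈ gr ((i : ℤ) + j)

/-- The minimal number of generators of a module `M` over `R = k[…]/I` with graded maximal
ideal `𝔪`: the `k`-dimension of `M/𝔪M`. -/
noncomputable def muGen (R : Type) [CommRing R] [Algebra k R] (𝔪 : Ideal R) (M : Type)
    [AddCommGroup M] [Module R M] : ℕ :=
  letI : Module k (M ⧸ (𝔪 • (⊤ : Submodule R M))) :=
    Module.compHom (M ⧸ (𝔪 • (⊤ : Submodule R M))) (algebraMap k R)
  Module.finrank k (M ⧸ (𝔪 • (⊤ : Submodule R M)))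

/-- The Hilbert--Samuel function `j ↦ dim_k M/𝔪^j M` of a module. -/
noncomputable def hilbSam (R : Type) [CommRing R] [Algebra k R] (𝔪 : Ideal R) (M : Type)
    [AddCommGroup M] [Module R M] (j : ℕ) : ℕ :=
  letI : Module k (M ⧸ ((𝔪 ^ j) • (⊤ : Submodule R M))) :=
    Module.compHom (M ⧸ ((𝔪 ^ j) • (⊤ : Submodule R M))) (algebraMap k R)
  Module.finrank k (M ⧸ ((𝔪 ^ j) • (⊤ : Submodule R M)))

/-- `M` is an Ulrich module with respect to `𝔪`: its minimal number of generators `μ(M)`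
equals its multiplicity `e(𝔪; M) = lim_j t!·dim_k(M/𝔪^j M)/j^t`, where `t = dim M`. -/
def IsUlrich (R : Type) [CommRing R] [Algebra k R] (𝔪 : Ideal R) (M : Type) [AddCommGroup M]
    [Module R M] : Prop :=
  ∃ t : ℕ, ringKrullDim (R ⧸ Module.annihilator R M) = (t : WithBot (WithTop ℕ)) ∧
    Filter.Tendsto
      (fun j : ℕ => ((t.factorial : ℝ) * (hilbSam k R 𝔪 M j : ℝ)) / (j : ℝ) ^ t)
      Filter.atTop (nhds ((muGen k R 𝔪 M : ℝ)))

end Graded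

section SR

variable (k : Type) [Field k] {n : ℕ}

/-- The Stanley--Reisner ideal of `Δ`: generated by the squarefree monomials supported on
non-faces of `Δ`. -/
noncomputable def srIdeal (Δ : SC n) : Ideal (MvPolynomial (Fin n) k) :=
  Ideal.span {m | ∃ σ : Finset (Fin n), σ ∉ Δ.faces ∧ m = ∏ i ∈ σ, MvPolynomial.X i}

/-- The Stanley--Reisner ring `k[Δ]`. -/
abbrev SRRing (Δ : SC n) : Type := MvPolynomial (Fin n) k ⧸ srIdeal k Δ

/-- The graded maximal ideal of `k[Δ]`. -/
noncomputable abbrev srMax (Δ : SC n) : Ideal (SRRing k Δ) := quotMax k (srIdeal k Δ)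

/-- The value at `j` of the Hilbert function of the (canonically graded) canonical module of
`k[Δ]`, as computed by Gräbe's theorem:
`dim_k [ω]_j = Σ_{a ∈ ℕ^n, |a| = j} dim_k H_{dim Δ}(Δ, cost_Δ(supp a); k)`. -/
noncomputable def canonicalHilbert (Δ : SC n) (j : ℕ) : ℕ :=
  ∑ a ∈ (Fintype.piFinset fun _ : Fin n => Finset.range (j + 1)).filter
      (fun a => ∑ i, a i = j),
    Module.finrank k
      (Δ.relHomology k (Finset.univ.filter fun i => a i ≠ 0) (Δ.faces.sup Finset.card - 1))

/-- A `ℤ`-grading `gr` on a module `ω` over `k[Δ]` is the canonical grading of the canonical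
module if it is a compatible grading, is supported in nonnegative degrees, and its Hilbert
function is the one given by Gräbe's theorem. -/
def IsCanonicallyGraded (Δ : SC n) (ω : Type) [AddCommGroup ω] [Module (SRRing k Δ) ω]
    [Module k ω] (gr : ℤ → Submodule k ω) : Prop :=
  IsCompatibleGrading k (srIdeal k Δ) ω gr ∧ (∀ j : ℤ, j < 0 → gr j = ⊥) ∧
    ∀ j : ℕ, Module.finrank k (gr (j : ℤ)) = canonicalHilbert k Δ j

/-- A `ℤ^n`-grading `grN` on a module `ω` over `k[Δ]` (supported in `ℕ^n`) is the canonical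
multigrading of the canonical module if it is an internal direct sum, is compatible with the
`ℤ^n`-grading of `k[Δ]`, and its multigraded Hilbert function is the one given by Gräbe's
theorem: `dim_k [ω]_a = dim_k H_{dim Δ}(Δ, cost_Δ(supp a); k)`. -/
def IsCanonicallyMultiGraded (Δ : SC n) (ω : Type) [AddCommGroup ω] [Module (SRRing k Δ) ω]
    [Module k ω] (grN : (Fin n → ℕ) → Submodule k ω) : Prop :=
  DirectSum.IsInternal grN ∧
    (∀ (a b : Fin n → ℕ) (r : SRRing k Δ) (m : ω),
      r ∈ quotMonomialGrade k (srIdeal k Δ) a → m ∈ grN b → r • m ∈ grN (a + b)) ∧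
    ∀ a : Fin n → ℕ, Module.finrank k (grN a) =
      Module.finrank k
        (Δ.relHomology k (Finset.univ.filter fun i => a i ≠ 0) (Δ.faces.sup Finset.card - 1))

end SR

/-- The chain map `C_•(Δ, cost_Δ τ) → C_•(Δ, cost_Δ σ)` (for `τ ⊆ σ`) induced by the
inclusion `cost_Δ τ ⊆ cost_Δ σ`: basis faces not containing `σ` are sent to `0`. -/
def SC.relChainMap {n : ℕ} (Δ : SC n) (R : Type) [CommRing R] (τ σ : Finset (Fin n)) (c : ℕ) :
    Δ.relChain R τ c →ₗ[R] Δ.relChain R σ c :=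
  Matrix.mulVecLin (fun (β : Δ.RFace σ c) (α : Δ.RFace τ c) => if α.1 = β.1 then (1 : R) else 0)

set_option synthInstance.maxHeartbeats 1000000 in
/-- `R = k[x_1,…,x_n]/I` is almost Gorenstein with respect to a canonical module `ω` with
(canonical) grading `gr`: writing `a = a_R` for the `a`-invariant (so `-a` is the least degree
of `ω`), there is an injective degree-zero `R`-linear map `φ : R → ω(-a)` whose cokernel is
zero or an Ulrich module. -/
def IsAlmostGorenstein (k : Type) [Field k] {n : ℕ} (I : Ideal (MvPolynomial (Fin n) k))
    (ω : Type) [AddCommGroup ω] [Module (MvPolynomial (Fin n) k ⧸ I) ω] [Module k ω]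
    (gr : ℤ → Submodule k ω) : Prop :=
  ∃ a : ℤ, (gr (-a) ≠ ⊥ ∧ ∀ j : ℤ, j < -a → gr j = ⊥) ∧
    ∃ φ : (MvPolynomial (Fin n) k ⧸ I) →ₗ[MvPolynomial (Fin n) k ⧸ I] ω,
      Function.Injective φ ∧
      (∀ (i : ℕ) (r : MvPolynomial (Fin n) k ⧸ I),
        r ∈ quotGrade k I i → φ r ∈ gr ((i : ℤ) - a)) ∧
      (Subsingleton (ω ⧸ LinearMap.range φ) ∨
        IsUlrich k (MvPolynomial (Fin n) k ⧸ I) (quotMax k I) (ω ⧸ LinearMap.range φ))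


set_option linter.unusedSectionVars false
set_option linter.unusedSimpArgs false
set_option linter.unusedVariables false

namespace GP

open CategoryTheory

section ResBasic

/-- The action of a matrix on module valued cochains. -/
def act {B N ι κ : Type} [CommRing B] [AddCommGroup N] [Module B N] [Fintype ι]
    (f : ι → N) (D : Matrix ι κ B) : κ → N := fun c => ∑ r, D r c • f r

section act
variable {B N N' ι κ μ : Type} [CommRing B] [AddCommGroup N] [Module B N] [AddCommGroup N']
  [Module B N'] [Fintype ι] [Fintype κ]

lemma act_mul (f : ι → N) (D : Matrix ι κ B) (E : Matrix κ μ B) :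
    act f (D * E) = act (act f D) E := by
  funext c
  simp only [act, Matrix.mul_apply, Finset.sum_smul, Finset.smul_sum]
  rw [Finset.sum_comm]
  refine Finset.sum_congr rfl fun x _ => Finset.sum_congr rfl fun y _ => ?_
  rw [smul_smul, mul_comm]

lemma act_add (f g : ι → N) (D : Matrix ι κ B) : act (f + g) D = act f D + act g D := by
  funext c; simp [act, Finset.sum_add_distrib]

lemma act_sub (f g : ι → N) (D : Matrix ι κ B) : act (f - g) D = act f D - act g D := by
  funext c; simp [act, Finset.sum_sub_distrib, smul_sub]

lemma act_smul (t : B) (f : ι → N) (D : Matrix ι κ B) : act (t • f) D = t • act f D := by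
  funext c
  simp only [act, Pi.smul_apply, Finset.smul_sum]
  exact Finset.sum_congr rfl fun x _ => smul_comm _ _ _

lemma act_zero (D : Matrix ι κ B) : act (0 : ι → N) D = 0 := by
  funext c; simp [act]

lemma act_mat_zero (f : ι → N) : act f (0 : Matrix ι κ B) = 0 := by
  funext c; simp [act]

lemma act_mat_add (f : ι → N) (D E : Matrix ι κ B) : act f (D + E) = act f D + act f E := by
  funext c; simp [act, add_smul, Finset.sum_add_distrib]

lemma act_smul_one [DecidableEq ι] (t : B) (f : ι → N) :
    act f (t • (1 : Matrix ι ι B)) = t • f := by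
  funext c
  simp [act, Matrix.one_apply]

lemma act_sum {s : Type} [Fintype s] (f : s → ι → N) (D : Matrix ι κ B) :
    act (∑ l, f l) D = ∑ l, act (f l) D := by
  funext c
  simp only [act, Finset.sum_apply, Finset.smul_sum]
  rw [Finset.sum_comm]

lemma map_act (φ : N →ₗ[B] N') (f : ι → N) (D : Matrix ι κ B) (c : κ) :
    φ (act f D c) = act (fun r => φ (f r)) D c := by
  simp [act]

lemma act_eq_mulVec (f : ι → B) (D : Matrix ι κ B) :
    act f D = D.transpose.mulVec f := by
  funext c; simp [act, Matrix.mulVec, dotProduct]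

end act

/-- A resolution of `B/𝔪` by finite free modules, with a shift in indices. -/
structure Res (B : Type) [CommRing B] (𝔪 : Ideal B) where
  ι : ℕ → Type
  [fin : ∀ i, Fintype (ι i)]
  [dec : ∀ i, DecidableEq (ι i)]
  [emp : IsEmpty (ι 0)]
  [uni : Unique (ι 1)]
  D : ∀ i, Matrix (ι i) (ι (i + 1)) B
  ex1 : ∀ v : ι 1 → B, v default ∈ 𝔪 ↔ ∃ w, v = (D 1).mulVec w
  ex : ∀ i (v : ι (i + 2) → B), (D (i + 1)).mulVec v = 0 ↔ ∃ w, v = (D (i + 2)).mulVec w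

attribute [instance] Res.fin Res.dec Res.emp Res.uni

namespace Res

variable {B : Type} [CommRing B] {𝔪 : Ideal B} (P : Res B 𝔪)
variable (N : Type) [AddCommGroup N] [Module B N]

/-- Every cocycle is a coboundary. -/
def Van (i : ℕ) : Prop :=
  ∀ f : P.ι (i + 1) → N, act f (P.D (i + 1)) = 0 → ∃ h : P.ι i → N, f = act h (P.D i)

/-- `Ext^i` has "dimension less than `r`". -/
def DimLT (i r : ℕ) : Prop :=
  ∀ f : Fin r → P.ι (i + 1) → N, (∀ l, act (f l) (P.D (i + 1)) = 0) →
    ∃ a : Fin r → B, (∃ l, a l ∉ 𝔪) ∧ ∃ h : P.ι i → N, (∑ l, a l • f l) = act h (P.D i)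

variable {N}

lemma D_mul (i : ℕ) : P.D i * P.D (i + 1) = 0 := by
  cases i with
  | zero => ext a; exact (IsEmpty.false a).elim
  | succ i =>
    refine Matrix.ext_iff_mulVec.mpr fun v => ?_
    rw [← Matrix.mulVec_mulVec, Matrix.zero_mulVec]
    exact (P.ex i _).mpr ⟨v, rfl⟩

lemma act_D_D (i : ℕ) (f : P.ι i → N) : act (act f (P.D i)) (P.D (i + 1)) = 0 := by
  rw [← act_mul, D_mul, act_mat_zero]

lemma exists_matrix_of_cols {ι κ μ : Type} [Fintype κ] (D : Matrix ι κ B) (M : Matrix ι μ B)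
    (h : ∀ c, ∃ w, (fun r => M r c) = D.mulVec w) : ∃ s : Matrix κ μ B, M = D * s := by
  choose w hw using h
  refine ⟨fun a c => w c a, ?_⟩
  ext r c
  have := congrFun (hw c) r
  change M r c = ∑ x, D r x * w c x
  simpa [Matrix.mulVec, dotProduct] using this

lemma exists_homotopy (t : B) (ht : t ∈ 𝔪) (i : ℕ) :
    ∃ (s : Matrix (P.ι (i + 2)) (P.ι (i + 1)) B) (s' : Matrix (P.ι (i + 1)) (P.ι i) B),
      P.D (i + 1) * s + s' * P.D i = t • (1 : Matrix _ _ B) := by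
  induction i with
  | zero =>
    obtain ⟨s, hs⟩ := exists_matrix_of_cols (P.D 1) (t • (1 : Matrix (P.ι 1) (P.ι 1) B))
      (fun c => (P.ex1 _).mp (by
        simp only [Matrix.smul_apply, smul_eq_mul]
        exact 𝔪.mul_mem_right _ ht))
    refine ⟨s, 0, ?_⟩
    rw [hs]; simp
  | succ i ih =>
    obtain ⟨s, s', h⟩ := ih
    have key : P.D (i + 1) * (t • (1 : Matrix _ _ B) - s * P.D (i + 1)) = 0 := by
      rw [Matrix.mul_sub, ← Matrix.mul_assoc]
      have : P.D (i + 1) * s = t • (1 : Matrix _ _ B) - s' * P.D i := by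
        rw [← h]; simp
      rw [this, Matrix.sub_mul, Matrix.mul_assoc, D_mul]
      simp
    obtain ⟨s2, hs2⟩ := exists_matrix_of_cols (P.D (i + 2))
      (t • (1 : Matrix (P.ι (i + 2)) (P.ι (i + 2)) B) - s * P.D (i + 1))
      (fun c => (P.ex i _).mp (by
        funext r
        have := congrFun (congrFun key r) c
        simpa [Matrix.mul_apply, Matrix.mulVec, dotProduct] using this))
    refine ⟨s2, s, ?_⟩
    rw [← hs2]; simp

/-- `𝔪` kills `Ext`. -/
lemma smul_cocycle (t : B) (ht : t ∈ 𝔪) (i : ℕ) (f : P.ι (i + 1) → N)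
    (hf : act f (P.D (i + 1)) = 0) : ∃ h : P.ι i → N, t • f = act h (P.D i) := by
  obtain ⟨s, s', h⟩ := P.exists_homotopy t ht i
  refine ⟨act f s', ?_⟩
  rw [← act_smul_one, ← h, act_mat_add, act_mul, hf, act_zero, act_mul, zero_add]

lemma van_of_bijective (t : B) (ht : t ∈ 𝔪) (hb : Function.Bijective fun x : N => t • x) (i : ℕ) :
    P.Van N i := by
  intro f hf
  obtain ⟨h, hh⟩ := P.smul_cocycle t ht i f hf
  choose g hg using hb.2
  refine ⟨fun r => g (h r), ?_⟩
  have h2 : t • f = t • act (fun r => g (h r)) (P.D i) := by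
    rw [hh, ← act_smul]
    congr 1
    funext r
    exact (hg (h r)).symm
  funext r
  exact hb.1 (congrFun h2 r)

lemma van_pi {J : Type} (M : J → Type) [∀ j, AddCommGroup (M j)] [∀ j, Module B (M j)] (i : ℕ)
    (h : ∀ j, P.Van (M j) i) : P.Van (∀ j, M j) i := by
  intro f hf
  have : ∀ j, ∃ g : P.ι i → M j, (fun r => f r j) = act g (P.D i) := by
    intro j
    apply h j
    funext c
    have := congrFun (congrFun hf c) j
    simpa [act] using this
  choose g hg using this
  refine ⟨fun r j => g j r, ?_⟩
  funext c j
  have := congrFun (hg j) c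
  simpa [act] using this

variable {K C K' : Type} [AddCommGroup K] [Module B K] [AddCommGroup C] [Module B C]
  [AddCommGroup K'] [Module B K']

lemma dimLT_shift (u : K →ₗ[B] C) (g : C →ₗ[B] K') (hu : Function.Injective u)
    (hg : Function.Surjective g) (hex : ∀ c, g c = 0 ↔ ∃ x, u x = c) (i r : ℕ)
    (hC : P.Van C i) (hK : P.DimLT K (i + 1) r) : P.DimLT K' i r := by
  intro f hf
  choose lift hlift using hg
  let F : Fin r → P.ι (i + 1) → C := fun l x => lift (f l x)
  have hgF : ∀ l, (fun x => g (F l x)) = f l := fun l => funext fun x => hlift _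
  have h1 : ∀ l, ∀ c, ∃ y, u y = act (F l) (P.D (i + 1)) c := by
    intro l c
    rw [← hex, map_act, hgF, hf]; rfl
  choose f1 hf1 using h1
  have hcoc : ∀ l, act (f1 l) (P.D (i + 1 + 1)) = 0 := by
    intro l
    funext c
    apply hu
    rw [map_act]
    have : (fun r => u (f1 l r)) = act (F l) (P.D (i + 1)) := funext (hf1 l)
    rw [this, act_D_D]; simp
  obtain ⟨a, ha, h, hh⟩ := hK f1 hcoc
  refine ⟨a, ha, ?_⟩
  let G : P.ι (i + 1) → C := (∑ l, a l • F l) - fun x => u (h x)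
  have hG : act G (P.D (i + 1)) = 0 := by
    simp only [G]
    rw [act_sub, act_sum]
    funext c
    have h2 := congrArg u (congrFun hh c)
    rw [map_act] at h2
    simp only [Pi.sub_apply, Finset.sum_apply, Pi.zero_apply, act_smul, Pi.smul_apply]
    rw [← h2]
    simp [hf1]
  obtain ⟨e, he⟩ := hC G hG
  refine ⟨fun x => g (e x), ?_⟩
  funext c
  rw [← map_act, ← he]
  simp only [G, Pi.sub_apply, map_sub, Finset.sum_apply, Pi.smul_apply, map_sum, map_smul]
  rw [(hex _).mpr ⟨_, rfl⟩, sub_zero]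
  refine Finset.sum_congr rfl fun l _ => ?_
  rw [congrFun (hgF l) c]

/-- Socle elements from degree zero. -/
lemma socle_of_dimLT_zero (r : ℕ) (h : P.DimLT N 0 r) (z : Fin r → N)
    (hz : ∀ l, ∀ t ∈ 𝔪, t • z l = 0) :
    ∃ a : Fin r → B, (∃ l, a l ∉ 𝔪) ∧ ∑ l, a l • z l = 0 := by
  obtain ⟨a, ha, e, he⟩ := h (fun l _ => z l) (by
    intro l
    funext c
    change (∑ x : P.ι 1, P.D 1 x c • z l) = 0
    rw [Fintype.sum_unique]
    apply hz
    refine (P.ex1 (fun r => P.D (0 + 1) r c)).mpr ⟨Pi.single c 1, ?_⟩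
    funext r
    simp)
  refine ⟨a, ha, ?_⟩
  have := congrFun he (default : P.ι 1)
  simpa [act] using this

end Res

end ResBasic

end GP


set_option linter.unusedSectionVars false
set_option linter.unusedSimpArgs false
set_option linter.unusedVariables false

namespace GP
namespace Res
open CategoryTheory

variable {B : Type} [CommRing B] {𝔪 : Ideal B} (P : Res B 𝔪)

lemma cpx_aux (i : ℕ) : ModuleCat.ofHom (P.D (i + 1 + 1)).mulVecLin ≫
    ModuleCat.ofHom (P.D (i + 1)).mulVecLin = 0 := by
  rw [← ModuleCat.ofHom_comp, ← Matrix.mulVecLin_mul, D_mul]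
  ext; simp

noncomputable def cpx : ChainComplex (ModuleCat.{0} B) ℕ :=
  ChainComplex.of (fun i => ModuleCat.of B (P.ι (i + 1) → B))
    (fun i => ModuleCat.ofHom (P.D (i + 1)).mulVecLin) P.cpx_aux

lemma cpx_d (i : ℕ) : P.cpx.d (i + 1) i = ModuleCat.ofHom (P.D (i + 1)).mulVecLin :=
  ChainComplex.of_d (fun i => ModuleCat.of B (P.ι (i + 1) → B))
    (fun i => ModuleCat.ofHom (P.D (i + 1)).mulVecLin) _

noncomputable def aug : P.cpx.X 0 ⟶ ModuleCat.of B (B ⧸ 𝔪) :=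
  ModuleCat.ofHom ((Submodule.mkQ 𝔪).comp (LinearMap.proj (R := B) (φ := fun _ : P.ι 1 => B) default))

lemma d_aug : P.cpx.d 1 0 ≫ P.aug = 0 := by
  rw [cpx_d]
  apply ModuleCat.hom_ext
  apply LinearMap.ext
  intro v
  change Submodule.mkQ 𝔪 ((P.D 1).mulVec v default) = 0
  rw [Submodule.mkQ_apply, Submodule.Quotient.mk_eq_zero]
  exact (P.ex1 _).mpr ⟨v, rfl⟩

noncomputable def piMap : P.cpx ⟶ (ChainComplex.single₀ _).obj (ModuleCat.of B (B ⧸ 𝔪)) :=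
  (P.cpx.toSingle₀Equiv _).symm ⟨P.aug, P.d_aug⟩

lemma piMap_zero : P.piMap.f 0 = P.aug :=
  ChainComplex.toSingle₀Equiv_symm_apply_f_zero _ _

lemma quasi : QuasiIso P.piMap where
  quasiIsoAt m := by
    induction m with
    | zero =>
      rw [ChainComplex.quasiIsoAt₀_iff, ShortComplex.quasiIso_iff_of_zeros' _ rfl rfl rfl]
      constructor
      · rw [ShortComplex.moduleCat_exact_iff]
        intro x hx
        have hx' : P.piMap.f 0 x = 0 := hx
        rw [piMap_zero] at hx'
        change P.ι 1 → B at x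
        have h2 : x default ∈ 𝔪 := by
          rw [← Submodule.Quotient.mk_eq_zero (p := 𝔪)]
          exact hx'
        obtain ⟨w, hw⟩ := (P.ex1 x).mp h2
        refine ⟨w, ?_⟩
        change P.cpx.d 1 0 w = x
        rw [cpx_d]
        exact hw.symm
      · have : Epi P.aug := by
          rw [ModuleCat.epi_iff_surjective]
          intro y
          obtain ⟨b, rfl⟩ := Submodule.mkQ_surjective 𝔪 y
          exact ⟨fun _ => b, rfl⟩
        change Epi (P.piMap.f 0)
        rw [piMap_zero]
        exact this
    | succ m _ =>
      rw [quasiIsoAt_iff_exactAt' (hL := ChainComplex.exactAt_succ_single_obj ..),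
          HomologicalComplex.exactAt_iff' _ (m + 2) (m + 1) m (by simp) (by simp)]
      rw [ShortComplex.moduleCat_exact_iff]
      intro x hx
      change P.ι (m + 2) → B at x
      have hx' : P.cpx.d (m + 1) m x = 0 := hx
      rw [cpx_d] at hx'
      obtain ⟨w, hw⟩ := (P.ex m x).mp hx'
      refine ⟨w, ?_⟩
      change P.cpx.d (m + 2) (m + 1) w = x
      rw [cpx_d]
      exact hw.symm

noncomputable def projRes : ProjectiveResolution (ModuleCat.of B (B ⧸ 𝔪)) where
  complex := P.cpx
  projective i := by
    change Projective (ModuleCat.of B (P.ι (i + 1) → B))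
    exact (IsProjective.iff_projective _).mp inferInstance
  π := P.piMap
  quasiIso := P.quasi

end Res
end GP


set_option linter.unusedSectionVars false
set_option linter.unusedSimpArgs false
set_option linter.unusedVariables false

namespace GP
namespace Res
open CategoryTheory

variable {B : Type} [CommRing B] {𝔪 : Ideal B} (P : Res B 𝔪)

lemma sc_homology (S : ShortComplex (ModuleCat.{0} B)) :
    ∃ q : LinearMap.ker S.g.hom →ₗ[B] S.homology, Function.Surjective q ∧
      ∀ z, q z = 0 ↔ ∃ y, S.f y = z.1 := by
  let e : S.homology ≃ₗ[B] _ := S.moduleCatHomologyIso.toLinearEquiv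
  refine ⟨e.symm.toLinearMap.comp (Submodule.mkQ (LinearMap.range S.moduleCatToCycles)), ?_, ?_⟩
  · exact e.symm.surjective.comp (Submodule.mkQ_surjective _)
  · intro z
    have h1 : (e.symm.toLinearMap.comp (Submodule.mkQ (LinearMap.range S.moduleCatToCycles))) z
      = e.symm (Submodule.mkQ (LinearMap.range S.moduleCatToCycles) z) := rfl
    rw [h1]
    have h2 := e.symm.map_eq_zero_iff (x := Submodule.mkQ (LinearMap.range S.moduleCatToCycles) z)
    refine h2.trans ?_
    have h3 := Submodule.Quotient.mk_eq_zero (LinearMap.range S.moduleCatToCycles) (x := z)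
    refine h3.trans ?_
    constructor
    · rintro ⟨y, hy⟩
      exact ⟨y, congrArg Subtype.val hy⟩
    · rintro ⟨y, hy⟩
      exact ⟨y, Subtype.ext hy⟩

/-- The pairing functional. -/
noncomputable def pr {ι : Type} [Fintype ι] : (ι → B) →ₗ[B] ((ι → B) →ₗ[B] B) where
  toFun f :=
    { toFun := fun v => ∑ r, f r * v r
      map_add' := fun v w => by simp [mul_add, Finset.sum_add_distrib]
      map_smul' := fun t w => by
        simp only [Pi.smul_apply, smul_eq_mul, RingHom.id_apply, Finset.mul_sum]
        exact Finset.sum_congr rfl fun _ _ => by ring }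
  map_add' f g := by
    apply LinearMap.ext; intro v; simp [add_mul, Finset.sum_add_distrib]
  map_smul' t g := by
    apply LinearMap.ext; intro v; simp [Finset.mul_sum, mul_assoc]

lemma pr_apply {ι : Type} [Fintype ι] (f v : ι → B) : pr f v = ∑ r, f r * v r := rfl

/-- dual of a free module. -/
noncomputable def dualE (i : ℕ) : (P.ι (i + 1) → B) ≃ₗ[B]
    ((P.cpx.linearYonedaObj B (ModuleCat.of B B)).X i) where
  toFun f := ModuleCat.ofHom (pr f)
  invFun φ := fun r => ((ModuleCat.Hom.hom φ : (P.ι (i + 1) → B) →ₗ[B] B)) (Pi.single r (1 : B))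
  map_add' f g := by
    rw [map_add]; rfl
  map_smul' t g := by
    rw [map_smul]; rfl
  left_inv f := by
    funext r
    change pr f (Pi.single r 1) = f r
    simp [pr_apply, Pi.single_apply]
  right_inv φ := by
    apply ModuleCat.hom_ext
    change pr _ = (ModuleCat.Hom.hom φ : (P.ι (i + 1) → B) →ₗ[B] B)
    refine LinearMap.pi_ext' fun r => LinearMap.ext_ring ?_
    change pr _ (Pi.single r 1) = _
    simp only [pr_apply, Pi.single_apply, mul_ite, mul_one, mul_zero, Finset.sum_ite_eq',
      Finset.mem_univ, if_true]
    rfl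

lemma dualE_d (i : ℕ) (f : P.ι (i + 1) → B) :
    (P.cpx.linearYonedaObj B (ModuleCat.of B B)).d i (i + 1) (P.dualE i f) =
      P.dualE (i + 1) (act f (P.D (i + 1))) := by
  change P.cpx.d (i + 1) i ≫ ModuleCat.ofHom _ = ModuleCat.ofHom _
  rw [cpx_d]
  apply ModuleCat.hom_ext
  apply LinearMap.ext
  intro v
  change P.ι (i + 2) → B at v
  change pr f ((P.D (i+1)).mulVec v) = pr (act f (P.D (i + 1))) v
  rw [pr_apply, pr_apply]
  simp only [smul_eq_mul, act, Matrix.mulVec, dotProduct, Finset.mul_sum, Finset.sum_mul]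
  rw [Finset.sum_comm]
  refine Finset.sum_congr rfl fun x _ => Finset.sum_congr rfl fun y _ => by ring

/-- cocycles -/
def Z (i : ℕ) : Submodule B (P.ι (i + 1) → B) where
  carrier := {f | act f (P.D (i + 1)) = 0}
  add_mem' {f g} hf hg := by
    have hf' : act f (P.D (i + 1)) = 0 := hf
    have hg' : act g (P.D (i + 1)) = 0 := hg
    change act (f + g) _ = 0
    rw [act_add, hf', hg', add_zero]
  zero_mem' := act_zero _
  smul_mem' t f hf := by
    have hf' : act f (P.D (i + 1)) = 0 := hf
    change act (t • f) _ = 0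
    rw [act_smul, hf', smul_zero]

lemma mem_Z (i : ℕ) (f : P.ι (i + 1) → B) : f ∈ P.Z i ↔ act f (P.D (i + 1)) = 0 := Iff.rfl

lemma bridge_aux (i j : ℕ) (hj : (ComplexShape.up ℕ).prev i = j)
    (hr : ∀ f : P.ι (i + 1) → B, (∃ h, f = act h (P.D i)) ↔
      ∃ y, (P.cpx.linearYonedaObj B (ModuleCat.of B B)).d j i y = P.dualE i f) :
    ∃ q : P.Z i →ₗ[B] extMod B (B ⧸ 𝔪) B i, Function.Surjective q ∧
      ∀ f, q f = 0 ↔ ∃ h, f.1 = act h (P.D i) := by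
  let C := P.cpx.linearYonedaObj B (ModuleCat.of B B)
  have e1 : extMod B (B ⧸ 𝔪) B i ≅ C.homology i :=
    P.projRes.isoExt (R := B) i (ModuleCat.of B B)
  have e2 : C.homology i ≅ (C.sc' j i (i + 1)).homology :=
    C.homologyIsoSc' j i (i + 1) hj (by simp)
  obtain ⟨q, hq, hq0⟩ := sc_homology (C.sc' j i (i + 1))
  let e := (e1 ≪≫ e2).toLinearEquiv
  let Φ : P.Z i →ₗ[B] LinearMap.ker (C.sc' j i (i + 1)).g.hom :=
    ((P.dualE i).toLinearMap.comp (P.Z i).subtype).codRestrict _ (by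
      intro f
      change C.d i (i + 1) (P.dualE i f) = 0
      rw [dualE_d]
      have : act f.1 (P.D (i + 1)) = 0 := f.2
      rw [this, map_zero])
  have hΦ : ∀ f, (Φ f).1 = P.dualE i f.1 := fun f => rfl
  refine ⟨e.symm.toLinearMap.comp (q.comp Φ), ?_, ?_⟩
  · refine e.symm.surjective.comp (hq.comp ?_)
    intro z
    refine ⟨⟨(P.dualE i).symm z.1, ?_⟩, ?_⟩
    · rw [mem_Z]
      apply (P.dualE (i + 1)).injective
      rw [← dualE_d, map_zero]
      have h1 : P.dualE i ((P.dualE i).symm z.1) = z.1 := (P.dualE i).apply_symm_apply _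
      have h2 : C.d i (i + 1) z.1 = 0 := z.2
      exact (congrArg (C.d i (i + 1)) h1).trans h2
    · apply Subtype.ext
      rw [hΦ]
      exact (P.dualE i).apply_symm_apply _
  · intro f
    refine (e.symm.map_eq_zero_iff (x := q (Φ f))).trans ?_
    rw [hq0, hr]
    rfl

lemma bridge (i : ℕ) :
    ∃ q : P.Z i →ₗ[B] extMod B (B ⧸ 𝔪) B i, Function.Surjective q ∧
      ∀ f, q f = 0 ↔ ∃ h, f.1 = act h (P.D i) := by
  cases i with
  | zero =>
    refine P.bridge_aux 0 0 CochainComplex.prev_nat_zero ?_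
    intro f
    rw [HomologicalComplex.shape _ _ _ (by simp)]
    have h0 : ∀ h : P.ι 0 → B, act h (P.D 0) = 0 := by
      intro h; funext c; simp [act]
    constructor
    · rintro ⟨h, rfl⟩
      refine ⟨0, ?_⟩
      rw [h0]; simp
    · rintro ⟨y, hy⟩
      refine ⟨0, ?_⟩
      rw [h0]
      apply (P.dualE 0).injective
      rw [← hy, map_zero]; rfl
  | succ i =>
    refine P.bridge_aux (i + 1) i (CochainComplex.prev_nat_succ i) ?_
    intro f
    constructor
    · rintro ⟨h, rfl⟩
      exact ⟨P.dualE i h, P.dualE_d i h⟩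
    · rintro ⟨y, hy⟩
      refine ⟨(P.dualE i).symm y, ?_⟩
      apply (P.dualE (i + 1)).injective
      rw [← hy, ← dualE_d, LinearEquiv.apply_symm_apply]

lemma dimLT_one_of_subsingleton (h𝔪 : (1 : B) ∉ 𝔪) (i : ℕ)
    (h : Subsingleton (extMod B (B ⧸ 𝔪) B i)) : P.DimLT B i 1 := by
  obtain ⟨q, hq, hq0⟩ := P.bridge i
  intro f hf
  obtain ⟨e, he⟩ := (hq0 ⟨f 0, hf 0⟩).mp (Subsingleton.elim _ _)
  exact ⟨fun _ => 1, ⟨0, h𝔪⟩, e, by simpa using he⟩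

lemma dimLT_two_of_equiv (i : ℕ) (h1 : (1 : B) ∉ 𝔪)
    (h : Nonempty (extMod B (B ⧸ 𝔪) B i ≃ₗ[B] (B ⧸ 𝔪))) : P.DimLT B i 2 := by
  obtain ⟨q, hq, hq0⟩ := P.bridge i
  obtain ⟨e⟩ := h
  intro f hf
  obtain ⟨b, hb⟩ := Submodule.mkQ_surjective 𝔪 (e (q ⟨f 0, hf 0⟩))
  obtain ⟨c, hc⟩ := Submodule.mkQ_surjective 𝔪 (e (q ⟨f 1, hf 1⟩))
  have key : ∀ a : Fin 2 → B, a 0 * b + a 1 * c ∈ 𝔪 →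
      ∃ h : P.ι i → B, (∑ l, a l • f l) = act h (P.D i) := by
    intro a ha
    have := (hq0 (a 0 • ⟨f 0, hf 0⟩ + a 1 • ⟨f 1, hf 1⟩)).mp (by
      apply e.injective
      rw [map_add, map_add, map_smul, map_smul, map_smul, map_smul, ← hb, ← hc, map_zero,
        ← map_smul, ← map_smul, ← map_add, Submodule.mkQ_apply, Submodule.Quotient.mk_eq_zero]
      exact ha)
    simpa [Fin.sum_univ_two] using this
  by_cases hbm : b ∈ 𝔪
  · refine ⟨![1, 0], ⟨0, by simpa using h1⟩, key _ (by simpa using hbm)⟩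
  · refine ⟨![c, -b], ⟨1, by simpa using hbm⟩, key _ (by
      simp only [Matrix.cons_val_zero, Matrix.cons_val_one]
      have : c * b + -b * c = 0 := by ring
      rw [this]; exact 𝔪.zero_mem)⟩

lemma not_subsingleton_of_equiv (h1 : (1 : B) ∉ 𝔪) (i : ℕ)
    (h : Nonempty (extMod B (B ⧸ 𝔪) B i ≃ₗ[B] (B ⧸ 𝔪))) : ¬ P.Van B i := by
  obtain ⟨q, hq, hq0⟩ := P.bridge i
  obtain ⟨e⟩ := h
  intro hv
  obtain ⟨x, hx⟩ := (e.surjective.comp hq) (Submodule.mkQ 𝔪 1)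
  have : q x = 0 := (hq0 x).mpr (hv x.1 x.2)
  simp only [Function.comp, this, map_zero] at hx
  apply h1
  rw [← Submodule.Quotient.mk_eq_zero 𝔪, ← Submodule.mkQ_apply, ← hx]

lemma subsingleton_of_van (i : ℕ) (h : P.Van B i) : Subsingleton (extMod B (B ⧸ 𝔪) B i) := by
  obtain ⟨q, hq, hq0⟩ := P.bridge i
  refine subsingleton_of_forall_eq 0 fun y => ?_
  obtain ⟨x, rfl⟩ := hq y
  exact (hq0 x).mpr (h x.1 x.2)

/-- if Ext is generated by one class that is nonzero, then it is `B/𝔪` (for maximal `𝔪`). -/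
lemma equiv_of_cyclic [𝔪.IsMaximal] (i : ℕ) (f : P.ι (i + 1) → B) (hf : act f (P.D (i + 1)) = 0)
    (hf0 : ¬ ∃ h, f = act h (P.D i))
    (hgen : ∀ g : P.ι (i + 1) → B, act g (P.D (i + 1)) = 0 →
      ∃ (a : B) (h : P.ι i → B), g = a • f + act h (P.D i)) :
    Nonempty (extMod B (B ⧸ 𝔪) B i ≃ₗ[B] (B ⧸ 𝔪)) := by
  obtain ⟨q, hq, hq0⟩ := P.bridge i
  let L : B →ₗ[B] extMod B (B ⧸ 𝔪) B i := LinearMap.toSpanSingleton B _ (q ⟨f, hf⟩)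
  have hL : Function.Surjective L := by
    intro y
    obtain ⟨g, rfl⟩ := hq y
    obtain ⟨a, h, hg⟩ := hgen g.1 g.2
    refine ⟨a, ?_⟩
    have : q (a • ⟨f, hf⟩ - g) = 0 := (hq0 _).mpr ⟨-h, by
      have := act_sub 0 h (P.D i)
      rw [zero_sub, act_zero] at this
      rw [this]
      change a • f - g.1 = _
      rw [hg]; abel⟩
    rw [map_sub, map_smul, sub_eq_zero] at this
    exact this
  have hker : LinearMap.ker L = 𝔪 := by
    symm
    apply Ideal.IsMaximal.eq_of_le inferInstance
    · intro ht
      apply hf0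
      rw [Ideal.eq_top_iff_one, LinearMap.mem_ker] at ht
      have : L 1 = q ⟨f, hf⟩ := by simp [L]
      rw [this] at ht
      exact (hq0 _).mp ht
    · intro t ht
      rw [LinearMap.mem_ker]
      change t • q ⟨f, hf⟩ = 0
      rw [← map_smul]
      exact (hq0 _).mpr (P.smul_cocycle t ht i f hf)
  exact ⟨(((Submodule.quotEquivOfEq _ _ hker).symm).trans (L.quotKerEquivOfSurjective hL)).symm⟩

end Res
end GP


set_option linter.unusedSectionVars false
set_option linter.unusedSimpArgs false
set_option linter.unusedVariables false

namespace GP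
namespace Res

variable {B : Type} [CommRing B]

lemma exists_gens [IsNoetherianRing B] {a : ℕ} (N : Submodule B (Fin a → B)) :
    ∃ (c : ℕ) (M : Matrix (Fin a) (Fin c) B), ∀ v, v ∈ N ↔ ∃ w, v = M.mulVec w := by
  obtain ⟨c, s, hs⟩ := Submodule.fg_iff_exists_fin_generating_family.mp
    (IsNoetherian.noetherian N)
  refine ⟨c, Matrix.of fun r j => s j r, fun v => ?_⟩
  rw [← hs, Submodule.mem_span_range_iff_exists_fun]
  refine exists_congr fun w => ?_
  have : (Matrix.of fun r j => s j r).mulVec w = ∑ i, w i • s i := by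
    funext r
    simp [Matrix.mulVec, dotProduct, mul_comm]
  rw [this]
  exact eq_comm

abbrev Dat (B : Type) := Σ (a b : ℕ), Matrix (Fin a) (Fin b) B

noncomputable def nextDat [IsNoetherianRing B] (s : Dat B) : Dat B :=
  ⟨s.2.1, (exists_gens (LinearMap.ker s.2.2.mulVecLin)).choose,
    (exists_gens (LinearMap.ker s.2.2.mulVecLin)).choose_spec.choose⟩

lemma nextDat_spec [IsNoetherianRing B] (s : Dat B) (v : Fin s.2.1 → B) :
    s.2.2.mulVec v = 0 ↔ ∃ w, v = (nextDat s).2.2.mulVec w :=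
  (exists_gens (LinearMap.ker s.2.2.mulVecLin)).choose_spec.choose_spec v

variable (𝔪 : Ideal B)

lemma exists_start [IsNoetherianRing B] :
    ∃ (c : ℕ) (M : Matrix (Fin 1) (Fin c) B), ∀ v : Fin 1 → B, v 0 ∈ 𝔪 ↔ ∃ w, v = M.mulVec w := by
  obtain ⟨c, M, h⟩ := exists_gens (Submodule.comap (LinearMap.proj (R := B)
    (φ := fun _ : Fin 1 => B) 0) 𝔪)
  exact ⟨c, M, h⟩

noncomputable def datSeq [IsNoetherianRing B] : ℕ → Dat B
  | 0 => ⟨1, (exists_start 𝔪).choose, (exists_start 𝔪).choose_spec.choose⟩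
  | i + 1 => nextDat (datSeq i)

def rι [IsNoetherianRing B] : ℕ → Type
  | 0 => Fin 0
  | i + 1 => Fin (datSeq 𝔪 i).1

noncomputable def rD [IsNoetherianRing B] : ∀ i, Matrix (rι 𝔪 i) (rι 𝔪 (i + 1)) B
  | 0 => fun _ _ => 0
  | i + 1 => (datSeq 𝔪 i).2.2

noncomputable instance rFin [IsNoetherianRing B] : ∀ i, Fintype (rι 𝔪 i)
  | 0 => inferInstanceAs (Fintype (Fin 0))
  | i + 1 => inferInstanceAs (Fintype (Fin (datSeq 𝔪 i).1))

noncomputable instance rDec [IsNoetherianRing B] : ∀ i, DecidableEq (rι 𝔪 i)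
  | 0 => inferInstanceAs (DecidableEq (Fin 0))
  | i + 1 => inferInstanceAs (DecidableEq (Fin (datSeq 𝔪 i).1))

instance rEmp [IsNoetherianRing B] : IsEmpty (rι 𝔪 0) := inferInstanceAs (IsEmpty (Fin 0))

noncomputable instance rUni [IsNoetherianRing B] : Unique (rι 𝔪 1) :=
  inferInstanceAs (Unique (Fin 1))

theorem exists_res [IsNoetherianRing B] : Nonempty (Res B 𝔪) := by
  refine ⟨⟨rι 𝔪, rD 𝔪, ?_, ?_⟩⟩
  · exact (exists_start 𝔪).choose_spec.choose_spec
  · intro i v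
    exact nextDat_spec (datSeq 𝔪 i) v

end Res
end GP


set_option linter.unusedSectionVars false
set_option linter.unusedSimpArgs false
set_option linter.unusedVariables false

namespace GP

/-- elementwise flatness -/
def FL {T A : Type} [CommRing T] [CommRing A] (φ : T →+* A) : Prop :=
  ∀ (ι κ : Type) [Fintype ι] [Fintype κ] (N : Matrix ι κ T) (u : κ → A),
    (N.map φ).mulVec u = 0 → ∃ (J : Type) (_ : Fintype J) (a : J → A) (w : J → κ → T),
      (∀ j, N.mulVec (w j) = 0) ∧ ∀ c, u c = ∑ j, a j * φ (w j c)

lemma FL_of {s T R A : Type} [CommRing T] [CommRing R] [CommRing A]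
    (ψ : R →+* MvPolynomial s T) (hψ : Function.Surjective ψ) (Φ : MvPolynomial s T →+* A)
    [Algebra R A] (M : Submonoid R) [IsLocalization M A]
    (hΦ : ∀ r, Φ (ψ r) = algebraMap R A r) : FL (Φ.comp MvPolynomial.C) := by
  classical
  intro ι κ _ _ N u hu
  obtain ⟨b, hb⟩ := IsLocalization.exist_integer_multiples_of_finite M u
  choose r hr using hb
  have hr' : ∀ c, algebraMap R A (r c) = algebraMap R A b * u c := by
    intro c; rw [hr c, Algebra.smul_def]
  let y : κ → MvPolynomial s T := fun c => ψ (r c)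
  have hz : ∀ i, ∃ q : M, ψ q * (∑ c, MvPolynomial.C (N i c) * y c) = 0 := by
    intro i
    obtain ⟨ρ, hρ⟩ := hψ (∑ c, MvPolynomial.C (N i c) * y c)
    have h0 : algebraMap R A ρ = 0 := by
      rw [← hΦ, hρ, map_sum]
      have := congrFun hu i
      simp only [Matrix.mulVec, dotProduct, Matrix.map_apply, RingHom.comp_apply,
        Pi.zero_apply] at this
      calc _ = ∑ c, Φ (MvPolynomial.C (N i c)) * (algebraMap R A b * u c) := by
            refine Finset.sum_congr rfl fun c _ => ?_
            rw [map_mul, ← hr', ← hΦ]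
        _ = algebraMap R A b * ∑ c, Φ (MvPolynomial.C (N i c)) * u c := by
            rw [Finset.mul_sum]
            exact Finset.sum_congr rfl fun c _ => by ring
        _ = 0 := by rw [this, mul_zero]
    obtain ⟨q, hq⟩ := (IsLocalization.map_eq_zero_iff M A ρ).mp h0
    refine ⟨q, ?_⟩
    rw [← hρ, ← map_mul, hq, map_zero]
  choose q hq using hz
  let Q : M := ∏ i, q i
  have hQ : ∀ i, ψ Q * (∑ c, MvPolynomial.C (N i c) * y c) = 0 := by
    intro i
    have : (Q : R) = q i * ∏ j ∈ Finset.univ.erase i, (q j : R) := by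
      simp only [Q, Submonoid.coe_finsetProd]
      rw [Finset.mul_prod_erase Finset.univ (fun j => (q j : R)) (Finset.mem_univ i)]
    rw [this, map_mul]
    calc _ = (ψ (∏ j ∈ Finset.univ.erase i, (q j : R))) *
          (ψ (q i) * (∑ c, MvPolynomial.C (N i c) * y c)) := by ring
      _ = 0 := by rw [hq, mul_zero]
  let y' : κ → MvPolynomial s T := fun c => ψ Q * y c
  let S : Finset (s →₀ ℕ) := Finset.univ.biUnion fun c => (y' c).support
  have hunit : IsUnit (algebraMap R A (b * Q)) := IsLocalization.map_units A (b * Q)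
  obtain ⟨v, hv⟩ := hunit
  refine ⟨S, inferInstance, fun m => ↑v⁻¹ * Φ (MvPolynomial.monomial m.1 1),
    fun m c => MvPolynomial.coeff m.1 (y' c), ?_, ?_⟩
  · intro m
    funext i
    have := congrArg (MvPolynomial.coeff m.1) (hQ i)
    rw [Finset.mul_sum, MvPolynomial.coeff_sum] at this
    simp only [Matrix.mulVec, dotProduct, Pi.zero_apply]
    rw [MvPolynomial.coeff_zero] at this
    rw [← this]
    refine Finset.sum_congr rfl fun c _ => ?_
    rw [← MvPolynomial.coeff_C_mul]
    congr 1
    simp only [y']; ring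
  · intro c
    have h1 : Φ (y' c) = v * u c := by
      rw [hv, map_mul (algebraMap R A)]
      simp only [y', y]
      rw [map_mul, hΦ, hΦ, hr']; ring
    have h2 : y' c = ∑ m ∈ S, MvPolynomial.monomial m (MvPolynomial.coeff m (y' c)) := by
      conv_lhs => rw [MvPolynomial.as_sum (y' c)]
      apply Finset.sum_subset
      · exact Finset.subset_biUnion_of_mem (fun c => (y' c).support) (Finset.mem_univ c)
      · intro m _ hm
        rw [MvPolynomial.notMem_support_iff.mp hm, map_zero]
    have h3 : u c = ↑v⁻¹ * Φ (y' c) := by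
      rw [h1, ← mul_assoc, Units.inv_mul, one_mul]
    rw [h3, h2, map_sum, Finset.mul_sum, ← Finset.sum_coe_sort S]
    refine Finset.sum_congr rfl fun m _ => ?_
    rw [mul_assoc, RingHom.comp_apply, ← map_mul]
    congr 2
    rw [mul_comm, MvPolynomial.C_mul_monomial, mul_one]

namespace Res
variable {T A : Type} [CommRing T] [CommRing A] {𝔪 : Ideal T} (P : Res T 𝔪) {φ : T →+* A}

def base (hφ : FL φ) : Res A (𝔪.map φ) where
  ι := P.ι
  D i := (P.D i).map φ
  ex1 v := by
    constructor
    · intro hv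
      have : ∀ t ∈ 𝔪.map φ, ∃ w, (fun _ => t) = ((P.D 1).map φ).mulVec w := by
        intro t ht
        induction ht using Submodule.span_induction with
        | mem x hx =>
          obtain ⟨y, hy, rfl⟩ := hx
          obtain ⟨w, hw⟩ := (P.ex1 fun _ => y).mp hy
          refine ⟨fun c => φ (w c), ?_⟩
          funext r
          have := congrArg φ (congrFun hw r)
          simpa [Matrix.mulVec, dotProduct] using this
        | zero => exact ⟨0, by simp; rfl⟩
        | add x y _ _ hx hy =>
          obtain ⟨w, hw⟩ := hx
          obtain ⟨w', hw'⟩ := hy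
          refine ⟨w + w', ?_⟩
          rw [Matrix.mulVec_add, ← hw, ← hw']; rfl
        | smul a x _ hx =>
          obtain ⟨w, hw⟩ := hx
          refine ⟨a • w, ?_⟩
          rw [Matrix.mulVec_smul, ← hw]; rfl
      obtain ⟨w, hw⟩ := this _ hv
      refine ⟨w, ?_⟩
      rw [← hw]
      funext r
      rw [Subsingleton.elim r default]
    · rintro ⟨w, rfl⟩
      simp only [Matrix.mulVec, dotProduct, Matrix.map_apply]
      refine Ideal.sum_mem _ fun c _ => Ideal.mul_mem_right _ _ (Ideal.mem_map_of_mem φ ?_)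
      refine (P.ex1 (fun r => P.D 1 r c)).mpr ⟨Pi.single c 1, ?_⟩
      funext r
      simp
  ex i v := by
    constructor
    · intro hv
      obtain ⟨J, _, a, w, hw, hu⟩ := hφ _ _ _ v hv
      choose z hz using fun j => (P.ex i (w j)).mp (hw j)
      refine ⟨fun c => ∑ j, a j * φ (z j c), ?_⟩
      funext r
      rw [hu]
      simp only [Matrix.mulVec, dotProduct, Matrix.map_apply, Finset.mul_sum]
      rw [Finset.sum_comm]
      refine Finset.sum_congr rfl fun j _ => ?_
      rw [hz j]
      simp only [Matrix.mulVec, dotProduct, map_sum, map_mul, Finset.mul_sum]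
      refine Finset.sum_congr rfl fun _ _ => by ring
    · rintro ⟨w, rfl⟩
      rw [Matrix.mulVec_mulVec, ← Matrix.map_mul]
      have := P.D_mul (i + 1)
      rw [this]
      simp

lemma act_map {ι κ : Type} [Fintype ι] (f : ι → T) (D : Matrix ι κ T) :
    act (fun r => φ (f r)) (D.map φ) = fun c => φ (act f D c) := by
  funext c
  simp [act]

lemma dimLT_down (hφ : FL φ) (i r : ℕ) (h : (P.base hφ).DimLT A i r) : P.DimLT T i r := by
  intro f hf
  obtain ⟨a, ⟨l, hl⟩, e, he⟩ := h (fun l x => φ (f l x)) (by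
    intro l
    have := act_map (φ := φ) (f l) (P.D (i + 1))
    change act (fun r => φ (f l r)) ((P.D (i + 1)).map φ) = 0
    rw [this, hf]; funext c; simp)
  change P.ι i → A at e
  let N : Matrix (P.ι (i + 1)) (Fin r ⊕ P.ι i) T :=
    Matrix.of fun c x => Sum.elim (fun l => f l c) (fun y => - P.D i y c) x
  obtain ⟨J, _, b, w, hw, hu⟩ := hφ _ _ N (Sum.elim a e) (by
    funext c
    have := congrFun he c
    change (∑ l, a l • fun x => φ (f l x)) c = act e ((P.D i).map φ) c at this
    simp only [act, Finset.sum_apply, Pi.smul_apply, smul_eq_mul, Matrix.map_apply] at this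
    simp only [Matrix.mulVec, dotProduct, Matrix.map_apply, Fintype.sum_sum_type, N,
      Matrix.of_apply, Sum.elim_inl, Sum.elim_inr, Pi.zero_apply, map_neg, neg_mul,
      Finset.sum_neg_distrib]
    rw [← this, add_neg_eq_zero]
    exact Finset.sum_congr rfl fun _ _ => mul_comm _ _)
  have hj : ∃ j, w j (Sum.inl l) ∉ 𝔪 := by
    by_contra hcon
    push Not at hcon
    apply hl
    have := hu (Sum.inl l)
    simp only [Sum.elim_inl] at this
    rw [this]
    exact Ideal.sum_mem _ fun j _ => Ideal.mul_mem_left _ _ (Ideal.mem_map_of_mem φ (hcon j))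
  obtain ⟨j, hj⟩ := hj
  refine ⟨fun l => w j (Sum.inl l), ⟨l, hj⟩, fun y => w j (Sum.inr y), ?_⟩
  funext c
  have := congrFun (hw j) c
  simp only [Matrix.mulVec, dotProduct, Fintype.sum_sum_type, N,
      Matrix.of_apply, Sum.elim_inl, Sum.elim_inr, Pi.zero_apply, neg_mul,
      Finset.sum_neg_distrib, add_neg_eq_zero] at this
  simp only [act, Finset.sum_apply, Pi.smul_apply, smul_eq_mul]
  rw [← this]
  exact Finset.sum_congr rfl fun _ _ => mul_comm _ _

lemma van_up (hφ : FL φ) (i : ℕ) (h : P.Van T i) : (P.base hφ).Van A i := by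
  intro f hf
  change P.ι (i + 1) → A at f
  change act f ((P.D (i + 1)).map φ) = 0 at hf
  obtain ⟨J, _, a, w, hw, hu⟩ := hφ _ _ (P.D (i + 1)).transpose f (by
    rw [act_eq_mulVec] at hf
    exact hf)
  choose z hz using fun j => h (w j) (by rw [act_eq_mulVec]; exact hw j)
  refine ⟨fun c => ∑ j, a j * φ (z j c), ?_⟩
  change f = act _ ((P.D i).map φ)
  funext c
  rw [hu]
  simp only [act, Matrix.map_apply, smul_eq_mul, Finset.mul_sum]
  rw [Finset.sum_comm]
  refine Finset.sum_congr rfl fun j _ => ?_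
  rw [hz j]
  simp only [act, map_sum, smul_eq_mul, map_mul, Finset.mul_sum]
  refine Finset.sum_congr rfl fun _ _ => by ring

end Res
end GP


set_option linter.unusedSectionVars false
set_option linter.unusedSimpArgs false
set_option linter.unusedVariables false

namespace GP

section SRbasic
variable (k : Type) [Field k] {n : ℕ} (Γ : SC n)

/-- A type synonym for the Stanley-Reisner ring. -/
def KR : Type := SRRing k Γ

noncomputable instance : CommRing (KR k Γ) := inferInstanceAs (CommRing (SRRing k Γ))
noncomputable instance : Algebra k (KR k Γ) := inferInstanceAs (Algebra k (SRRing k Γ))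
instance : IsNoetherianRing (KR k Γ) := inferInstanceAs (IsNoetherianRing (SRRing k Γ))

/-- the projection -/
noncomputable def mkR : MvPolynomial (Fin n) k →ₐ[k] KR k Γ := Ideal.Quotient.mkₐ k (srIdeal k Γ)

lemma mkR_surj : Function.Surjective (mkR k Γ) := Ideal.Quotient.mk_surjective

lemma mkR_zero {p : MvPolynomial (Fin n) k} (h : p ∈ srIdeal k Γ) : mkR k Γ p = 0 :=
  Ideal.Quotient.eq_zero_iff_mem.mpr h

/-- the image of a variable -/
noncomputable def xv (i : Fin n) : KR k Γ := mkR k Γ (MvPolynomial.X i)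

/-- the graded maximal ideal -/
noncomputable def kMax : Ideal (KR k Γ) := Ideal.span (Set.range (xv k Γ))

lemma prod_xv_eq_zero (τ : Finset (Fin n)) (h : τ ∉ Γ.faces) : ∏ i ∈ τ, xv k Γ i = 0 := by
  simp only [xv]
  rw [← map_prod]
  exact mkR_zero k Γ (Ideal.subset_span ⟨τ, h, rfl⟩)

variable {k Γ}

noncomputable def srLift {S : Type} [CommRing S] [Algebra k S] (f : Fin n → S)
    (hf : ∀ τ : Finset (Fin n), τ ∉ Γ.faces → ∏ i ∈ τ, f i = 0) : KR k Γ →ₐ[k] S :=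
  (Ideal.Quotient.liftₐ (srIdeal k Γ) (MvPolynomial.aeval f) (by
    intro a ha
    have : srIdeal k Γ ≤ RingHom.ker (MvPolynomial.aeval (R := k) f) := by
      rw [srIdeal, Ideal.span_le]
      rintro _ ⟨τ, hτ, rfl⟩
      simp only [SetLike.mem_coe, RingHom.mem_ker, map_prod, MvPolynomial.aeval_X]
      exact hf τ hτ
    exact this ha) : SRRing k Γ →ₐ[k] S)

@[simp] lemma srLift_xv {S : Type} [CommRing S] [Algebra k S] (f : Fin n → S)
    (hf : ∀ τ : Finset (Fin n), τ ∉ Γ.faces → ∏ i ∈ τ, f i = 0) (i : Fin n) :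
    srLift (k := k) f hf (xv k Γ i) = f i := by
  change MvPolynomial.aeval f (MvPolynomial.X i) = f i
  simp

lemma srLift_mk {S : Type} [CommRing S] [Algebra k S] (f : Fin n → S)
    (hf : ∀ τ : Finset (Fin n), τ ∉ Γ.faces → ∏ i ∈ τ, f i = 0) (p : MvPolynomial (Fin n) k) :
    srLift (k := k) f hf (mkR k Γ p) = MvPolynomial.aeval f p := rfl

lemma sr_hom_ext {S : Type} [CommRing S] [Algebra k S] {f g : KR k Γ →ₐ[k] S}
    (h : ∀ i, f (xv k Γ i) = g (xv k Γ i)) : f = g := by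
  have : f.comp (mkR k Γ) = g.comp (mkR k Γ) := by
    apply MvPolynomial.algHom_ext
    intro i
    exact h i
  apply AlgHom.ext
  intro r
  obtain ⟨p, rfl⟩ := mkR_surj k Γ r
  exact DFunLike.congr_fun this p

lemma sr_hom_ext' {S : Type} [CommRing S] [Algebra k S] {f g : KR k Γ →+* S}
    (hf : ∀ c, f (algebraMap k _ c) = algebraMap k S c)
    (hg : ∀ c, g (algebraMap k _ c) = algebraMap k S c)
    (h : ∀ i, f (xv k Γ i) = g (xv k Γ i)) (r : KR k Γ) : f r = g r := by
  let f' : KR k Γ →ₐ[k] S := { f with commutes' := hf }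
  let g' : KR k Γ →ₐ[k] S := { g with commutes' := hg }
  have : f' = g' := sr_hom_ext h
  exact DFunLike.congr_fun this r

lemma kMax_eq : kMax k Γ = Ideal.span (Set.range (xv k Γ)) := rfl

lemma xv_mem (i : Fin n) : xv k Γ i ∈ kMax k Γ := Ideal.subset_span ⟨i, rfl⟩

lemma vertex_ne_face {i : Fin n} (h : ({i} : Finset (Fin n)) ∉ Γ.faces) : xv k Γ i = 0 := by
  simpa using prod_xv_eq_zero k Γ {i} h

/-- sections : an ideal-theoretic induction. -/
lemma sub_mem_of_hom {I : Ideal (KR k Γ)} (f : KR k Γ →ₐ[k] KR k Γ)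
    (h : ∀ i, xv k Γ i - f (xv k Γ i) ∈ I) (r : KR k Γ) : r - f r ∈ I := by
  have : (Ideal.Quotient.mkₐ k I) = (Ideal.Quotient.mkₐ k I).comp f := by
    apply sr_hom_ext
    intro i
    exact Ideal.Quotient.eq.mpr (h i)
  have h2 := DFunLike.congr_fun this r
  exact Ideal.Quotient.eq.mp h2

/-- face evaluation -/
noncomputable def fEv (k : Type) [Field k] (Γ : SC n) (σ : Finset (Fin n)) (hσ : σ ∈ Γ.faces) :
    KR k Γ →ₐ[k] MvPolynomial (Fin n) k :=
  srLift (fun i => if i ∈ σ then MvPolynomial.X i else 0) (by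
    intro τ hτ
    have : ¬ τ ⊆ σ := fun h => hτ (Γ.down_closed hσ h)
    obtain ⟨i, hi, his⟩ := Finset.not_subset.mp this
    exact Finset.prod_eq_zero hi (by simp [his]))

lemma fEv_xv (σ : Finset (Fin n)) (hσ : σ ∈ Γ.faces) (i : Fin n) :
    fEv k Γ σ hσ (xv k Γ i) = if i ∈ σ then MvPolynomial.X i else 0 := srLift_xv _ _ _

/-- face prime -/
noncomputable def fP (k : Type) [Field k] (Γ : SC n) (σ : Finset (Fin n)) (hσ : σ ∈ Γ.faces) :
    Ideal (KR k Γ) := RingHom.ker (fEv k Γ σ hσ)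

instance (σ : Finset (Fin n)) (hσ : σ ∈ Γ.faces) : (fP k Γ σ hσ).IsPrime :=
  RingHom.ker_isPrime _

lemma mem_fP (σ : Finset (Fin n)) (hσ : σ ∈ Γ.faces) (r : KR k Γ) :
    r ∈ fP k Γ σ hσ ↔ fEv k Γ σ hσ r = 0 := Iff.rfl

lemma xv_mem_fP (σ : Finset (Fin n)) (hσ : σ ∈ Γ.faces) (i : Fin n) :
    xv k Γ i ∈ fP k Γ σ hσ ↔ i ∉ σ := by
  rw [mem_fP, fEv_xv]
  split_ifs with h <;> simp [h]

lemma fP_eq_span (σ : Finset (Fin n)) (hσ : σ ∈ Γ.faces) :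
    fP k Γ σ hσ = Ideal.span (xv k Γ '' {i | i ∉ σ}) := by
  apply le_antisymm
  · intro r hr
    let s : MvPolynomial (Fin n) k →ₐ[k] KR k Γ := MvPolynomial.aeval (xv k Γ)
    have := sub_mem_of_hom (I := Ideal.span (xv k Γ '' {i | i ∉ σ}))
      (s.comp (fEv k Γ σ hσ)) (by
        intro i
        simp only [AlgHom.comp_apply, fEv_xv]
        split_ifs with h
        · simp [s]
        · rw [map_zero, sub_zero]
          exact Ideal.subset_span ⟨i, h, rfl⟩) r
    rw [mem_fP] at hr
    simpa [hr] using this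
  · rw [Ideal.span_le]
    rintro _ ⟨i, hi, rfl⟩
    exact (xv_mem_fP σ hσ i).mpr hi

lemma fP_empty : fP k Γ ∅ Γ.empty_mem = kMax k Γ := by
  rw [fP_eq_span, kMax_eq]
  congr 1
  ext; simp

lemma fP_ne (σ : Finset (Fin n)) (hσ : σ ∈ Γ.faces) (hne : σ ≠ ∅) :
    fP k Γ σ hσ ≠ kMax k Γ := by
  obtain ⟨i, hi⟩ := Finset.nonempty_iff_ne_empty.mpr hne
  intro h
  have : xv k Γ i ∈ kMax k Γ := xv_mem (k := k) (Γ := Γ) i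
  rw [← h, xv_mem_fP] at this
  exact this hi

lemma fP_homog (σ : Finset (Fin n)) (hσ : σ ∈ Γ.faces) :
    IsHomogIdeal k ((fP k Γ σ hσ).comap (mkR k Γ)) := by
  intro p hp d
  let F : MvPolynomial (Fin n) k →ₐ[k] MvPolynomial (Fin n) k :=
    MvPolynomial.aeval (fun i => if i ∈ σ then MvPolynomial.X i else 0)
  have hp' : F p = 0 := hp
  change F (MvPolynomial.homogeneousComponent d p) = 0
  have key : ∀ q, F (MvPolynomial.homogeneousComponent d q)
      = MvPolynomial.homogeneousComponent d (F q) := by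
    intro q
    induction q using MvPolynomial.induction_on' with
    | add p q hp hq => rw [map_add, map_add, map_add, map_add, hp, hq]
    | monomial m c =>
      have h1 : (MvPolynomial.monomial m c).IsHomogeneous m.degree :=
        MvPolynomial.isHomogeneous_monomial _ rfl
      have h2 : (F (MvPolynomial.monomial m c)).IsHomogeneous m.degree := by
        simp only [F, MvPolynomial.aeval_monomial]
        rw [← zero_add m.degree]
        refine MvPolynomial.IsHomogeneous.mul (MvPolynomial.isHomogeneous_C _ _) ?_
        rw [Finsupp.degree_apply]
        refine MvPolynomial.IsHomogeneous.prod _ _ _ fun i _ => ?_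
        dsimp only
        split_ifs
        · simpa using (MvPolynomial.isHomogeneous_X k i).pow (m i)
        · by_cases hm : m i = 0
          · rw [hm, pow_zero]; exact MvPolynomial.isHomogeneous_one _ _
          · rw [zero_pow hm]; exact MvPolynomial.isHomogeneous_zero _ _ _
      rw [MvPolynomial.homogeneousComponent_of_mem h1, MvPolynomial.homogeneousComponent_of_mem h2]
      split_ifs <;> simp
  rw [key, hp', map_zero]

/-- constant term -/
noncomputable def cT (k : Type) [Field k] (Γ : SC n) : KR k Γ →ₐ[k] k :=
  srLift (k := k) (Γ := Γ) (fun _ => (0 : k)) (by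
    intro τ hτ
    have : τ ≠ ∅ := fun h => hτ (h ▸ Γ.empty_mem)
    obtain ⟨i, hi⟩ := Finset.nonempty_iff_ne_empty.mpr this
    exact Finset.prod_eq_zero hi rfl)

lemma sub_cT_mem (r : KR k Γ) : r - algebraMap k _ (cT k Γ r) ∈ kMax k Γ := by
  refine sub_mem_of_hom ((Algebra.ofId k (KR k Γ)).comp (cT k Γ)) (fun i => ?_) r
  have : cT k Γ (xv k Γ i) = 0 := srLift_xv _ _ _
  rw [AlgHom.comp_apply, this, map_zero, sub_zero]
  exact xv_mem i

lemma mem_kMax_iff (r : KR k Γ) : r ∈ kMax k Γ ↔ cT k Γ r = 0 := by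
  constructor
  · intro h
    have : kMax k Γ ≤ RingHom.ker (cT k Γ) := by
      rw [kMax_eq, Ideal.span_le]
      rintro _ ⟨i, rfl⟩
      exact srLift_xv _ _ _
    exact this h
  · intro h
    have := sub_cT_mem r
    rwa [h, map_zero, sub_zero] at this

instance kMax_isMaximal : (kMax k Γ).IsMaximal := by
  have hs : Function.Surjective (cT k Γ : KR k Γ →+* k) := fun c =>
    ⟨algebraMap k _ c, (cT k Γ).commutes c⟩
  have := RingHom.ker_isMaximal_of_surjective _ hs
  have h2 : kMax k Γ = RingHom.ker (cT k Γ : KR k Γ →+* k) := by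
    ext r
    exact mem_kMax_iff r
  rw [h2]
  exact this

lemma one_notMem_kMax : (1 : KR k Γ) ∉ kMax k Γ := by
  rw [mem_kMax_iff, map_one]; exact one_ne_zero

end SRbasic
end GP


set_option linter.unusedSectionVars false
set_option linter.unusedSimpArgs false
set_option linter.unusedVariables false

namespace GP

section Loc
variable {k : Type} [Field k] {n : ℕ} {Δ : SC n}

lemma mem_link {σ : Finset (Fin n)} {hσ : σ ∈ Δ.faces} {τ : Finset (Fin n)} :
    τ ∈ (Δ.link σ hσ).faces ↔ Disjoint τ σ ∧ τ ∪ σ ∈ Δ.faces := by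
  simp only [SC.link, Finset.mem_filter, Finset.disjoint_iff_inter_eq_empty]
  exact ⟨fun h => h.2, fun h => ⟨Δ.down_closed h.2 Finset.subset_union_left, h⟩⟩

variable (σ : Finset (Fin n)) (hσ : σ ∈ Δ.faces)

noncomputable def psi : KR k Δ →ₐ[k] MvPolynomial {i // i ∈ σ} (KR k (Δ.link σ hσ)) :=
  srLift (fun i => if h : i ∈ σ then MvPolynomial.X ⟨i, h⟩ else MvPolynomial.C (xv k _ i)) (by
    intro τ hτ
    have h0 : (τ \ σ) ∉ (Δ.link σ hσ).faces := by
      rw [mem_link]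
      rintro ⟨_, h⟩
      exact hτ (Δ.down_closed h (by simp))
    have h1 : ∏ i ∈ τ \ σ, (if h : i ∈ σ then MvPolynomial.X ⟨i, h⟩ else
        MvPolynomial.C (xv k _ i) : MvPolynomial {i // i ∈ σ} (KR k (Δ.link σ hσ))) = 0 := by
      rw [Finset.prod_congr rfl (g := fun i => MvPolynomial.C (xv k _ i)), ← map_prod,
        prod_xv_eq_zero _ _ _ h0, map_zero]
      intro i hi
      rw [dif_neg (Finset.mem_sdiff.mp hi).2]
    rw [← Finset.prod_sdiff (Finset.inter_subset_left : τ ∩ σ ⊆ τ)]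
    rw [Finset.sdiff_inter_self_left, h1, zero_mul])

lemma psi_xv (i : Fin n) : psi (k := k) σ hσ (xv k Δ i) =
    if h : i ∈ σ then MvPolynomial.X ⟨i, h⟩ else MvPolynomial.C (xv k _ i) := srLift_xv _ _ _

lemma xv_link_eq_zero {i : Fin n} (hi : i ∈ σ) : xv k (Δ.link σ hσ) i = 0 := by
  apply vertex_ne_face
  rw [mem_link]
  rintro ⟨h, -⟩
  exact Finset.disjoint_left.mp h (Finset.mem_singleton_self i) hi

lemma psi_surj : Function.Surjective (psi (k := k) σ hσ) := by
  rw [← AlgHom.range_eq_top, eq_top_iff]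
  intro y _
  have hC : ∀ t : KR k (Δ.link σ hσ), MvPolynomial.C t ∈ (psi (k := k) σ hσ).range := by
    intro t
    obtain ⟨p, rfl⟩ := mkR_surj k _ t
    induction p using MvPolynomial.induction_on with
    | C c => exact Subalgebra.algebraMap_mem _ c
    | add p q hp hq => rw [map_add, map_add]; exact Subalgebra.add_mem _ hp hq
    | mul_X p i hp =>
      rw [map_mul, map_mul]
      refine Subalgebra.mul_mem _ hp ?_
      by_cases hi : i ∈ σ
      · have := xv_link_eq_zero (k := k) σ hσ hi
        rw [xv] at this
        rw [this, map_zero]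
        exact Subalgebra.zero_mem _
      · refine ⟨xv k Δ i, ?_⟩
        change psi (k := k) σ hσ _ = _
        rw [psi_xv, dif_neg hi]; rfl
  induction y using MvPolynomial.induction_on with
  | C t => exact hC t
  | add p q hp hq => exact Subalgebra.add_mem _ (hp trivial) (hq trivial)
  | mul_X p i hp =>
    refine Subalgebra.mul_mem _ (hp trivial) ⟨xv k Δ i, ?_⟩
    change psi (k := k) σ hσ _ = _
    rw [psi_xv, dif_pos i.2]

variable {A : Type} [CommRing A] [Algebra k A] [Algebra (KR k Δ) A]
  [IsScalarTower k (KR k Δ) A]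

noncomputable def phi (hu : ∀ i ∈ σ, IsUnit (algebraMap (KR k Δ) A (xv k Δ i))) :
    KR k (Δ.link σ hσ) →ₐ[k] A :=
  srLift (fun i => if i ∈ σ then 0 else algebraMap _ A (xv k Δ i)) (by
    intro τ hτ
    by_cases hd : Disjoint τ σ
    · have h1 : τ ∪ σ ∉ Δ.faces := fun h => hτ (mem_link.mpr ⟨hd, h⟩)
      have h2 := congrArg (algebraMap (KR k Δ) A) (prod_xv_eq_zero k Δ _ h1)
      rw [Finset.prod_union hd, map_mul, map_zero] at h2
      have h3 : IsUnit (algebraMap (KR k Δ) A (∏ i ∈ σ, xv k Δ i)) := by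
        rw [map_prod]
        exact (IsUnit.prod_iff).mpr hu
      rw [h3.mul_left_eq_zero, map_prod] at h2
      rw [← h2]
      refine Finset.prod_congr rfl fun i hi => ?_
      rw [if_neg (Finset.disjoint_left.mp hd hi)]
    · rw [Finset.not_disjoint_iff] at hd
      obtain ⟨i, hi, his⟩ := hd
      exact Finset.prod_eq_zero hi (if_pos his))

lemma phi_xv (hu : ∀ i ∈ σ, IsUnit (algebraMap (KR k Δ) A (xv k Δ i))) (i : Fin n) :
    phi (k := k) σ hσ hu (xv k _ i) = if i ∈ σ then 0 else algebraMap _ A (xv k Δ i) :=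
  srLift_xv _ _ _

noncomputable def bigPhi (hu : ∀ i ∈ σ, IsUnit (algebraMap (KR k Δ) A (xv k Δ i))) :
    MvPolynomial {i // i ∈ σ} (KR k (Δ.link σ hσ)) →+* A :=
  MvPolynomial.eval₂Hom (phi (k := k) σ hσ hu : _ →+* A) fun i => algebraMap _ A (xv k Δ i.1)

lemma bigPhi_C (hu : ∀ i ∈ σ, IsUnit (algebraMap (KR k Δ) A (xv k Δ i)))
    (t : KR k (Δ.link σ hσ)) :
    bigPhi (k := k) σ hσ hu (MvPolynomial.C t) = phi (k := k) σ hσ hu t :=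
  MvPolynomial.eval₂Hom_C _ _ t

lemma psi_alg (c : k) : psi (k := k) σ hσ (algebraMap k (KR k Δ) c) =
    MvPolynomial.C (algebraMap k (KR k (Δ.link σ hσ)) c) :=
  ((psi (k := k) σ hσ).commutes c).trans
    (IsScalarTower.algebraMap_apply k (KR k (Δ.link σ hσ))
      (MvPolynomial {i // i ∈ σ} (KR k (Δ.link σ hσ))) c)

lemma bigPhi_psi (hu : ∀ i ∈ σ, IsUnit (algebraMap (KR k Δ) A (xv k Δ i))) (r : KR k Δ) :
    bigPhi (k := k) σ hσ hu (psi (k := k) σ hσ r) = algebraMap _ A r := by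
  have h0 : ∀ r, ((bigPhi (k := k) σ hσ hu).comp (psi (k := k) σ hσ : KR k Δ →+* _)) r =
      bigPhi (k := k) σ hσ hu (psi (k := k) σ hσ r) := fun r => rfl
  have key := sr_hom_ext' (f := (bigPhi (k := k) σ hσ hu).comp
    (psi (k := k) σ hσ : KR k Δ →+* _)) (g := algebraMap _ A)
  rw [← h0]
  refine key ?_ ?_ ?_ r
  · intro c
    rw [h0, psi_alg, bigPhi_C]
    exact AlgHom.commutes _ _
  · intro c
    exact (IsScalarTower.algebraMap_apply k (KR k Δ) A c).symm
  · intro i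
    rw [h0, psi_xv]
    split_ifs with h
    · rw [bigPhi, MvPolynomial.eval₂Hom_X']
    · rw [bigPhi_C, phi_xv, if_neg h]

lemma bigPhi_comp_C (hu : ∀ i ∈ σ, IsUnit (algebraMap (KR k Δ) A (xv k Δ i))) :
    (bigPhi (k := k) σ hσ hu).comp MvPolynomial.C = (phi (k := k) σ hσ hu).toRingHom :=
  RingHom.ext fun t => bigPhi_C σ hσ hu t

lemma phi_FL (M : Submonoid (KR k Δ)) [IsLocalization M A]
    (hu : ∀ i ∈ σ, IsUnit (algebraMap (KR k Δ) A (xv k Δ i))) :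
    FL (phi (k := k) σ hσ hu).toRingHom := by
  rw [← bigPhi_comp_C]
  exact FL_of (psi (k := k) σ hσ).toRingHom (psi_surj (k := k) σ hσ)
    (bigPhi (k := k) σ hσ hu) M (bigPhi_psi (k := k) σ hσ hu)

theorem loc_FL (A : Type) [CommRing A] [Algebra k A] [Algebra (KR k Δ) A]
    [IsScalarTower k (KR k Δ) A] [IsLocalRing A] [IsLocalization.AtPrime A (fP k Δ σ hσ)] :
    ∃ φ : KR k (Δ.link σ hσ) →+* A, FL φ ∧
      (kMax k (Δ.link σ hσ)).map φ = IsLocalRing.maximalIdeal A := by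
  have hu : ∀ i ∈ σ, IsUnit (algebraMap (KR k Δ) A (xv k Δ i)) := by
    intro i hi
    exact IsLocalization.map_units (M := (fP k Δ σ hσ).primeCompl) _
      ⟨xv k Δ i, fun h => (xv_mem_fP σ hσ i).mp h hi⟩
  refine ⟨_, phi_FL σ hσ (fP k Δ σ hσ).primeCompl hu, ?_⟩
  rw [← IsLocalization.AtPrime.map_eq_maximalIdeal (fP k Δ σ hσ) A, fP_eq_span, kMax_eq,
    Ideal.map_span, Ideal.map_span]
  apply le_antisymm
  · rw [Ideal.span_le]
    rintro _ ⟨_, ⟨i, rfl⟩, rfl⟩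
    change phi (k := k) σ hσ hu _ ∈ _
    rw [phi_xv]
    split_ifs with h
    · exact Ideal.zero_mem _
    · exact Ideal.subset_span ⟨_, ⟨i, h, rfl⟩, rfl⟩
  · rw [Ideal.span_le]
    rintro _ ⟨_, ⟨i, hi, rfl⟩, rfl⟩
    refine Ideal.subset_span ⟨_, ⟨i, rfl⟩, ?_⟩
    change phi (k := k) σ hσ hu _ = _
    rw [phi_xv, if_neg hi]

end Loc
end GP


set_option linter.unusedSectionVars false
set_option linter.unusedSimpArgs false
set_option linter.unusedVariables false

namespace GP

/-- Gorenstein-like numerical conditions in terms of a resolution -/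
structure Res.Gor {B : Type} [CommRing B] {𝔪 : Ideal B} (P : Res B 𝔪) (e : ℕ) : Prop where
  one : ∀ i, i ≠ e → P.DimLT B i 1
  two : P.DimLT B e 2
  nv : ¬ P.Van B e

lemma Res.van_of_dimLT {B N : Type} [CommRing B] {𝔪 : Ideal B} [h𝔪 : 𝔪.IsMaximal] (P : Res B 𝔪)
    [AddCommGroup N] [Module B N] (i : ℕ) (h : P.DimLT N i 1) : P.Van N i := by
  intro f hf
  obtain ⟨a, ⟨l, hl⟩, e, he⟩ := h (fun _ => f) (fun _ => hf)
  obtain ⟨b, t, ht, hbt⟩ := h𝔪.exists_inv hl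
  obtain rfl : l = 0 := Subsingleton.elim _ _
  obtain ⟨e', he'⟩ := P.smul_cocycle t ht i f hf
  refine ⟨b • e + e', ?_⟩
  rw [act_add, act_smul, ← he, ← he']
  simp only [Finset.univ_unique, Fin.default_eq_zero, Finset.sum_singleton, smul_smul, ← add_smul,
    hbt, one_smul]

lemma Res.dimLT_of_van {B N : Type} [CommRing B] {𝔪 : Ideal B} (h1 : (1 : B) ∉ 𝔪) (P : Res B 𝔪)
    [AddCommGroup N] [Module B N] (i : ℕ) (h : P.Van N i) : P.DimLT N i 1 := by
  intro f hf
  obtain ⟨e, he⟩ := h (f 0) (hf 0)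
  exact ⟨fun _ => 1, ⟨0, h1⟩, e, by simpa using he⟩

lemma gor_of_local {T A : Type} [CommRing T] [CommRing A] [IsLocalRing A] {𝔪 : Ideal T}
    (P : Res T 𝔪) (φ : T →+* A) (hφ : FL φ) (hm : 𝔪.map φ = IsLocalRing.maximalIdeal A)
    (hG : IsGorensteinAt A (IsLocalRing.maximalIdeal A)) (e : ℕ)
    (he : ringKrullDim A = (e : WithBot (WithTop ℕ))) : P.Gor e := by
  have h1 : (1 : A) ∉ 𝔪.map φ := by
    rw [hm, ← Ideal.ne_top_iff_one]
    exact Ideal.IsPrime.ne_top'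
  rw [← hm] at hG
  refine ⟨fun i hi => ?_, ?_, ?_⟩
  · apply P.dimLT_down hφ
    apply Res.dimLT_one_of_subsingleton _ h1
    apply (hG.2 i).2
    rw [he]
    intro h
    exact hi (by exact_mod_cast h)
  · apply P.dimLT_down hφ
    exact Res.dimLT_two_of_equiv _ _ h1 ((hG.2 e).1 he.symm)
  · intro hv
    exact Res.not_subsingleton_of_equiv (P.base hφ) h1 e ((hG.2 e).1 he.symm) (P.van_up hφ e hv)

end GP


set_option linter.unusedSectionVars false
set_option linter.unusedSimpArgs false
set_option linter.unusedVariables false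

namespace GP

section Krull
variable {k : Type} [Field k] {n : ℕ} {Δ : SC n}

lemma fP_lt {σ τ : Finset (Fin n)} (hσ : σ ∈ Δ.faces) (hτ : τ ∈ Δ.faces) (h : σ ⊂ τ) :
    fP k Δ τ hτ < fP k Δ σ hσ := by
  obtain ⟨hsub, i, hi, his⟩ := Finset.ssubset_iff_exists_cons_subset.mp h |> fun ⟨a, ha, h'⟩ =>
    (⟨(Finset.subset_cons _).trans h', a, h' (Finset.mem_cons_self _ _), ha⟩ :
      σ ⊆ τ ∧ ∃ i, i ∈ τ ∧ i ∉ σ)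
  refine lt_of_le_of_ne ?_ ?_
  · rw [fP_eq_span, Ideal.span_le]
    rintro _ ⟨j, hj, rfl⟩
    exact (xv_mem_fP σ hσ j).mpr fun hjs => hj (hsub hjs)
  · intro he
    have : xv k Δ i ∈ fP k Δ τ hτ := by rw [he]; exact (xv_mem_fP σ hσ i).mpr his
    exact (xv_mem_fP τ hτ i).mp this hi

lemma card_le_height (m : ℕ) : ∀ {σ τ : Finset (Fin n)} (hσ : σ ∈ Δ.faces) (hτ : τ ∈ Δ.faces)
    (h : σ ⊆ τ) (hm : τ.card = σ.card + m), (m : ℕ∞) ≤ (fP k Δ σ hσ).height := by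
  induction m with
  | zero => intros; simp
  | succ m ih =>
    intro σ τ hσ hτ h hm
    obtain ⟨i, hi, his⟩ : ∃ i ∈ τ, i ∉ σ := Finset.exists_mem_notMem_of_card_lt_card (by omega)
    have hsub : insert i σ ⊆ τ := Finset.insert_subset hi h
    have hf : insert i σ ∈ Δ.faces := Δ.down_closed hτ hsub
    have h1 := ih hf hτ hsub (by rw [Finset.card_insert_of_notMem his]; omega)
    have h2 := Ideal.height_add_one_le_of_lt_of_isPrime
      (fP_lt (k := k) hσ hf (Finset.ssubset_insert his))
    refine le_trans ?_ h2
    push_cast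
    gcongr

lemma dim_KR_ge (τ : Finset (Fin n)) (hτ : τ ∈ Δ.faces) :
    ((τ.card : ℕ) : WithBot (WithTop ℕ)) ≤ ringKrullDim (KR k Δ) := by
  have h1 := card_le_height (k := k) τ.card Δ.empty_mem hτ (Finset.empty_subset _) (by simp)
  refine le_trans ?_ (Ideal.height_le_ringKrullDim_of_isPrime (I := fP k Δ ∅ Δ.empty_mem))
  exact WithBot.coe_le_coe.mpr h1

lemma dim_quot (F : Finset (Fin n)) (hF : F ∈ Δ.faces) :
    ringKrullDim (KR k Δ ⧸ fP k Δ F hF) ≤ ((F.card : ℕ) : WithBot (WithTop ℕ)) := by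
  let g : MvPolynomial {i // i ∈ F} k →ₐ[k] (KR k Δ ⧸ fP k Δ F hF) :=
    MvPolynomial.aeval fun i => Ideal.Quotient.mk _ (xv k Δ i.1)
  have hg : Function.Surjective g := by
    intro y
    obtain ⟨r, rfl⟩ := Ideal.Quotient.mk_surjective y
    obtain ⟨p, rfl⟩ := mkR_surj k _ r
    suffices h : Ideal.Quotient.mk (fP k Δ F hF) (mkR k Δ p) ∈ g.range from h
    induction p using MvPolynomial.induction_on with
    | C c => exact Subalgebra.algebraMap_mem _ c
    | add p q hp hq => rw [map_add, map_add]; exact Subalgebra.add_mem _ hp hq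
    | mul_X p i hp =>
      rw [map_mul, map_mul]
      refine Subalgebra.mul_mem _ hp ?_
      by_cases hi : i ∈ F
      · refine ⟨MvPolynomial.X ⟨i, hi⟩, ?_⟩
        exact MvPolynomial.aeval_X _ _
      · have : Ideal.Quotient.mk (fP k Δ F hF) (mkR k Δ (MvPolynomial.X i)) = 0 :=
          Ideal.Quotient.eq_zero_iff_mem.mpr ((xv_mem_fP F hF i).mpr hi)
        rw [this]
        exact Subalgebra.zero_mem _
  refine (ringKrullDim_le_of_surjective g.toRingHom hg).trans ?_
  rw [MvPolynomial.ringKrullDim_of_isNoetherianRing, ringKrullDim_eq_zero_of_field]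
  simp
  rfl

lemma prime_ge_fP (q : Ideal (KR k Δ)) [q.IsPrime] : ∃ F, ∃ hF : F ∈ Δ.faces, fP k Δ F hF ≤ q := by
  classical
  let F : Finset (Fin n) := Finset.univ.filter fun i => xv k Δ i ∉ q
  have hF : F ∈ Δ.faces := by
    by_contra h
    have h0 : ∏ i ∈ F, xv k Δ i ∈ q := by rw [prod_xv_eq_zero k Δ _ h]; exact q.zero_mem
    obtain ⟨i, hi, hiq⟩ := (Ideal.IsPrime.prod_mem_iff).mp h0
    exact (Finset.mem_filter.mp hi).2 hiq
  refine ⟨F, hF, ?_⟩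
  rw [fP_eq_span, Ideal.span_le]
  rintro _ ⟨j, hj, rfl⟩
  by_contra h
  exact hj (Finset.mem_filter.mpr ⟨Finset.mem_univ _, h⟩)

lemma dim_KR_le (d : ℕ) (hd : ∀ τ ∈ Δ.faces, τ.card ≤ d) :
    ringKrullDim (KR k Δ) ≤ (d : WithBot (WithTop ℕ)) := by
  refine iSup_le fun l => ?_
  obtain ⟨F, hF, hle⟩ := prime_ge_fP (k := k) (Δ := Δ) l.head.asIdeal
  have h1 : ∀ i, l i ∈ PrimeSpectrum.zeroLocus (fP k Δ F hF : Set (KR k Δ)) := by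
    intro i r hr
    have : l.head ≤ l i := l.head_le i
    exact this (hle hr)
  let l' : LTSeries (PrimeSpectrum.zeroLocus (fP k Δ F hF : Set (KR k Δ))) :=
    { length := l.length
      toFun := fun i => ⟨l i, h1 i⟩
      step := fun i => l.step i }
  have h2 : (l.length : WithBot ℕ∞) ≤
      Order.krullDim (PrimeSpectrum.zeroLocus (fP k Δ F hF : Set (KR k Δ))) :=
    le_iSup (fun p : LTSeries (PrimeSpectrum.zeroLocus (fP k Δ F hF : Set (KR k Δ))) =>
      (p.length : WithBot ℕ∞)) l'
  rw [← ringKrullDim_quotient] at h2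
  refine h2.trans ((dim_quot F hF).trans ?_)
  change ((F.card : ℕ) : WithBot ℕ∞) ≤ ((d : ℕ) : WithBot ℕ∞)
  exact_mod_cast hd F hF

end Krull

section Inst
variable {k : Type} [Field k] {n : ℕ} {Δ : SC n}

theorem link_gor (hGP : GorensteinPunctured k (srIdeal k Δ)) (σ : Finset (Fin n))
    (hσ : σ ∈ Δ.faces) (hne : σ ≠ ∅) :
    ∃ e : ℕ, (∀ τ ∈ (Δ.link σ hσ).faces, τ.card ≤ e) ∧
      ∀ P : Res (KR k (Δ.link σ hσ)) (kMax k (Δ.link σ hσ)), P.Gor e := by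
  have hG : IsGorensteinLocalRing (Localization.AtPrime (fP k Δ σ hσ)) :=
    @hGP (fP k Δ σ hσ) (inferInstanceAs (fP k Δ σ hσ).IsPrime) (fP_homog σ hσ) (fP_ne σ hσ hne)
  have hN : IsNoetherianRing (Localization.AtPrime (fP k Δ σ hσ)) := hG.1
  have hfin : (fP k Δ σ hσ).height ≠ ⊤ := Ideal.height_ne_top_of_isPrime
  obtain ⟨e, he⟩ := ENat.ne_top_iff_exists.mp hfin
  have hdim := IsLocalization.AtPrime.ringKrullDim_eq_height (fP k Δ σ hσ)
    (Localization.AtPrime (fP k Δ σ hσ))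
  rw [← he] at hdim
  refine ⟨e, ?_, ?_⟩
  · intro τ hτ
    obtain ⟨h1, h2⟩ := mem_link.mp hτ
    have := card_le_height (k := k) τ.card hσ h2 Finset.subset_union_right
      (by rw [Finset.card_union_of_disjoint h1, add_comm])
    rw [← he] at this
    exact_mod_cast this
  · intro P
    obtain ⟨φ, hφ, hm⟩ := loc_FL (k := k) σ hσ (Localization.AtPrime (fP k Δ σ hσ))
    exact gor_of_local P φ hφ hm hG e hdim

end Inst
end GP


set_option linter.unusedSectionVars false
set_option linter.unusedSimpArgs false
set_option linter.unusedVariables false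

namespace GP

namespace Res

variable {T R : Type} [CommRing T] [CommRing R] {𝔪 : Ideal T} (P : Res T 𝔪)

def cι : ℕ → Type
  | 0 => Empty
  | i + 1 => P.ι (i + 1) ⊕ P.ι i

instance cFin : ∀ i, Fintype (P.cι i)
  | 0 => inferInstanceAs (Fintype Empty)
  | i + 1 => inferInstanceAs (Fintype (P.ι (i + 1) ⊕ P.ι i))

instance cDec : ∀ i, DecidableEq (P.cι i)
  | 0 => inferInstanceAs (DecidableEq Empty)
  | i + 1 => inferInstanceAs (DecidableEq (P.ι (i + 1) ⊕ P.ι i))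

instance cEmp : IsEmpty (P.cι 0) := inferInstanceAs (IsEmpty Empty)

instance cUni : Unique (P.cι 1) where
  default := (Sum.inl default : P.ι 1 ⊕ P.ι 0)
  uniq a := by
    change P.ι 1 ⊕ P.ι 0 at a
    rcases a with a | a
    · rw [Unique.eq_default a]
    · exact (IsEmpty.false a).elim

variable (φ : T →+* R) (ev : R →+* T) (x : R)

def cD : ∀ i, Matrix (P.cι i) (P.cι (i + 1)) R
  | 0 => fun a _ => (IsEmpty.false a).elim
  | i + 1 => Matrix.fromBlocks ((P.D (i + 1)).map φ)
      (((-1) ^ i * x) • (1 : Matrix (P.ι (i + 1)) (P.ι (i + 1)) R)) 0 ((P.D i).map φ)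

/-- pack two vectors -/
def pk (i : ℕ) (a : P.ι (i + 1) → R) (b : P.ι i → R) : P.cι (i + 1) → R :=
  (Sum.elim a b : P.ι (i + 1) ⊕ P.ι i → R)

lemma pk_ext (i : ℕ) {v w : P.cι (i + 1) → R}
    (h1 : ∀ c, v (Sum.inl c : P.ι (i + 1) ⊕ P.ι i) = w (Sum.inl c : P.ι (i + 1) ⊕ P.ι i))
    (h2 : ∀ c, v (Sum.inr c : P.ι (i + 1) ⊕ P.ι i) = w (Sum.inr c : P.ι (i + 1) ⊕ P.ι i)) :
    v = w := by
  funext c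
  change P.ι (i + 1) ⊕ P.ι i at c
  rcases c with c | c
  · exact h1 c
  · exact h2 c

lemma pk_fst (i : ℕ) {a a' : P.ι (i + 1) → R} {b b' : P.ι i → R}
    (h : P.pk i a b = P.pk i a' b') : a = a' :=
  funext fun c => congrFun h (Sum.inl c : P.ι (i + 1) ⊕ P.ι i)

lemma pk_snd (i : ℕ) {a a' : P.ι (i + 1) → R} {b b' : P.ι i → R}
    (h : P.pk i a b = P.pk i a' b') : b = b' :=
  funext fun c => congrFun h (Sum.inr c : P.ι (i + 1) ⊕ P.ι i)

lemma pk_zero (i : ℕ) : P.pk i 0 0 = (0 : P.cι (i + 1) → R) := P.pk_ext i (fun _ => rfl) fun _ => rfl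

lemma cD_mulVec (i : ℕ) (a : P.ι (i + 2) → R) (b : P.ι (i + 1) → R) :
    (P.cD φ x (i + 1)).mulVec (P.pk (i + 1) a b) =
      (P.pk i (((P.D (i + 1)).map φ).mulVec a + ((-1) ^ i * x) • b)
        (((P.D i).map φ).mulVec b)) := by
  refine (Matrix.fromBlocks_mulVec _ _ _ _ (Sum.elim a b)).trans ?_
  refine congrArg₂ (P.pk i) ?_ ?_
  · rw [Matrix.smul_mulVec, Matrix.one_mulVec, Sum.elim_comp_inl, Sum.elim_comp_inr]
  · rw [Matrix.zero_mulVec, zero_add, Sum.elim_comp_inr]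

lemma act_cD (i : ℕ) (f : P.ι (i + 1) → R) (g : P.ι i → R) :
    act (P.pk i f g) (P.cD φ x (i + 1)) =
      (P.pk (i + 1) (act f ((P.D (i + 1)).map φ))
        (((-1) ^ i * x) • f + act g ((P.D i).map φ))) := by
  have h1 : ∀ (A : Matrix (P.ι (i + 1)) (P.ι (i + 2)) R) (B : Matrix (P.ι (i + 1)) (P.ι (i + 1)) R)
      (C : Matrix (P.ι i) (P.ι (i + 2)) R) (E : Matrix (P.ι i) (P.ι (i + 1)) R),
      act (Sum.elim f g) (Matrix.fromBlocks A B C E) =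
        Sum.elim (act f A + act g C) (act f B + act g E) := by
    intro A B C E
    funext c
    rcases c with c | c <;> simp [act]
  refine (h1 _ _ _ _).trans (congrArg₂ (P.pk (i + 1)) ?_ ?_)
  · rw [act_mat_zero, add_zero]
  · rw [act_smul_one]

lemma sum_elim_cases (i : ℕ) (v : P.cι (i + 1) → R) :
    ∃ (a : P.ι (i + 1) → R) (b : P.ι i → R), v = (P.pk i a b) :=
  ⟨fun r => v (Sum.inl r : P.ι (i + 1) ⊕ P.ι i), fun r => v (Sum.inr r : P.ι (i + 1) ⊕ P.ι i),
    (Sum.elim_comp_inl_inr (v : P.ι (i + 1) ⊕ P.ι i → R)).symm⟩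

variable {φ ev x}

lemma ev_mulVec (hev : ∀ t, ev (φ t) = t) {ι κ : Type} [Fintype κ] (D : Matrix ι κ T) (v : κ → R) :
    (fun r => ev ((D.map φ).mulVec v r)) = D.mulVec fun c => ev (v c) := by
  funext r
  simp [Matrix.mulVec, dotProduct, hev]

lemma phi_mulVec {ι κ : Type} [Fintype κ] (D : Matrix ι κ T) (v : κ → T) :
    (D.map φ).mulVec (fun c => φ (v c)) = fun r => φ (D.mulVec v r) := by
  funext r
  simp [Matrix.mulVec, dotProduct]

lemma ev_act (hev : ∀ t, ev (φ t) = t) {ι κ : Type} [Fintype ι] (f : ι → R) (D : Matrix ι κ T) :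
    (fun r => ev (act f (D.map φ) r)) = act (fun c => ev (f c)) D := by
  funext r
  simp [act, hev]

lemma phi_act {ι κ : Type} [Fintype ι] (f : ι → T) (D : Matrix ι κ T) :
    act (fun c => φ (f c)) (D.map φ) = fun r => φ (act f D r) := by
  funext r
  simp [act]

variable (hev : ∀ t, ev (φ t) = t) (hx0 : ev x = 0) (hx : ∀ r, x * r = 0 → r = 0)
  (hdec : ∀ r, ∃ r', r = φ (ev r) + x * r')

lemma vdec (hdec : ∀ r, ∃ r', r = φ (ev r) + x * r') {ι : Type} (v : ι → R) :
    ∃ v', v = (fun c => φ (ev (v c))) + x • v' := by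
  choose v' hv' using fun c => hdec (v c)
  exact ⟨v', funext hv'⟩

lemma vcancel (hx : ∀ r, x * r = 0 → r = 0) {ι : Type} {v : ι → R} (h : x • v = 0) : v = 0 :=
  funext fun c => hx _ (congrFun h c)

/-- mapping cone resolution -/
def cone (hev : ∀ t, ev (φ t) = t) (hx0 : ev x = 0) (hx : ∀ r, x * r = 0 → r = 0)
    (hdec : ∀ r, ∃ r', r = φ (ev r) + x * r') : Res R (𝔪.comap ev) where
  ι := P.cι
  D := P.cD φ x
  ex1 v := by
    have key : ∀ a b, (P.cD φ x 1).mulVec (P.pk 1 a b) default =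
        ((P.D 1).map φ).mulVec a default + x * b default := by
      intro a b
      rw [cD_mulVec]
      change (((P.D 1).map φ).mulVec a + ((-1) ^ 0 * x) • b) default = _
      simp
    constructor
    · intro hv
      have hv' : ev (v default) ∈ 𝔪 := hv
      obtain ⟨w, hw⟩ := (P.ex1 fun _ => ev (v default)).mp hv'
      obtain ⟨r', hr'⟩ := hdec (v default)
      refine ⟨(P.pk 1 (fun c => φ (w c)) (fun _ => r')), ?_⟩
      funext c
      rw [Unique.eq_default c, key, phi_mulVec, ← hw, ← hr']
    · rintro ⟨w, rfl⟩
      obtain ⟨a, b, rfl⟩ := P.sum_elim_cases 1 w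
      rw [key, Ideal.mem_comap, map_add, map_mul, hx0, zero_mul, add_zero]
      rw [show ev (((P.D 1).map φ).mulVec a default) =
        (fun r => ev (((P.D 1).map φ).mulVec a r)) default from rfl, ev_mulVec hev]
      exact (P.ex1 _).mpr ⟨_, rfl⟩
  ex i v := by
    obtain ⟨a, b, rfl⟩ := P.sum_elim_cases (i + 1) v
    rw [cD_mulVec]
    have hs : ((-1 : R) ^ i) * (-1) ^ i = 1 := by
      rw [← mul_pow]; simp
    have hs' : ((-1 : R) ^ (i + 1)) = - (-1) ^ i := by ring
    have hDD : ∀ (j : ℕ) (d : P.ι (j + 2) → R),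
        ((P.D j).map φ).mulVec (((P.D (j + 1)).map φ).mulVec d) = 0 := by
      intro j d
      rw [Matrix.mulVec_mulVec, ← Matrix.map_mul, P.D_mul]
      simp
    constructor
    · intro h
      have h1 : ((P.D (i + 1)).map φ).mulVec a + ((-1) ^ i * x) • b = 0 :=
        P.pk_fst i (h.trans (P.pk_zero i).symm)
      have h2 : (P.D (i + 1)).mulVec (fun c => ev (a c)) = 0 := by
        rw [← ev_mulVec hev]
        funext c
        have := congrArg ev (congrFun h1 c)
        simpa [hx0] using this
      obtain ⟨c0, hc0⟩ := (P.ex i _).mp h2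
      obtain ⟨a', ha'⟩ := vdec hdec a
      have hc1 : (fun c => φ (ev (a c))) = ((P.D (i + 2)).map φ).mulVec fun c => φ (c0 c) := by
        rw [phi_mulVec]
        funext c
        rw [← hc0]
      rw [hc1] at ha'
      have h3 : x • (((P.D (i + 1)).map φ).mulVec a' + (-1 : R) ^ i • b) = 0 := by
        rw [← h1]
        conv_rhs => rw [ha']
        rw [Matrix.mulVec_add, hDD, Matrix.mulVec_smul, zero_add, smul_add, smul_smul, mul_comm x]
      have h4 := vcancel hx h3
      refine ⟨(P.pk (i + 2) (fun c => φ (c0 c)) (-((-1 : R) ^ i • a'))),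
        ?_⟩
      rw [cD_mulVec]
      congr 1
      · conv_lhs => rw [ha']
        congr 1
        rw [hs', smul_neg, smul_smul, ← neg_smul]
        congr 1
        linear_combination -x * hs
      · rw [Matrix.mulVec_neg, Matrix.mulVec_smul, eq_neg_of_add_eq_zero_left h4, smul_neg,
          smul_smul, hs, one_smul, neg_neg]
    · rintro ⟨w, hw⟩
      obtain ⟨c, d, rfl⟩ := P.sum_elim_cases (i + 2) w
      rw [cD_mulVec] at hw
      have e1 := P.pk_fst _ hw
      have e2 := P.pk_snd _ hw
      have e1' : a = ((P.D (i + 2)).map φ).mulVec c + ((-1) ^ (i + 1) * x) • d := e1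
      have e2' : b = ((P.D (i + 1)).map φ).mulVec d := e2
      have z2 : ((P.D i).map φ).mulVec b = 0 := by rw [e2', hDD]
      have z1 : ((P.D (i + 1)).map φ).mulVec a + ((-1) ^ i * x) • b = 0 := by
        rw [e1', e2', Matrix.mulVec_add, hDD, Matrix.mulVec_smul, zero_add, ← add_smul, hs']
        convert zero_smul R _ using 2
        ring
      rw [z1, z2, pk_zero]

/-- every cocycle is cohomologous to a constant one -/
lemma cone_reduce (i : ℕ) (f : P.ι (i + 2) → R) (g : P.ι (i + 1) → R)
    (h : act (P.pk (i + 1) f g) (P.cD φ x (i + 2)) = 0)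
    (hev : ∀ t, ev (φ t) = t) (hx0 : ev x = 0) (hx : ∀ r, x * r = 0 → r = 0)
    (hdec : ∀ r, ∃ r', r = φ (ev r) + x * r') :
    ∃ g0 : P.ι (i + 1) → T, act g0 (P.D (i + 1)) = 0 ∧ ∃ w : P.cι (i + 1) → R,
      (P.pk (i + 1) f g) =
        (P.pk (i + 1) 0 (fun c => φ (g0 c))) +
          act w (P.cD φ x (i + 1)) := by
  rw [act_cD] at h
  have h1 : ((-1) ^ (i + 1) * x) • f + act g ((P.D (i + 1)).map φ) = 0 :=
    P.pk_snd _ (h.trans (P.pk_zero (i + 2)).symm)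
  have h2 : act (fun c => ev (g c)) (P.D (i + 1)) = 0 := by
    rw [← ev_act hev]
    funext c
    have := congrArg ev (congrFun h1 c)
    simpa [hx0] using this
  have hs : ((-1 : R) ^ i) * (-1) ^ i = 1 := by
    rw [← mul_pow]; simp
  have hs' : ((-1 : R) ^ (i + 1)) = - (-1) ^ i := by ring
  obtain ⟨g', hg'⟩ := vdec hdec g
  refine ⟨fun c => ev (g c), h2, (P.pk i ((-1 : R) ^ i • g') 0), ?_⟩
  have h3 : x • (((-1 : R) ^ (i + 1)) • f + act g' ((P.D (i + 1)).map φ)) = 0 := by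
    rw [← h1]
    conv_rhs => rw [hg']
    rw [act_add, phi_act, h2, act_smul, smul_add, smul_smul, mul_comm x]
    congr 1
    funext c; simp
  have h4 := vcancel hx h3
  have h5 : f = ((-1 : R) ^ i) • act g' ((P.D (i + 1)).map φ) := by
    rw [eq_neg_of_add_eq_zero_right h4, hs', smul_neg, smul_smul]
    rw [show (-1 : R) ^ i * -(-1) ^ i = -1 by rw [mul_neg, hs]]
    simp
  rw [act_cD, act_smul, ← h5]
  refine P.pk_ext (i + 1) (fun c => ?_) fun c => ?_
  · change f c = 0 + f c
    rw [zero_add]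
  · change g c = φ (ev (g c)) + ((((-1) ^ i * x) • ((-1 : R) ^ i • g')) c +
      act (0 : P.ι i → R) ((P.D i).map φ) c)
    rw [act_zero, Pi.zero_apply, add_zero]
    conv_lhs => rw [hg']
    simp only [Pi.add_apply, Pi.smul_apply, smul_eq_mul]
    linear_combination -(x * g' c) * hs

lemma cone_bdry (i : ℕ) (h : P.ι i → T) :
    (P.pk (i + 1) 0 (fun c => φ (act h (P.D i) c))) =
      act (P.pk i 0 (fun c => φ (h c))) (P.cD φ x (i + 1)) := by
  rw [act_cD, phi_act, act_zero, smul_zero, zero_add]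

lemma gor_gen [h𝔪 : 𝔪.IsMaximal] {e : ℕ} (h : P.Gor e) :
    ∃ f : P.ι (e + 1) → T, act f (P.D (e + 1)) = 0 ∧ (¬ ∃ h, f = act h (P.D e)) ∧
      ∀ g : P.ι (e + 1) → T, act g (P.D (e + 1)) = 0 →
        ∃ (a : T) (h : P.ι e → T), g = a • f + act h (P.D e) := by
  have h0 := h.nv
  unfold Van at h0
  push Not at h0
  obtain ⟨f, hf, hf0⟩ := h0
  refine ⟨f, hf, fun ⟨w, hw⟩ => hf0 w hw, fun g hg => ?_⟩
  obtain ⟨a, hal, w, hw⟩ := h.two ![f, g] (by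
    intro l
    fin_cases l
    · exact hf
    · exact hg)
  simp only [Fin.sum_univ_two, Matrix.cons_val_zero, Matrix.cons_val_one] at hw
  have h1 : a 1 ∉ 𝔪 := by
    intro h1
    have h2 : a 0 ∉ 𝔪 := by
      rw [Fin.exists_fin_two] at hal
      exact hal.resolve_right (by simpa using h1)
    obtain ⟨b, t, ht, hbt⟩ := h𝔪.exists_inv h2
    obtain ⟨w1, hw1⟩ := P.smul_cocycle t ht e f hf
    obtain ⟨w2, hw2⟩ := P.smul_cocycle (a 1) h1 e g hg
    apply hf0 (b • (w - w2) + w1)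
    rw [act_add, act_smul, act_sub, ← hw1, ← hw2, ← hw, add_sub_cancel_right, smul_smul, ← add_smul,
      hbt, one_smul]
  obtain ⟨b, t, ht, hbt⟩ := h𝔪.exists_inv h1
  obtain ⟨w1, hw1⟩ := P.smul_cocycle t ht e g hg
  refine ⟨-(b * a 0), b • w + w1, ?_⟩
  rw [act_add, act_smul, ← hw1, ← hw, smul_add, smul_smul, smul_smul, neg_smul, ← add_assoc,
    neg_add_cancel_left, ← add_smul, hbt, one_smul]

end Res

theorem cone_gor {T R : Type} [CommRing T] [CommRing R] [IsNoetherianRing R] {𝔪 : Ideal T}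
    [h𝔪 : 𝔪.IsMaximal] (𝔫 : Ideal R) [h𝔫 : 𝔫.IsMaximal]
    (P : Res T 𝔪) (φ : T →+* R) (ev : R →+* T) (x : R) (hn : 𝔫 = 𝔪.comap ev)
    (hev : ∀ t, ev (φ t) = t) (hx0 : ev x = 0) (hx : ∀ r, x * r = 0 → r = 0)
    (hdec : ∀ r, ∃ r', r = φ (ev r) + x * r') (e : ℕ) (hP : P.Gor e)
    (hd : ringKrullDim R = ((e + 1 : ℕ) : WithBot (WithTop ℕ))) : IsGorensteinAt R 𝔫 := by
  subst hn
  refine ⟨inferInstance, fun i => ⟨fun hi => ?_, fun hi => ?_⟩⟩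
  · rw [hd] at hi
    obtain rfl : i = e + 1 := by exact_mod_cast hi
    obtain ⟨f, hf, hf0, hgen⟩ := P.gor_gen hP
    let Q : Res R (𝔪.comap ev) := P.cone hev hx0 hx hdec
    refine Q.equiv_of_cyclic (e + 1)
      (P.pk (e + 1) 0 (fun c => φ (f c))) ?_ ?_ ?_
    · refine (P.act_cD φ x (e + 1) 0 (fun c => φ (f c))).trans ?_
      rw [act_zero, smul_zero, zero_add, Res.phi_act, hf]
      refine P.pk_ext (e + 2) (fun c => ?_) fun c => ?_
      · rfl
      · exact map_zero φ
    · rintro ⟨w, hw⟩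
      obtain ⟨a, b, rfl⟩ := P.sum_elim_cases e w
      have hw' := hw.trans (P.act_cD φ x e a b)
      have h1 : (fun c => φ (f c)) = ((-1) ^ e * x) • a + act b ((P.D e).map φ) :=
        P.pk_snd _ hw'
      apply hf0
      refine ⟨fun c => ev (b c), ?_⟩
      rw [← Res.ev_act hev]
      funext c
      have := congrArg ev (congrFun h1 c)
      simpa [hx0, hev] using this
    · intro g hg
      obtain ⟨g1, g2, rfl⟩ := P.sum_elim_cases (e + 1) g
      obtain ⟨g0, hg0, w, hw⟩ := P.cone_reduce e g1 g2 hg hev hx0 hx hdec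
      obtain ⟨a, u, hu⟩ := hgen g0 hg0
      refine ⟨φ a, (P.pk e 0 (fun c => φ (u c))) + w, ?_⟩
      refine hw.trans ?_
      have e3 := act_add (P.pk e 0 (fun c => φ (u c))) w
        (P.cD φ x (e + 1))
      refine Eq.trans ?_ (congrArg (fun z => φ a • P.pk (e + 1) 0 (fun c => φ (f c)) + z) e3.symm)
      rw [← P.cone_bdry, ← add_assoc]
      congr 1
      refine P.pk_ext (e + 1) (fun c => ?_) fun c => ?_
      · change (0 : R) = φ a * 0 + 0
        simp
      · change φ (g0 c) = φ a * φ (f c) + φ _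
        rw [hu]
        simp
  · rw [hd] at hi
    let Q : Res R (𝔪.comap ev) := P.cone hev hx0 hx hdec
    apply Q.subsingleton_of_van
    cases i with
    | zero =>
      intro f hf
      obtain ⟨a, b, rfl⟩ := P.sum_elim_cases 0 f
      have hf' := (P.act_cD φ x 0 a b).symm.trans hf
      have h1 : ((-1) ^ 0 * x) • a + act b ((P.D 0).map φ) = 0 :=
        P.pk_snd _ (hf'.trans (P.pk_zero 1).symm)
      have hb : b = 0 := Subsingleton.elim _ _
      rw [hb, act_zero, pow_zero, one_mul, add_zero] at h1
      have ha := Res.vcancel hx h1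
      refine ⟨0, ?_⟩
      refine Eq.trans ?_ (act_zero _).symm
      rw [ha, hb, Res.pk_zero]
      rfl
    | succ i =>
      have hne : i ≠ e := by
        rintro rfl
        exact hi rfl
      have hv := P.van_of_dimLT i (hP.one i hne)
      intro g hg
      obtain ⟨g1, g2, rfl⟩ := P.sum_elim_cases (i + 1) g
      obtain ⟨g0, hg0, w, hw⟩ := P.cone_reduce i g1 g2 hg hev hx0 hx hdec
      obtain ⟨u, hu⟩ := hv g0 hg0
      refine ⟨(P.pk i 0 (fun c => φ (u c))) + w, ?_⟩
      refine hw.trans ?_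
      have e3 := act_add (P.pk i 0 (fun c => φ (u c))) w
        (P.cD φ x (i + 1))
      refine Eq.trans ?_ e3.symm
      rw [← P.cone_bdry, ← hu]

end GP


set_option linter.unusedSectionVars false
set_option linter.unusedSimpArgs false
set_option linter.unusedVariables false

namespace GP

section Cone
variable {k : Type} [Field k] {n : ℕ} {Δ : SC n} (w : Fin n) (hw : {w} ∈ Δ.faces)

noncomputable def cPhi (hc : ∀ τ ∈ Δ.faces, insert w τ ∈ Δ.faces) :
    KR k (Δ.link {w} hw) →ₐ[k] KR k Δ :=
  srLift (fun i => if i = w then 0 else xv k Δ i) (by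
    intro τ hτ
    by_cases hd : w ∈ τ
    · exact Finset.prod_eq_zero hd (if_pos rfl)
    · have h1 : τ ∉ Δ.faces := by
        intro h
        apply hτ
        rw [mem_link]
        refine ⟨Finset.disjoint_singleton_right.mpr hd, ?_⟩
        rw [Finset.union_comm]
        exact hc τ h
      rw [← prod_xv_eq_zero k Δ τ h1]
      refine Finset.prod_congr rfl fun i hi => ?_
      rw [if_neg (by rintro rfl; exact hd hi)])

lemma cPhi_xv (hc : ∀ τ ∈ Δ.faces, insert w τ ∈ Δ.faces) (i : Fin n) :
    cPhi (k := k) w hw hc (xv k _ i) = if i = w then 0 else xv k Δ i := srLift_xv _ _ _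

noncomputable def cEv : KR k Δ →ₐ[k] KR k (Δ.link {w} hw) :=
  srLift (fun i => xv k _ i) (by
    intro τ hτ
    apply prod_xv_eq_zero
    intro h
    exact hτ (Δ.down_closed (mem_link.mp h).2 Finset.subset_union_left))

lemma cEv_xv (i : Fin n) : cEv (k := k) w hw (xv k Δ i) = xv k _ i := srLift_xv _ _ _

lemma cEv_cPhi (hc : ∀ τ ∈ Δ.faces, insert w τ ∈ Δ.faces) (t : KR k (Δ.link {w} hw)) :
    cEv (k := k) w hw (cPhi (k := k) w hw hc t) = t := by
  have : (cEv (k := k) w hw).comp (cPhi (k := k) w hw hc) = AlgHom.id k _ := by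
    apply sr_hom_ext
    intro i
    rw [AlgHom.comp_apply, cPhi_xv]
    split_ifs with h
    · subst h
      rw [map_zero, AlgHom.id_apply, xv_link_eq_zero _ _ (Finset.mem_singleton_self i)]
    · rw [cEv_xv]; rfl
  exact DFunLike.congr_fun this t

lemma c_dec (hc : ∀ τ ∈ Δ.faces, insert w τ ∈ Δ.faces) (r : KR k Δ) :
    ∃ r', r = cPhi (k := k) w hw hc (cEv (k := k) w hw r) + xv k Δ w * r' := by
  have h := sub_mem_of_hom (I := Ideal.span {xv k Δ w}) ((cPhi (k := k) w hw hc).comp (cEv (k := k) w hw)) (by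
      intro i
      rw [AlgHom.comp_apply, cEv_xv, cPhi_xv]
      split_ifs with h
      · subst h
        rw [sub_zero]
        exact Ideal.subset_span rfl
      · rw [sub_self]; exact Ideal.zero_mem _) r
  obtain ⟨r', hr'⟩ := Ideal.mem_span_singleton'.mp h
  refine ⟨r', ?_⟩
  rw [mul_comm, hr']
  change r = _ + (r - _)
  exact (add_sub_cancel _ _).symm

lemma c_nzd (hw : {w} ∈ Δ.faces) (hc : ∀ τ ∈ Δ.faces, insert w τ ∈ Δ.faces) (r : KR k Δ) (hr : xv k Δ w * r = 0) :
    r = 0 := by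
  let Φ : MvPolynomial {i // i ∈ ({w} : Finset (Fin n))} (KR k (Δ.link {w} hw)) →+* KR k Δ :=
    MvPolynomial.eval₂Hom (cPhi (k := k) w hw hc).toRingHom fun i => xv k Δ i.1
  have hC : ∀ t, Φ (MvPolynomial.C t) = cPhi (k := k) w hw hc t := fun t =>
    MvPolynomial.eval₂Hom_C _ _ t
  have h0 : ∀ r, (Φ.comp (psi (k := k) {w} hw).toRingHom) r = Φ (psi (k := k) {w} hw r) :=
    fun r => rfl
  have key := sr_hom_ext' (f := Φ.comp (psi (k := k) {w} hw).toRingHom) (g := RingHom.id _)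
    (by
      intro c
      rw [h0, psi_alg, hC]
      exact AlgHom.commutes _ _)
    (by intro c; rfl)
    (by
      intro i
      rw [h0, psi_xv]
      split_ifs with h
      · exact MvPolynomial.eval₂Hom_X' _ _ _
      · rw [hC, cPhi_xv, if_neg (by simpa using h)]; rfl) r
  have h1 := congrArg (psi (k := k) {w} hw) hr
  rw [map_mul, psi_xv, dif_pos (Finset.mem_singleton_self w), map_zero, mul_comm] at h1
  have h2 : psi (k := k) {w} hw r = 0 := by
    have := MvPolynomial.isRegular_X (R := KR k (Δ.link {w} hw))
      (n := (⟨w, Finset.mem_singleton_self w⟩ : {i // i ∈ ({w} : Finset (Fin n))}))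
    exact this.right (by simpa using h1)
  rw [h0, h2, map_zero] at key
  exact key.symm

theorem cone_case (hc : ∀ τ ∈ Δ.faces, insert w τ ∈ Δ.faces) (e : ℕ)
    (hP : ∀ P : Res (KR k (Δ.link {w} hw)) (kMax k (Δ.link {w} hw)), P.Gor e)
    (hd : ringKrullDim (KR k Δ) = ((e + 1 : ℕ) : WithBot (WithTop ℕ))) :
    IsGorensteinAt (KR k Δ) (kMax k Δ) := by
  obtain ⟨P⟩ := Res.exists_res (kMax k (Δ.link {w} hw))
  refine cone_gor (kMax k Δ) P (cPhi (k := k) w hw hc).toRingHom (cEv (k := k) w hw).toRingHom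
    (xv k Δ w) ?_ (cEv_cPhi w hw hc) ?_ (c_nzd w hw hc) (c_dec w hw hc) e (hP P) hd
  · refine Ideal.IsMaximal.eq_of_le inferInstance (Ideal.IsPrime.ne_top inferInstance) ?_
    rw [kMax_eq, Ideal.span_le]
    rintro _ ⟨i, rfl⟩
    change cEv (k := k) w hw (xv k Δ i) ∈ kMax k (Δ.link {w} hw)
    rw [cEv_xv]
    exact xv_mem i
  · refine (cEv_xv w hw w).trans ?_
    exact xv_link_eq_zero _ _ (Finset.mem_singleton_self w)

end Cone
end GP


set_option linter.unusedSectionVars false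
set_option linter.unusedSimpArgs false
set_option linter.unusedVariables false

namespace GP

section Sign
variable {n : ℕ}

/-- the sign of a vertex in a face -/
def sg (v : Fin n) (G : Finset (Fin n)) : ℤ := (-1) ^ (G.filter (fun w => w < v)).card

lemma sg_sq (v : Fin n) (G : Finset (Fin n)) : sg v G * sg v G = 1 := by
  unfold sg
  rw [← mul_pow]; simp

lemma sg_swap_aux (u v : Fin n) (G : Finset (Fin n)) (hu : u ∈ G) (hv : v ∈ G) (h : u < v) :
    sg v G * sg u (G.erase v) = - (sg u G * sg v (G.erase u)) := by
  have h1 : (G.filter (fun w => w < v)).card = ((G.erase u).filter (fun w => w < v)).card + 1 := by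
    rw [Finset.filter_erase, Finset.card_erase_add_one]
    simp [hu, h]
  have h2 : ((G.erase v).filter (fun w => w < u)) = (G.filter (fun w => w < u)) := by
    rw [Finset.filter_erase, Finset.erase_eq_of_notMem]
    simp [h.le]
  unfold sg
  rw [h1, h2, pow_succ]
  ring

lemma sg_swap (u v : Fin n) (G : Finset (Fin n)) (hu : u ∈ G) (hv : v ∈ G) (h : u ≠ v) :
    sg v G * sg u (G.erase v) = - (sg u G * sg v (G.erase u)) := by
  rcases lt_or_gt_of_ne h with h | h
  · exact sg_swap_aux u v G hu hv h
  · rw [sg_swap_aux v u G hv hu h, neg_neg]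

lemma sg_swap' (u v : Fin n) (G : Finset (Fin n)) (hu : u ∈ G) (hv : v ∈ G) (h : u ≠ v) :
    sg u G * sg v G = - (sg v (G.erase u) * sg u (G.erase v)) := by
  have h1 := sg_swap u v G hu hv h
  have h2 := sg_sq u (G.erase v)
  calc sg u G * sg v G = sg u G * (sg v G * (sg u (G.erase v) * sg u (G.erase v))) := by
        rw [h2, mul_one]
    _ = sg u G * (sg v G * sg u (G.erase v)) * sg u (G.erase v) := by ring
    _ = - ((sg u G * sg u G) * (sg v (G.erase u) * sg u (G.erase v))) := by rw [h1]; ring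
    _ = _ := by rw [sg_sq, one_mul]

lemma sum_antisymm {ι M : Type} [DecidableEq ι] [AddCommGroup M] (s : Finset ι) (F : ι → ι → M)
    (h0 : ∀ v, F v v = 0) (h : ∀ u ∈ s, ∀ v ∈ s, u ≠ v → F u v = - F v u) :
    ∑ v ∈ s, ∑ u ∈ s, F v u = 0 := by
  rw [← Finset.sum_product']
  refine Finset.sum_involution (fun p _ => p.swap) ?_ ?_ ?_ ?_
  · rintro ⟨a, b⟩ hp
    simp only [Finset.mem_product] at hp
    by_cases e : a = b
    · subst e; simp [h0]
    · simp only [Prod.swap]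
      rw [h a hp.1 b hp.2 e, neg_add_cancel]
  · rintro ⟨a, b⟩ hp hne e
    simp only [Prod.swap, Prod.mk.injEq] at e
    rw [e.1] at hne
    exact hne (h0 _)
  · rintro ⟨a, b⟩ hp
    simp only [Finset.mem_product, Prod.swap] at hp ⊢
    exact ⟨hp.2, hp.1⟩
  · rintro ⟨a, b⟩ hp
    rfl
end Sign

section Tot
variable {R : Type} [CommRing R] {n : ℕ} {M : Finset (Fin n) → Type} [∀ G, AddCommGroup (M G)]
  [∀ G, Module R (M G)] (ρ : ∀ G G', M G →ₗ[R] M G')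

/-- total coboundary -/
def dl : (∀ G, M G) →ₗ[R] (∀ G, M G) where
  toFun y G := ∑ v ∈ G, sg v G • ρ (G.erase v) G (y (G.erase v))
  map_add' y z := by
    funext G
    simp only [Pi.add_apply, map_add, smul_add, Finset.sum_add_distrib]
  map_smul' a y := by
    funext G
    simp only [Pi.smul_apply, map_smul, RingHom.id_apply, Finset.smul_sum]
    refine Finset.sum_congr rfl fun v _ => ?_
    rw [smul_comm]

lemma dl_apply (y : ∀ G, M G) (G) :
    dl ρ y G = ∑ v ∈ G, sg v G • ρ (G.erase v) G (y (G.erase v)) := rfl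

lemma dl_dl (hρ : ∀ G G' G'', G ⊆ G' → G' ⊆ G'' → ∀ x, ρ G' G'' (ρ G G' x) = ρ G G'' x)
    (y : ∀ G, M G) : dl ρ (dl ρ y) = 0 := by
  funext G
  rw [dl_apply, Pi.zero_apply]
  let F : Fin n → Fin n → M G := fun v u => if v = u then 0 else
    (sg v G * sg u (G.erase v)) • ρ ((G.erase v).erase u) G (y ((G.erase v).erase u))
  rw [← sum_antisymm G F (fun v => if_pos rfl) ?_]
  · refine Finset.sum_congr rfl fun v hv => ?_
    rw [dl_apply, map_sum, Finset.smul_sum]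
    rw [← Finset.sum_erase G (a := v) (f := F v) (if_pos rfl)]
    refine Finset.sum_congr rfl fun u hu => ?_
    simp only [F]
    rw [if_neg (Finset.ne_of_mem_erase hu).symm, map_zsmul, mul_smul,
      hρ _ _ _ (Finset.erase_subset _ _) (Finset.erase_subset _ _)]
  · intro u hu v hv huv
    simp only [F]
    rw [if_neg huv, if_neg huv.symm, sg_swap v u G hv hu huv.symm, neg_smul,
      Finset.erase_right_comm]

/-- contraction lemma -/
lemma helperH (hρ : ∀ G G' G'', G ⊆ G' → G' ⊆ G'' → ∀ x, ρ G' G'' (ρ G G' x) = ρ G G'' x)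
    (hid : ∀ G x, ρ G G x = x) (q : ℕ)
    (z : ∀ G, M G) (hz : ∀ G, G.card = q + 1 → dl ρ z G = 0) (i : Fin n) (t : R)
    (y0 : ∀ G, M G)
    (hy : ∀ G, i ∉ G → ρ G (insert i G) (y0 G) = t • z (insert i G)) :
    ∃ y : ∀ G, M G, ∀ G, G.card = q → (i ∈ G → t • z G - dl ρ y G = 0) ∧
      (i ∉ G → ρ G (insert i G) (t • z G - dl ρ y G) = 0) := by
  classical
  let y : ∀ G, M G := fun G => if i ∈ G then 0 else sg i (insert i G) • y0 G
  have hA : ∀ G, i ∈ G → t • z G - dl ρ y G = 0 := by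
    intro G hi
    rw [dl_apply, Finset.sum_eq_single_of_mem i hi]
    · simp only [y, Finset.notMem_erase, if_false, map_zsmul]
      rw [smul_smul]
      have h1 := hy (G.erase i) (Finset.notMem_erase i G)
      rw [Finset.insert_erase hi] at h1 ⊢
      rw [h1, sg_sq, one_smul, sub_self]
    · intro v hv hvi
      have : i ∈ G.erase v := Finset.mem_erase.mpr ⟨hvi.symm, hi⟩
      simp only [y, this, if_true, map_zero, smul_zero]
  refine ⟨y, fun G hG => ⟨hA G, fun hi => ?_⟩⟩
  have h2 : dl ρ (t • z - dl ρ y) (insert i G) = 0 := by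
    rw [map_sub, map_smul, dl_dl ρ hρ, sub_zero, Pi.smul_apply, hz, smul_zero]
    rw [Finset.card_insert_of_notMem hi, hG]
  rw [dl_apply, Finset.sum_eq_single_of_mem i (Finset.mem_insert_self _ _),
    Finset.erase_insert hi] at h2
  · have h3 := congrArg (fun a => sg i (insert i G) • a) h2
    simp only [smul_smul, sg_sq, one_smul, smul_zero] at h3
    exact h3
  · intro v hv hvi
    have : i ∈ (insert i G).erase v := Finset.mem_erase.mpr ⟨hvi.symm, Finset.mem_insert_self _ _⟩
    have h4 := hA _ this
    rw [Pi.sub_apply, Pi.smul_apply, h4, map_zero, smul_zero]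

end Tot

section Const
variable {k : Type} [Field k] {n : ℕ}

/-- constant coefficient coboundary -/
def dk : (Finset (Fin n) → k) →ₗ[k] (Finset (Fin n) → k) :=
  dl (M := fun _ => k) (fun _ _ => LinearMap.id)

lemma dk_apply (c : Finset (Fin n) → k) (G) :
    dk c G = ∑ v ∈ G, sg v G • c (G.erase v) := rfl

lemma dk_dk (c : Finset (Fin n) → k) : dk (dk c) = 0 :=
  dl_dl (R := k) (M := fun _ : Finset (Fin n) => k) (fun _ _ => LinearMap.id)
    (fun _ _ _ _ _ _ => rfl) c

/-- cone homotopy -/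
def hk (i : Fin n) (c : Finset (Fin n) → k) : Finset (Fin n) → k :=
  fun G => if i ∈ G then 0 else sg i (insert i G) • c (insert i G)

lemma dk_hk (i : Fin n) (c : Finset (Fin n) → k) : dk (hk i c) + hk i (dk c) = c := by
  funext G
  rw [Pi.add_apply]
  by_cases hi : i ∈ G
  · have h1 : hk i (dk c) G = 0 := if_pos hi
    rw [h1, add_zero, dk_apply, Finset.sum_eq_single_of_mem i hi]
    · simp only [hk, Finset.notMem_erase, if_false]
      rw [Finset.insert_erase hi, smul_smul, sg_sq, one_smul]
    · intro v hv hvi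
      have : i ∈ G.erase v := Finset.mem_erase.mpr ⟨hvi.symm, hi⟩
      simp only [hk, this, if_true, smul_zero]
  · have h1 : hk i (dk c) G = sg i (insert i G) • dk c (insert i G) := if_neg hi
    rw [h1, dk_apply, dk_apply, Finset.sum_insert hi, Finset.erase_insert hi, smul_add, smul_smul,
      sg_sq, one_smul, add_comm, add_assoc, Finset.smul_sum, ← Finset.sum_add_distrib]
    rw [Finset.sum_eq_zero, add_zero]
    intro v hv
    have hvi : i ≠ v := by rintro rfl; exact hi hv
    have h2 : i ∉ G.erase v := fun h => hi (Finset.mem_of_mem_erase h)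
    simp only [hk, h2, if_false]
    have h3 : (insert i G).erase v = insert i (G.erase v) := by
      rw [Finset.erase_insert_of_ne hvi]
    have h4 := sg_swap' i v (insert i G) (Finset.mem_insert_self _ _) (Finset.mem_insert_of_mem hv) hvi
    rw [Finset.erase_insert hi, h3] at h4
    rw [smul_smul, smul_smul, h4, h3, neg_smul, neg_add_cancel]

end Const

section Hom
variable {B : Type} [CommRing B] {𝔪 : Ideal B} (P : Res B 𝔪)
  (C : ℕ → Type) [∀ q, AddCommGroup (C q)] [∀ q, Module B (C q)] (d : ∀ q, C q →ₗ[B] C (q + 1))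

/-- coboundaries -/
def Bd : ∀ q, Submodule B (C q)
  | 0 => ⊥
  | q + 1 => LinearMap.range (d q)

lemma Bd_le (hdd : ∀ q x, d (q + 1) (d q x) = 0) (q : ℕ) (x : C q) (hx : x ∈ Bd C d q) :
    d q x = 0 := by
  cases q with
  | zero => rw [(Submodule.mem_bot B).mp hx, map_zero]
  | succ q => obtain ⟨y, rfl⟩ := hx; exact hdd q y

lemma dimLT_of_equiv {N N' : Type} [AddCommGroup N] [Module B N] [AddCommGroup N'] [Module B N']
    (φ : N →ₗ[B] N') (hφ : Function.Bijective φ) (i r : ℕ) (h : P.DimLT N i r) :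
    P.DimLT N' i r := by
  intro f hf
  choose g hg using hφ.2
  obtain ⟨a, ha, e, he⟩ := h (fun l x => g (f l x)) (by
    intro l
    funext c
    apply hφ.1
    rw [map_act]
    simp only [hg]
    rw [hf l]; simp)
  refine ⟨a, ha, fun x => φ (e x), ?_⟩
  funext c
  rw [← map_act, ← he]
  simp [hg]

lemma dimLT_K (hdd : ∀ q x, d (q + 1) (d q x) = 0) (hV : ∀ q i, P.Van (C (q + 1)) i) (j r : ℕ)
    (hH : ∀ q < j, ∀ x, d q x = 0 → x ∈ Bd C d q) (h0 : P.DimLT (C 0) j r) :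
    P.DimLT (C j ⧸ Bd C d j) 0 r := by
  suffices H : ∀ q i, q + i = j → P.DimLT (C q ⧸ Bd C d q) i r from H j 0 (by simp)
  intro q
  induction q with
  | zero =>
    intro i hi
    obtain rfl : i = j := by omega
    refine dimLT_of_equiv P (Submodule.mkQ (Bd C d 0)) ⟨?_, Submodule.mkQ_surjective _⟩ i r h0
    rw [← LinearMap.ker_eq_bot, Submodule.ker_mkQ]; rfl
  | succ q ih =>
    intro i hi
    have h1 := ih (i + 1) (by omega)
    have hle : Bd C d q ≤ LinearMap.ker (d q) := fun x hx => Bd_le C d hdd q x hx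
    refine P.dimLT_shift ((Bd C d q).liftQ (d q) hle) (Submodule.mkQ (Bd C d (q + 1))) ?_
      (Submodule.mkQ_surjective _) ?_ i r (hV q i) h1
    · rw [← LinearMap.ker_eq_bot]
      rw [Submodule.ker_liftQ_eq_bot]
      intro x hx
      exact hH q (by omega) x hx
    · intro c
      rw [Submodule.mkQ_apply, Submodule.Quotient.mk_eq_zero]
      constructor
      · rintro ⟨y, rfl⟩
        exact ⟨Submodule.Quotient.mk y, rfl⟩
      · rintro ⟨x, rfl⟩
        obtain ⟨y, rfl⟩ := Submodule.Quotient.mk_surjective _ x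
        exact ⟨y, rfl⟩

lemma socle_K (hdd : ∀ q x, d (q + 1) (d q x) = 0) (hV : ∀ q i, P.Van (C (q + 1)) i) (j r : ℕ)
    (hH : ∀ q < j, ∀ x, d q x = 0 → x ∈ Bd C d q) (h0 : P.DimLT (C 0) j r)
    (z : Fin r → C j) (hz : ∀ l, ∀ t ∈ 𝔪, t • z l ∈ Bd C d j) :
    ∃ a : Fin r → B, (∃ l, a l ∉ 𝔪) ∧ ∑ l, a l • z l ∈ Bd C d j := by
  obtain ⟨a, ha, h⟩ := P.socle_of_dimLT_zero r (dimLT_K P C d hdd hV j r hH h0)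
    (fun l => Submodule.Quotient.mk (z l)) (by
      intro l t ht
      rw [← Submodule.Quotient.mk_smul, Submodule.Quotient.mk_eq_zero]
      exact hz l t ht)
  refine ⟨a, ha, ?_⟩
  rw [← Submodule.Quotient.mk_eq_zero]
  rw [← h]
  change Submodule.mkQ _ _ = _
  rw [map_sum]
  rfl

lemma H_vanish [h𝔪 : 𝔪.IsMaximal] (hfg : 𝔪.FG) (hdd : ∀ q x, d (q + 1) (d q x) = 0)
    (hV : ∀ q i, P.Van (C (q + 1)) i) (s : Set B) (hs : 𝔪 = Ideal.span s)
    (hT : ∀ q x, d q x = 0 → ∀ a ∈ s, ∃ N, a ^ N • x ∈ Bd C d q) (j : ℕ)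
    (h0 : ∀ q < j, P.DimLT (C 0) q 1) :
    ∀ q < j, ∀ x, d q x = 0 → x ∈ Bd C d q := by
  intro q
  induction q using Nat.strong_induction_on with
  | _ q ih =>
    intro hq x hx
    have hsoc : ∀ z : C q, (∀ t ∈ 𝔪, t • z ∈ Bd C d q) → z ∈ Bd C d q := by
      intro z hz
      obtain ⟨a, ⟨l, hl⟩, h⟩ := socle_K P C d hdd hV q 1 (fun q' hq' => ih q' hq' (by omega))
        (h0 q hq) (fun _ => z) (fun _ => hz)
      obtain rfl : l = 0 := Subsingleton.elim _ _
      simp only [Finset.univ_unique, Fin.default_eq_zero, Finset.sum_singleton] at h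
      obtain ⟨b, t, ht, hbt⟩ := h𝔪.exists_inv hl
      have : z = b • (a 0 • z) + t • z := by rw [smul_smul, ← add_smul, hbt, one_smul]
      rw [this]
      exact Submodule.add_mem _ (Submodule.smul_mem _ _ h) (hz t ht)
    let I : Ideal B := (Bd C d q).comap (LinearMap.toSpanSingleton B (C q) x)
    have hI : ∀ a, a ∈ I ↔ a • x ∈ Bd C d q := fun a => Iff.rfl
    have hrad : 𝔪 ≤ I.radical := by
      rw [hs, Ideal.span_le]
      intro a ha
      obtain ⟨N, hN⟩ := hT q x hx a ha
      exact ⟨N, hN⟩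
    obtain ⟨N, hN⟩ := Ideal.exists_pow_le_of_le_radical_of_fg hrad hfg
    have : ∀ N, 𝔪 ^ N ≤ I → x ∈ Bd C d q := by
      intro N
      induction N with
      | zero =>
        intro h
        have := (hI 1).mp (h (by simp))
        simpa using this
      | succ N ihN =>
        intro h
        apply ihN
        intro a ha
        rw [hI]
        apply hsoc
        intro t ht
        rw [smul_smul, mul_comm t a]
        have h5 : a * t ∈ 𝔪 ^ (N + 1) := by rw [pow_succ]; exact Ideal.mul_mem_mul ha ht
        exact h h5
    exact this N hN
end Hom
end GP


set_option linter.unusedSectionVars false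
set_option linter.unusedSimpArgs false
set_option linter.unusedVariables false

namespace GP

section Cech
variable {T : Type} [CommRing T] {n : ℕ} (x : Fin n → T) (C : Finset (Fin n) → Type)
  [∀ G, CommRing (C G)] [∀ G, Algebra T (C G)] [hL : ∀ G, IsLocalization.Away (∏ i ∈ G, x i) (C G)]

/-- the monomial of a set, in the localization -/
def xm (F G : Finset (Fin n)) : C G := algebraMap T (C G) (∏ i ∈ F, x i)

lemma xm_unit {F G : Finset (Fin n)} (h : F ⊆ G) : IsUnit (xm x C F G) :=
  isUnit_of_dvd_unit (map_dvd _ (Finset.prod_dvd_prod_of_subset _ _ _ h))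
    (IsLocalization.Away.algebraMap_isUnit (S := C G) (∏ i ∈ G, x i))

/-- transition maps, as algebra maps -/
noncomputable def ra {G G' : Finset (Fin n)} (h : G ⊆ G') : C G →ₐ[T] C G' :=
  IsLocalization.liftAlgHom (M := Submonoid.powers (∏ i ∈ G, x i)) (f := Algebra.ofId T (C G'))
    (by
      rintro ⟨_, m, rfl⟩
      have := xm_unit x C h
      change IsUnit (algebraMap T (C G') _)
      rw [map_pow]
      exact this.pow m)

/-- transition maps -/
noncomputable def rho (G G' : Finset (Fin n)) : C G →ₗ[T] C G' :=
  open Classical in if h : G ⊆ G' then (ra x C h).toLinearMap else 0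

lemma rho_eq {G G' : Finset (Fin n)} (h : G ⊆ G') (y : C G) : rho x C G G' y = ra x C h y := by
  unfold rho
  rw [dif_pos h]; rfl

lemma rho_trans (G G' G'' : Finset (Fin n)) (h : G ⊆ G') (h' : G' ⊆ G'') (y : C G) :
    rho x C G' G'' (rho x C G G' y) = rho x C G G'' y := by
  rw [rho_eq x C h, rho_eq x C h', rho_eq x C (h.trans h')]
  have := IsLocalization.algHom_subsingleton (R := T) (Submonoid.powers (∏ i ∈ G, x i)) (S := C G)
    (P := C G'')
  exact DFunLike.congr_fun (Subsingleton.elim ((ra x C h').comp (ra x C h)) (ra x C (h.trans h'))) y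

lemma rho_self (G : Finset (Fin n)) (y : C G) : rho x C G G y = y := by
  rw [rho_eq x C subset_rfl]
  have := IsLocalization.algHom_subsingleton (R := T) (Submonoid.powers (∏ i ∈ G, x i)) (S := C G)
    (P := C G)
  exact DFunLike.congr_fun (Subsingleton.elim (ra x C (subset_refl G)) (AlgHom.id T _)) y

lemma exists_num (G : Finset (Fin n)) (y : C G) :
    ∃ (M : ℕ) (a : T), (∏ i ∈ G, x i) ^ M • y = algebraMap T (C G) a := by
  obtain ⟨M, a, h⟩ := IsLocalization.Away.surj (∏ i ∈ G, x i) y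
  refine ⟨M, a, ?_⟩
  rw [← h, Algebra.smul_def, map_pow, mul_comm]

lemma loc_smul_inj {F G : Finset (Fin n)} (h : F ⊆ G) (M : ℕ) {y z : C G}
    (e : (∏ i ∈ F, x i) ^ M • y = (∏ i ∈ F, x i) ^ M • z) : y = z := by
  rw [Algebra.smul_def, Algebra.smul_def, map_pow] at e
  exact ((xm_unit x C h).pow M).mul_left_cancel e

lemma locL1 (G : Finset (Fin n)) (i : Fin n) (hi : i ∉ G) (y : C (insert i G)) :
    ∃ (M : ℕ), ∀ M', M ≤ M' → ∃ y', rho x C G (insert i G) y' = x i ^ M' • y := by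
  obtain ⟨M, a, h⟩ := exists_num x C _ y
  have hs : G ⊆ insert i G := Finset.subset_insert i G
  refine ⟨M, fun M' hM => ?_⟩
  obtain ⟨u, hu⟩ := (xm_unit x C (subset_refl G)).pow M
  refine ⟨x i ^ (M' - M) • (a • (u⁻¹ : (C G)ˣ).1), ?_⟩
  apply loc_smul_inj x C hs M
  rw [← map_smul, smul_comm _ (x i ^ (M' - M)), smul_comm _ a]
  have h1 : (∏ i ∈ G, x i) ^ M • (u⁻¹ : (C G)ˣ).1 = 1 := by
    rw [Algebra.smul_def, map_pow]
    have h3 : (algebraMap T (C G) (∏ i ∈ G, x i)) ^ M = u.1 := hu.symm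
    rw [h3]
    exact u.mul_inv
  rw [h1, map_smul, map_smul, rho_eq x C hs, map_one]
  have h2 : x i ^ M' = x i ^ (M' - M) * x i ^ M := by rw [← pow_add]; congr 1; omega
  rw [Finset.prod_insert hi, mul_pow, mul_comm, mul_smul] at h
  rw [h2, mul_smul, smul_comm _ (x i ^ (M' - M)), h, Algebra.algebraMap_eq_smul_one]

lemma locL2 (G : Finset (Fin n)) (i : Fin n) (hi : i ∉ G) (y : C G)
    (hy : rho x C G (insert i G) y = 0) : ∃ N, ∀ N', N ≤ N' → x i ^ N' • y = 0 := by
  obtain ⟨M, a, h⟩ := exists_num x C _ y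
  have hs : G ⊆ insert i G := Finset.subset_insert i G
  have h1 := congrArg (rho x C G (insert i G)) h
  rw [map_smul, hy, smul_zero, rho_eq x C hs, AlgHom.commutes] at h1
  obtain ⟨N, hN⟩ := IsLocalization.Away.exists_of_eq (∏ j ∈ insert i G, x j)
    (h1.symm.trans (map_zero _).symm)
  rw [mul_zero, Finset.prod_insert hi] at hN
  have h2 : x i ^ N • y = 0 := by
    apply loc_smul_inj x C (subset_refl G) (M + N)
    rw [smul_zero, pow_add, mul_comm, mul_smul, smul_comm _ (x i ^ N), h, ← mul_smul,
      Algebra.algebraMap_eq_smul_one, smul_smul, mul_comm (_ ^ N) (x i ^ N),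
      ← mul_pow, hN, zero_smul]
  refine ⟨N, fun N' hN' => ?_⟩
  obtain ⟨p, rfl⟩ := Nat.exists_eq_add_of_le hN'
  rw [pow_add, mul_comm, mul_smul, h2, smul_zero]

/-- graded piece -/
abbrev Cq (q : ℕ) : Type := ∀ G : {G : Finset (Fin n) // G.card = q}, C G.1

/-- extension by zero -/
def exq (q : ℕ) : Cq C q →ₗ[T] ∀ G, C G where
  toFun y G := if h : G.card = q then y ⟨G, h⟩ else 0
  map_add' y z := by
    funext G
    simp only [Pi.add_apply]
    split_ifs <;> simp
  map_smul' a y := by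
    funext G
    simp only [Pi.smul_apply, RingHom.id_apply]
    split_ifs <;> simp

/-- restriction -/
def req (q : ℕ) : (∀ G, C G) →ₗ[T] Cq C q where
  toFun y G := y G.1
  map_add' y z := rfl
  map_smul' a y := rfl

lemma req_exq (q : ℕ) (y : Cq C q) : req (T := T) C q (exq (T := T) C q y) = y := by
  funext G
  exact dif_pos G.2

/-- graded coboundary -/
noncomputable def dq (q : ℕ) : Cq C q →ₗ[T] Cq C (q + 1) :=
  (req C (q + 1)).comp ((dl (rho x C)).comp (exq C q))

lemma dl_congr (q : ℕ) {y z : ∀ G, C G} (h : ∀ G, G.card = q → y G = z G) (G) (hG : G.card = q + 1) :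
    dl (rho x C) y G = dl (rho x C) z G := by
  rw [dl_apply, dl_apply]
  refine Finset.sum_congr rfl fun v hv => ?_
  rw [h]
  rw [Finset.card_erase_of_mem hv, hG, Nat.add_sub_cancel]

lemma dq_req (q : ℕ) (y : ∀ G, C G) :
    dq x C q (req (T := T) C q y) = req (T := T) C (q + 1) (dl (rho x C) y) := by
  funext G
  refine dl_congr x C q (fun G' hG' => ?_) G.1 G.2
  exact dif_pos hG'

lemma dq_dq (q : ℕ) (y : Cq C q) : dq x C (q + 1) (dq x C q y) = 0 := by
  rw [← req_exq (T := T) C q y, dq_req, dq_req, dl_dl (rho x C) (rho_trans x C), map_zero]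

/-- being a coboundary in degree `q` -/
def MB (q : ℕ) (z : ∀ G, C G) : Prop := ∃ y : ∀ G, C G, ∀ G, G.card = q → z G = dl (rho x C) y G

lemma mem_Bd (q : ℕ) (z : ∀ G, C G) :
    req (T := T) C q z ∈ Bd (Cq C) (dq x C) q ↔ MB x C q z := by
  cases q with
  | zero =>
    rw [Bd, Submodule.mem_bot]
    constructor
    · intro h
      refine ⟨0, fun G hG => ?_⟩
      rw [map_zero]
      exact congrFun h ⟨G, hG⟩
    · rintro ⟨y, hy⟩
      funext G
      refine (hy G.1 G.2).trans ?_
      have : G.1 = ∅ := Finset.card_eq_zero.mp G.2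
      rw [dl_apply, Finset.sum_eq_zero]
      · rfl
      · intro v hv
        rw [this] at hv
        exact absurd hv (Finset.notMem_empty v)
  | succ q =>
    rw [Bd, LinearMap.mem_range]
    constructor
    · rintro ⟨y, hy⟩
      refine ⟨exq (T := T) C q y, fun G hG => ?_⟩
      exact (congrFun hy ⟨G, hG⟩).symm
    · rintro ⟨y, hy⟩
      refine ⟨req (T := T) C q y, ?_⟩
      rw [dq_req]
      funext G
      exact (hy G.1 G.2).symm

lemma cech_torsion (q : ℕ) (z : ∀ G, C G) (hz : ∀ G, G.card = q + 1 → dl (rho x C) z G = 0)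
    (i : Fin n) : ∃ N, MB x C q (x i ^ N • z) := by
  have h1 : ∀ G, ∃ M : ℕ, i ∉ G → ∀ M', M ≤ M' →
      ∃ y', rho x C G (insert i G) y' = x i ^ M' • z (insert i G) := by
    intro G
    by_cases hi : i ∈ G
    · exact ⟨0, fun h => absurd hi h⟩
    · obtain ⟨M, hM⟩ := locL1 x C G i hi (z (insert i G))
      exact ⟨M, fun _ => hM⟩
  choose M hM using h1
  let M' := Finset.univ.sup M
  have h2 : ∀ G, ∃ y', i ∉ G → rho x C G (insert i G) y' = x i ^ M' • z (insert i G) := by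
    intro G
    by_cases hi : i ∈ G
    · exact ⟨0, fun h => absurd hi h⟩
    · obtain ⟨y, hy⟩ := hM G hi M' (Finset.le_sup (f := M) (Finset.mem_univ G))
      exact ⟨y, fun _ => hy⟩
  choose y0 hy0 using h2
  obtain ⟨y, hy⟩ := helperH (rho x C) (rho_trans x C) (rho_self x C) q z hz i (x i ^ M') y0 hy0
  have h3 : ∀ G, ∃ N, G.card = q → ∀ N', N ≤ N' →
      x i ^ N' • (x i ^ M' • z G - dl (rho x C) y G) = 0 := by
    intro G
    by_cases hG : G.card = q
    · by_cases hi : i ∈ G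
      · refine ⟨0, fun _ N' _ => ?_⟩
        rw [(hy G hG).1 hi, smul_zero]
      · obtain ⟨N, hN⟩ := locL2 x C G i hi _ ((hy G hG).2 hi)
        exact ⟨N, fun _ => hN⟩
    · exact ⟨0, fun h => absurd h hG⟩
  choose N hN using h3
  let N' := Finset.univ.sup N
  refine ⟨N' + M', x i ^ N' • y, fun G hG => ?_⟩
  have h4 := hN G hG N' (Finset.le_sup (f := N) (Finset.mem_univ G))
  rw [smul_sub, sub_eq_zero, smul_smul, ← pow_add] at h4
  rw [Pi.smul_apply, h4, map_smul, Pi.smul_apply]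

variable {𝔪 : Ideal T} (P : Res T 𝔪)

lemma van_Cq (hx : ∀ i, x i ∈ 𝔪) (q i : ℕ) : P.Van (Cq C (q + 1)) i := by
  apply P.van_pi
  rintro ⟨G, hG⟩
  have hne : G.Nonempty := by rw [← Finset.card_pos, hG]; omega
  obtain ⟨v, hv⟩ := hne
  refine P.van_of_bijective (x v) (hx v) ?_ i
  have hu : IsUnit (algebraMap T (C G) (x v)) := by
    have := xm_unit x C (Finset.singleton_subset_iff.mpr hv)
    unfold xm at this
    rwa [Finset.prod_singleton] at this
  have he : (fun y : C G => x v • y) = fun y => algebraMap T (C G) (x v) * y := by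
    funext y; rw [Algebra.smul_def]
  rw [he]
  exact IsUnit.isUnit_iff_mulLeft_bijective.mp hu

lemma dimLT_C0 (x : Fin n → T) [∀ G, IsLocalization.Away (∏ i ∈ G, x i) (C G)] (j r : ℕ) (h : P.DimLT T j r) : P.DimLT (Cq C 0) j r := by
  refine dimLT_of_equiv P (LinearMap.pi fun G => Algebra.linearMap T (C G.1)) ?_ j r h
  constructor
  · intro a b hab
    have h1 : algebraMap T (C ∅) a = algebraMap T (C ∅) b := congrFun hab ⟨∅, rfl⟩
    obtain ⟨N, hN⟩ := IsLocalization.Away.exists_of_eq (∏ j ∈ (∅ : Finset (Fin n)), x j) h1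
    simpa using hN
  · intro y
    obtain ⟨M, a, h⟩ := exists_num x C _ (y ⟨∅, rfl⟩)
    refine ⟨a, ?_⟩
    funext ⟨G, hG⟩
    obtain rfl := Finset.card_eq_zero.mp hG
    rw [Finset.prod_empty, one_pow, one_smul] at h
    exact h.symm

theorem cech_socle [𝔪.IsMaximal] (hm : 𝔪 = Ideal.span (Set.range x)) (j r : ℕ)
    (h1 : ∀ q < j, P.DimLT T q 1) (hr : P.DimLT T j r) (z : Fin r → ∀ G, C G)
    (hz : ∀ l i, MB x C j (x i • z l)) :
    ∃ a : Fin r → T, (∃ l, a l ∉ 𝔪) ∧ MB x C j (∑ l, a l • z l) := by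
  have hx : ∀ i, x i ∈ 𝔪 := fun i => by rw [hm]; exact Ideal.subset_span ⟨i, rfl⟩
  have hV := van_Cq x C P hx
  have hdd := dq_dq x C
  have hH := H_vanish P (Cq C) (dq x C)
    (by rw [hm]; exact Submodule.fg_span (Set.finite_range x)) hdd hV (Set.range x) hm
    (by
      rintro q y hy _ ⟨i, rfl⟩
      obtain ⟨N, hN⟩ := cech_torsion x C q (exq (T := T) C q y)
        (fun G hG => congrFun hy ⟨G, hG⟩) i
      refine ⟨N, ?_⟩
      rw [← mem_Bd, map_smul, req_exq] at hN
      exact hN) j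
    (fun q hq => dimLT_C0 C P x q 1 (h1 q hq))
  obtain ⟨a, ha, h⟩ := socle_K P (Cq C) (dq x C) hdd hV j r hH (dimLT_C0 C P x j r hr)
    (fun l => req (T := T) C j (z l)) (by
      intro l t ht
      rw [hm] at ht
      induction ht using Submodule.span_induction with
      | mem t ht =>
        obtain ⟨i, rfl⟩ := ht
        rw [← map_smul, mem_Bd]
        exact hz l i
      | zero => rw [zero_smul]; exact Submodule.zero_mem _
      | add s t _ _ hs ht => rw [add_smul]; exact Submodule.add_mem _ hs ht
      | smul s t _ ht => rw [smul_assoc]; exact Submodule.smul_mem _ _ ht)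
  refine ⟨a, ha, ?_⟩
  rw [← mem_Bd, map_sum]
  simpa only [map_smul] using h

lemma MB_smul (q : ℕ) (a : T) (z : ∀ G, C G) (h : MB x C q z) : MB x C q (a • z) := by
  obtain ⟨y, hy⟩ := h
  refine ⟨a • y, fun G hG => ?_⟩
  rw [Pi.smul_apply, hy G hG, map_smul, Pi.smul_apply]

lemma MB_add (q : ℕ) (z z' : ∀ G, C G) (h : MB x C q z) (h' : MB x C q z') :
    MB x C q (z + z') := by
  obtain ⟨y, hy⟩ := h
  obtain ⟨y', hy'⟩ := h'
  refine ⟨y + y', fun G hG => ?_⟩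
  rw [Pi.add_apply, hy G hG, hy' G hG, map_add, Pi.add_apply]

lemma MB_ideal (hm : 𝔪 = Ideal.span (Set.range x)) (q : ℕ) (z : ∀ G, C G)
    (h : ∀ i, MB x C q (x i • z)) (t : T) (ht : t ∈ 𝔪) : MB x C q (t • z) := by
  rw [hm] at ht
  induction ht using Submodule.span_induction with
  | mem t ht =>
    obtain ⟨i, rfl⟩ := ht
    exact h i
  | zero => rw [zero_smul]; exact ⟨0, fun G _ => by rw [map_zero]⟩
  | add s t _ _ hs ht => rw [add_smul]; exact MB_add x C q _ _ hs ht
  | smul s t _ ht => rw [smul_assoc]; exact MB_smul x C q _ _ ht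

end Cech
end GP


set_option linter.unusedSectionVars false
set_option linter.unusedSimpArgs false
set_option linter.unusedVariables false

namespace GP

section Coef
variable {k : Type} [Field k] {n : ℕ} {Γ : SC n}

lemma coeff_srIdeal (p : MvPolynomial (Fin n) k) (hp : p ∈ srIdeal k Γ) :
    ∀ a : Fin n →₀ ℕ, a.support ∈ Γ.faces → MvPolynomial.coeff a p = 0 := by
  classical
  unfold srIdeal at hp
  induction hp using Submodule.span_induction with
  | mem p hp =>
    obtain ⟨σ, hσ, rfl⟩ := hp
    intro a ha
    have : (∏ i ∈ σ, MvPolynomial.X i : MvPolynomial (Fin n) k) =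
        MvPolynomial.monomial (∑ i ∈ σ, Finsupp.single i 1) 1 := by
      rw [MvPolynomial.monomial_sum_one]; rfl
    rw [this, MvPolynomial.coeff_monomial, if_neg]
    rintro rfl
    apply hσ
    refine Γ.down_closed ha fun i hi => ?_
    rw [Finsupp.mem_support_iff, Finsupp.finsetSum_apply]
    intro h0
    have := (Finset.sum_eq_zero_iff.mp h0) i hi
    simp at this
  | zero => intro a _; exact MvPolynomial.coeff_zero a
  | add p q _ _ hp hq => intro a ha; rw [MvPolynomial.coeff_add, hp a ha, hq a ha, add_zero]
  | smul q p _ hp =>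
    intro a ha
    rw [smul_eq_mul, MvPolynomial.coeff_mul]
    refine Finset.sum_eq_zero fun ⟨b, c⟩ hbc => ?_
    rw [hp c, mul_zero]
    refine Γ.down_closed ha (Finsupp.support_mono ?_)
    rw [Finset.HasAntidiagonal.mem_antidiagonal] at hbc
    rw [← hbc]
    exact le_add_self

/-- coefficient -/
noncomputable def tc (a : Fin n →₀ ℕ) (r : KR k Γ) : k :=
  MvPolynomial.coeff a (Function.surjInv (mkR_surj k Γ) r)

lemma tc_mk (a : Fin n →₀ ℕ) (ha : a.support ∈ Γ.faces) (p : MvPolynomial (Fin n) k) :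
    tc a (mkR k Γ p) = MvPolynomial.coeff a p := by
  unfold tc
  rw [← sub_eq_zero, ← MvPolynomial.coeff_sub]
  refine coeff_srIdeal (Γ := Γ) _ ?_ a ha
  have h : mkR k Γ (Function.surjInv (mkR_surj k Γ) (mkR k Γ p)) = mkR k Γ p :=
    Function.surjInv_eq _ _
  exact Ideal.Quotient.eq.mp h

/-- coefficient as an additive map -/
noncomputable def tch (a : Fin n →₀ ℕ) (ha : a.support ∈ Γ.faces) : KR k Γ →ₗ[k] k where
  toFun := tc a
  map_add' r s := by
    obtain ⟨p, rfl⟩ := mkR_surj k Γ r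
    obtain ⟨q, rfl⟩ := mkR_surj k Γ s
    rw [← map_add, tc_mk a ha, tc_mk a ha, tc_mk a ha, MvPolynomial.coeff_add]
  map_smul' c r := by
    obtain ⟨p, rfl⟩ := mkR_surj k Γ r
    rw [← map_smul, tc_mk a ha, tc_mk a ha, MvPolynomial.coeff_smul]
    rfl

variable (k Γ) in
/-- monomials -/
noncomputable def mon (b : Fin n →₀ ℕ) : KR k Γ := mkR k Γ (MvPolynomial.monomial b 1)

lemma mon_add (a b : Fin n →₀ ℕ) : mon k Γ (a + b) = mon k Γ a * mon k Γ b := by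
  unfold mon
  rw [← map_mul, MvPolynomial.monomial_mul, one_mul]

lemma mon_nsmul (N : ℕ) (a : Fin n →₀ ℕ) : mon k Γ (N • a) = mon k Γ a ^ N := by
  unfold mon
  rw [← map_pow, MvPolynomial.monomial_pow, one_pow]

lemma mon_single (i : Fin n) : mon k Γ (Finsupp.single i 1) = xv k Γ i := rfl

/-- indicator exponent -/
noncomputable def ind (G : Finset (Fin n)) : Fin n →₀ ℕ := ∑ i ∈ G, Finsupp.single i 1

lemma ind_apply (G : Finset (Fin n)) (j : Fin n) : ind G j = if j ∈ G then 1 else 0 := by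
  classical
  unfold ind
  rw [Finsupp.finsetSum_apply]
  simp [Finsupp.single_apply]

lemma mon_ind (G : Finset (Fin n)) : mon k Γ (ind G) = ∏ i ∈ G, xv k Γ i := by
  unfold mon ind
  rw [MvPolynomial.monomial_sum_one, map_prod]
  rfl

lemma tc_mon (a b : Fin n →₀ ℕ) (ha : a.support ∈ Γ.faces) :
    tc a (mon k Γ b) = if b = a then 1 else 0 := by
  classical
  unfold mon
  rw [tc_mk a ha, MvPolynomial.coeff_monomial]

lemma tc_mon_mul (a b : Fin n →₀ ℕ) (ha : (b + a).support ∈ Γ.faces) (r : KR k Γ) :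
    tc (b + a) (mon k Γ b * r) = tc a r := by
  obtain ⟨p, rfl⟩ := mkR_surj k Γ r
  unfold mon
  rw [← map_mul, tc_mk _ ha, tc_mk, MvPolynomial.coeff_monomial_mul, one_mul]
  exact Γ.down_closed ha (Finsupp.support_mono le_add_self)

lemma tc_mon_mul_zero (a b : Fin n →₀ ℕ) (ha : a.support ∈ Γ.faces) (h : ¬ b ≤ a) (r : KR k Γ) :
    tc a (mon k Γ b * r) = 0 := by
  obtain ⟨p, rfl⟩ := mkR_surj k Γ r
  unfold mon
  rw [← map_mul, tc_mk _ ha, MvPolynomial.coeff_monomial_mul', if_neg h]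

end Coef

section Mu
variable {k : Type} [Field k] {n : ℕ} {Γ : SC n} (C : Finset (Fin n) → Type)
  [∀ G, CommRing (C G)] [∀ G, Algebra (KR k Γ) (C G)]
  [hL : ∀ G, IsLocalization.Away (∏ i ∈ G, xv k Γ i) (C G)]

/-- `1 / x_F` in `C G` -/
noncomputable def iv (F G : Finset (Fin n)) : C G := Ring.inverse (xm (xv k Γ) C F G)

lemma iv_mul {F G : Finset (Fin n)} (h : F ⊆ G) :
    (∏ i ∈ F, xv k Γ i) • iv (k := k) (Γ := Γ) C F G = 1 := by
  rw [Algebra.smul_def]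
  exact Ring.mul_inverse_cancel _ (xm_unit (xv k Γ) C h)

lemma cancelF {F G : Finset (Fin n)} (h : F ⊆ G) {y z : C G}
    (e : (∏ i ∈ F, xv k Γ i) • y = (∏ i ∈ F, xv k Γ i) • z) : y = z := by
  apply loc_smul_inj (xv k Γ) C h 1
  rw [pow_one, e]

lemma rho_iv {F G G' : Finset (Fin n)} (h : F ⊆ G) (h' : G ⊆ G') :
    rho (xv k Γ) C G G' (iv (k := k) (Γ := Γ) C F G) = iv (k := k) (Γ := Γ) C F G' := by
  apply cancelF (k := k) (Γ := Γ) C (h.trans h')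
  rw [← map_smul, iv_mul C h, iv_mul C (h.trans h'), rho_eq (xv k Γ) C h', map_one]

lemma xv_iv {F G : Finset (Fin n)} (h : F ⊆ G) (i : Fin n) (hi : i ∈ F) :
    xv k Γ i • iv (k := k) (Γ := Γ) C F G = iv (k := k) (Γ := Γ) C (F.erase i) G := by
  have h1 := (Finset.erase_subset i F).trans h
  apply cancelF (k := k) (Γ := Γ) C h1
  rw [iv_mul C h1, smul_smul, mul_comm, Finset.mul_prod_erase _ _ hi, iv_mul C h]

end Mu

lemma nonface_sub {k : Type} [Field k] {n : ℕ} {Γ : SC n} (C : Finset (Fin n) → Type)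
    [∀ G, CommRing (C G)] [∀ G, Algebra (KR k Γ) (C G)]
    [hL : ∀ G, IsLocalization.Away (∏ i ∈ G, xv k Γ i) (C G)] {G : Finset (Fin n)} (h : G ∉ Γ.faces) : Subsingleton (C G) := by
  have h1 := xm_unit (xv k Γ) C (subset_refl G)
  unfold xm at h1
  rw [prod_xv_eq_zero k Γ G h, map_zero] at h1
  exact subsingleton_of_zero_eq_one (isUnit_zero_iff.mp h1)

end GP


set_option linter.unusedSectionVars false
set_option linter.unusedSimpArgs false
set_option linter.unusedVariables false

namespace GP

section Cob
variable {k : Type} [Field k] {n : ℕ} (Γ : SC n)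

/-- supported on sets containing `F` -/
def Sup (F : Finset (Fin n)) (c : Finset (Fin n) → k) : Prop := ∀ G, c G ≠ 0 → F ⊆ G

/-- `c` is, in degree `q`, a coboundary of a cochain supported on sets containing `F` -/
def Cob (F : Finset (Fin n)) (q : ℕ) (c : Finset (Fin n) → k) : Prop :=
  ∃ b, Sup F b ∧ ∀ G ∈ Γ.faces, G.card = q → c G = dk b G

variable {Γ}

lemma Sup.mono {F F' : Finset (Fin n)} {c : Finset (Fin n) → k} (h : Sup F c) (hs : F' ⊆ F) :
    Sup F' c := fun G hG => hs.trans (h G hG)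

lemma Sup.zero {F G : Finset (Fin n)} {c : Finset (Fin n) → k} (h : Sup F c) (hs : ¬ F ⊆ G) :
    c G = 0 := by
  by_contra h1
  exact hs (h G h1)

lemma Cob.mono {F F' : Finset (Fin n)} {q : ℕ} {c : Finset (Fin n) → k} (h : Cob Γ F q c)
    (hs : F' ⊆ F) : Cob Γ F' q c := by
  obtain ⟨b, hb, h⟩ := h
  exact ⟨b, hb.mono hs, h⟩

end Cob

section Mu
variable {k : Type} [Field k] {n : ℕ} {Γ : SC n} (C : Finset (Fin n) → Type)
  [∀ G, CommRing (C G)] [∀ G, Algebra (KR k Γ) (C G)]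
  [hL : ∀ G, IsLocalization.Away (∏ i ∈ G, xv k Γ i) (C G)]

/-- the multidegree `-F` part -/
noncomputable def mu (F : Finset (Fin n)) (c : Finset (Fin n) → k) : ∀ G, C G :=
  fun G => algebraMap k (KR k Γ) (c G) • iv (k := k) (Γ := Γ) C F G

lemma mu_apply (F : Finset (Fin n)) (c : Finset (Fin n) → k) (G) :
    mu (Γ := Γ) C F c G = algebraMap k (KR k Γ) (c G) • iv (k := k) (Γ := Γ) C F G := rfl

lemma mu_add (F : Finset (Fin n)) (c c' : Finset (Fin n) → k) :
    mu (Γ := Γ) C F (c + c') = mu (Γ := Γ) C F c + mu (Γ := Γ) C F c' := by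
  funext G
  rw [Pi.add_apply, mu_apply, mu_apply, mu_apply, Pi.add_apply, map_add, add_smul]

lemma mu_smul (F : Finset (Fin n)) (a : k) (c : Finset (Fin n) → k) :
    mu (Γ := Γ) C F (a • c) = algebraMap k (KR k Γ) a • mu (Γ := Γ) C F c := by
  funext G
  rw [Pi.smul_apply, mu_apply, mu_apply, Pi.smul_apply, smul_smul, smul_eq_mul, map_mul]

lemma mu_dl (F : Finset (Fin n)) (b : Finset (Fin n) → k) (hb : Sup F b) :
    dl (rho (xv k Γ) C) (mu (Γ := Γ) C F b) = mu (Γ := Γ) C F (dk b) := by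
  funext G
  rw [dl_apply, mu_apply, dk_apply, map_sum, Finset.sum_smul]
  refine Finset.sum_congr rfl fun v hv => ?_
  rw [mu_apply, map_smul, map_zsmul, smul_assoc]
  by_cases h : F ⊆ G.erase v
  · rw [rho_iv C h (Finset.erase_subset _ _)]
  · rw [hb.zero h]; simp

lemma xv_mu (F : Finset (Fin n)) (c : Finset (Fin n) → k) (hc : Sup F c) (i : Fin n) (hi : i ∈ F) :
    xv k Γ i • mu (Γ := Γ) C F c = mu (Γ := Γ) C (F.erase i) c := by
  funext G
  rw [Pi.smul_apply, mu_apply, mu_apply, smul_comm]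
  by_cases h : F ⊆ G
  · rw [xv_iv C h i hi]
  · rw [hc.zero h]; simp

lemma MB_of_cob (F : Finset (Fin n)) (q : ℕ) (c : Finset (Fin n) → k) (h : Cob Γ F q c) :
    MB (xv k Γ) C q (mu (Γ := Γ) C F c) := by
  obtain ⟨b, hb, h⟩ := h
  refine ⟨mu (Γ := Γ) C F b, fun G hG => ?_⟩
  by_cases hf : G ∈ Γ.faces
  · rw [mu_dl C F b hb, mu_apply, mu_apply, h G hf hG]
  · have := nonface_sub (k := k) C hf
    exact Subsingleton.elim _ _

lemma mu_soc (F : Finset (Fin n)) (q : ℕ) (c : Finset (Fin n) → k) (hc : Sup F c)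
    (hcoc : ∀ G ∈ Γ.faces, G.card = q + 1 → dk c G = 0)
    (hcob : ∀ i ∈ F, Cob Γ (F.erase i) q c) (i : Fin n) :
    MB (xv k Γ) C q (xv k Γ i • mu (Γ := Γ) C F c) := by
  by_cases hi : i ∈ F
  · rw [xv_mu C F c hc i hi]
    exact MB_of_cob C _ q c (hcob i hi)
  · have hs : Sup F (hk i c) := by
      intro G hG
      unfold hk at hG
      by_cases h : i ∈ G
      · simp [h] at hG
      · rw [if_neg h] at hG
        have h1 : F ⊆ insert i G := by
          by_contra h2
          rw [hc.zero h2] at hG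
          simp at hG
        exact (Finset.subset_insert_iff_of_notMem hi).mp h1
    refine ⟨xv k Γ i • mu (Γ := Γ) C F (hk i c), fun G hG => ?_⟩
    rw [map_smul, mu_dl C F _ hs, ← sub_eq_zero, Pi.smul_apply, Pi.smul_apply, ← smul_sub,
      mu_apply, mu_apply, ← sub_smul, ← map_sub]
    have h1 : c G - dk (hk i c) G = hk i (dk c) G := by
      have := congrFun (dk_hk i c) G
      rw [Pi.add_apply] at this
      rw [← this]; ring
    rw [h1]
    unfold hk
    by_cases h : i ∈ G
    · simp [h]
    · rw [if_neg h]
      by_cases hf : insert i G ∈ Γ.faces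
      · rw [hcoc _ hf (by rw [Finset.card_insert_of_notMem h, hG])]; simp
      · have h2 := prod_xv_eq_zero k Γ _ hf
        rw [Finset.prod_insert h, mul_comm] at h2
        apply cancelF (k := k) (Γ := Γ) C (subset_refl G)
        rw [smul_smul, h2, zero_smul, smul_zero]

lemma exists_num' (G : Finset (Fin n)) (y : C G) :
    ∃ M, ∀ M', M ≤ M' → ∃ a : KR k Γ, (∏ i ∈ G, xv k Γ i) ^ M' • y = algebraMap (KR k Γ) (C G) a := by
  obtain ⟨M, a, h⟩ := exists_num (xv k Γ) C G y
  refine ⟨M, fun M' hM => ⟨(∏ i ∈ G, xv k Γ i) ^ (M' - M) * a, ?_⟩⟩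
  rw [map_mul, ← h, ← Algebra.smul_def, smul_smul, ← pow_add]
  congr 2
  omega

lemma ind_supp (M : ℕ) (F G : Finset (Fin n)) (hG : G ∈ Γ.faces) (b : Fin n →₀ ℕ)
    (hb : ∀ i, b i ≠ 0 → i ∈ G) : b.support ∈ Γ.faces :=
  Γ.down_closed hG fun i hi => hb i (Finsupp.mem_support_iff.mp hi)

theorem cob_of_MB (q : ℕ) (f : Finset (Fin n) → Finset (Fin n) → k) (hf : ∀ F, Sup F (f F))
    (h : MB (xv k Γ) C q (∑ F, mu (Γ := Γ) C F (f F))) (F : Finset (Fin n)) :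
    Cob Γ F q (f F) := by
  classical
  obtain ⟨y, hy⟩ := h
  choose M0 hM0 using fun G => exists_num' (k := k) (Γ := Γ) C G (y G)
  let M := Finset.univ.sup M0 + 1
  choose p hp using fun G => hM0 G M
    ((Finset.le_sup (f := M0) (Finset.mem_univ G)).trans (Nat.le_succ _))
  refine ⟨fun G => if F ⊆ G then tc (M • ind G - ind F) (p G) else 0, ?_, ?_⟩
  · intro G hG
    by_contra h
    simp [h] at hG
  intro G hG hq
  rw [dk_apply]
  by_cases hFG : F ⊆ G
  swap
  · rw [(hf F).zero hFG, Finset.sum_eq_zero]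
    intro v hv
    rw [if_neg (fun h => hFG (h.trans (Finset.erase_subset _ _))), smul_zero]
  have hle : ∀ F' ⊆ G, ind F' ≤ M • ind G := by
    intro F' hF' i
    rw [Finsupp.smul_apply, ind_apply, ind_apply]
    by_cases h : i ∈ F'
    · rw [if_pos h, if_pos (hF' h)]; simp [M]
    · rw [if_neg h]; exact Nat.zero_le _
  have e1 : algebraMap (KR k Γ) (C G) (∑ F', f F' G • mon k Γ (M • ind G - ind F')) =
      algebraMap (KR k Γ) (C G)
        (∑ v ∈ G, sg v G • (mon k Γ (M • Finsupp.single v 1) * p (G.erase v))) := by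
    have e2 := congrArg (fun a => (∏ i ∈ G, xv k Γ i) ^ M • a) (hy G hq)
    beta_reduce at e2
    rw [map_sum, map_sum]
    convert e2 using 1
    · rw [Finset.sum_apply, Finset.smul_sum]
      refine Finset.sum_congr rfl fun F' _ => ?_
      rw [mu_apply, smul_comm, Algebra.smul_def (f F' G), map_mul, ← Algebra.smul_def]
      by_cases hF' : F' ⊆ G
      · congr 1
        apply cancelF (k := k) (Γ := Γ) C hF'
        rw [smul_comm _ (_ ^ M), iv_mul C hF', ← mon_ind, ← mon_ind, ← mon_nsmul,
          Algebra.smul_def, ← map_mul, ← mon_add, add_tsub_cancel_of_le (hle F' hF'),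
          Algebra.algebraMap_eq_smul_one]
      · rw [(hf F').zero hF']; simp
    · rw [dl_apply, Finset.smul_sum]
      refine Finset.sum_congr rfl fun v hv => ?_
      rw [map_zsmul, smul_comm (_ ^ M)]
      congr 1
      rw [← Finset.mul_prod_erase _ _ hv, mul_pow, mul_smul, ← map_smul, hp,
        rho_eq (xv k Γ) C (Finset.erase_subset _ _), AlgHom.commutes, mon_nsmul, mon_single, map_mul,
        Algebra.smul_def]
  obtain ⟨N, hN⟩ := IsLocalization.Away.exists_of_eq (∏ j ∈ G, xv k Γ j) e1
  rw [← mon_ind, ← mon_nsmul] at hN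
  have hsupp : ∀ b : Fin n →₀ ℕ, (∀ i, i ∉ G → b i = 0) → b.support ∈ Γ.faces := by
    intro b hb
    refine Γ.down_closed hG fun i hi => ?_
    by_contra h
    exact Finsupp.mem_support_iff.mp hi (hb i h)
  have ha : ∀ i, i ∉ G → (M • ind G - ind F) i = 0 := by
    intro i hi
    rw [Finsupp.tsub_apply, Finsupp.smul_apply, ind_apply, if_neg hi]; simp
  have e3 := congrArg (tc (N • ind G + (M • ind G - ind F))) hN
  have hs1 : (N • ind G + (M • ind G - ind F)).support ∈ Γ.faces := by
    apply hsupp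
    intro i hi
    rw [Finsupp.add_apply, ha i hi, Finsupp.smul_apply, ind_apply, if_neg hi]; simp
  rw [tc_mon_mul _ _ hs1, tc_mon_mul _ _ hs1] at e3
  have hs2 := hsupp _ ha
  change tch (M • ind G - ind F) hs2 _ = tch (M • ind G - ind F) hs2 _ at e3
  rw [map_sum, map_sum] at e3
  rw [Finset.sum_eq_single F] at e3
  · rw [map_smul] at e3
    have e4 : tch (M • ind G - ind F) hs2 (mon k Γ (M • ind G - ind F)) = 1 := by
      change tc _ _ = _
      rw [tc_mon _ _ hs2, if_pos rfl]
    rw [e4, smul_eq_mul, mul_one] at e3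
    rw [e3]
    refine Finset.sum_congr rfl fun v hv => ?_
    rw [map_zsmul]
    congr 1
    change tc _ _ = _
    by_cases hvF : v ∈ F
    · rw [if_neg (fun h => Finset.notMem_erase v G (h hvF)), tc_mon_mul_zero _ _ hs2]
      intro hle
      have := hle v
      simp only [Finsupp.smul_apply, Finsupp.single_eq_same, Finsupp.tsub_apply, ind_apply, hv, hvF,
        if_true, M, smul_eq_mul, mul_one] at this
      omega
    · have hFe : F ⊆ G.erase v := fun i hi =>
        Finset.mem_erase.mpr ⟨by rintro rfl; exact hvF hi, hFG hi⟩
      rw [if_pos hFe]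
      have hdec : M • ind G - ind F =
          M • Finsupp.single v 1 + (M • ind (G.erase v) - ind F) := by
        ext i
        simp only [Finsupp.smul_apply, Finsupp.tsub_apply, Finsupp.add_apply, ind_apply,
          Finset.mem_erase, smul_eq_mul, Finsupp.single_apply]
        by_cases hiv : v = i
        · subst hiv
          simp [hv, hvF]
        · have : i ≠ v := fun h => hiv h.symm
          simp [hiv, this]
      rw [hdec] at hs2 ⊢
      rw [tc_mon_mul _ _ hs2]
  · intro F' _ hne
    rw [map_smul]
    by_cases hF' : F' ⊆ G
    · have : tch (M • ind G - ind F) hs2 (mon k Γ (M • ind G - ind F')) = 0 := by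
        change tc _ _ = _
        rw [tc_mon _ _ hs2, if_neg]
        intro he
        apply hne
        have h5 := hle F hFG
        have h6 := hle F' hF'
        ext i
        have h7 := DFunLike.congr_fun he i
        have h8 := h5 i
        have h9 := h6 i
        simp only [Finsupp.tsub_apply] at h7
        have h10 : ind F' i = ind F i := by omega
        rw [ind_apply, ind_apply] at h10
        by_cases a : i ∈ F' <;> by_cases b : i ∈ F <;> simp_all
      rw [this, smul_zero]
    · rw [(hf F').zero hF', zero_smul]
  · intro h
    exact absurd (Finset.mem_univ F) h

end Mu
end GP


set_option linter.unusedSectionVars false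
set_option linter.unusedSimpArgs false
set_option linter.unusedVariables false

namespace GP

section Comb
variable {k : Type} [Field k] {n : ℕ} {Γ : SC n}

lemma Cob.smul {F : Finset (Fin n)} {q : ℕ} {c : Finset (Fin n) → k} (h : Cob Γ F q c) (a : k) :
    Cob Γ F q (a • c) := by
  obtain ⟨b, hb, h⟩ := h
  refine ⟨a • b, ?_, ?_⟩
  · intro G hG
    apply hb
    intro h0
    apply hG
    rw [Pi.smul_apply, h0, smul_zero]
  · intro G hG hq
    rw [map_smul, Pi.smul_apply, Pi.smul_apply, h G hG hq]

lemma Cob.of_smul {F : Finset (Fin n)} {q : ℕ} {c : Finset (Fin n) → k} {a : k} (ha : a ≠ 0)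
    (h : Cob Γ F q (a • c)) : Cob Γ F q c := by
  have := h.smul a⁻¹
  rwa [smul_smul, inv_mul_cancel₀ ha, one_smul] at this

/-- cocycle condition -/
def Coc (Γ : SC n) (q : ℕ) (c : Finset (Fin n) → k) : Prop :=
  ∀ G ∈ Γ.faces, G.card = q + 1 → dk c G = 0

lemma mu_sum' (C : Finset (Fin n) → Type)
    [∀ G, CommRing (C G)] [∀ G, Algebra (KR k Γ) (C G)]
    [hL : ∀ G, IsLocalization.Away (∏ i ∈ G, xv k Γ i) (C G)] {ι : Type} (s : Finset ι)
    (F : Finset (Fin n)) (c : ι → Finset (Fin n) → k) :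
    mu (Γ := Γ) C F (∑ l ∈ s, c l) = ∑ l ∈ s, mu (Γ := Γ) C F (c l) :=
  map_sum (AddMonoidHom.mk' (mu (Γ := Γ) C F) (mu_add C F)) c s

lemma soc_dep' (C : Finset (Fin n) → Type)
    [∀ G, CommRing (C G)] [∀ G, Algebra (KR k Γ) (C G)]
    [hL : ∀ G, IsLocalization.Away (∏ i ∈ G, xv k Γ i) (C G)]
    (P : Res (KR k Γ) (kMax k Γ)) (j r : ℕ) (h1 : ∀ q < j, P.DimLT (KR k Γ) q 1)
    (hr : P.DimLT (KR k Γ) j r) (F : Fin r → Finset (Fin n)) (c : Fin r → Finset (Fin n) → k)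
    (hs : ∀ l, Sup (F l) (c l)) (hcoc : ∀ l, Coc Γ j (c l))
    (hcob : ∀ l, ∀ i ∈ F l, Cob Γ ((F l).erase i) j (c l)) :
    ∃ a : Fin r → k, (∃ l, a l ≠ 0) ∧
      ∀ F', Cob Γ F' j (∑ l, if F l = F' then a l • c l else 0) := by
  classical
  have hz : ∀ l i, MB (xv k Γ) C j (xv k Γ i • mu (Γ := Γ) C (F l) (c l)) :=
    fun l i => mu_soc C (F l) j (c l) (hs l) (hcoc l) (hcob l) i
  obtain ⟨a, ⟨l0, hl0⟩, h⟩ := cech_socle (xv k Γ) C P rfl j r h1 hr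
    (fun l => mu (Γ := Γ) C (F l) (c l)) hz
  refine ⟨fun l => cT k Γ (a l), ⟨l0, fun h0 => hl0 ((mem_kMax_iff _).mpr h0)⟩, ?_⟩
  apply cob_of_MB C j (fun F' => ∑ l, if F l = F' then cT k Γ (a l) • c l else 0)
  · intro F' G hG
    by_contra hne
    apply hG
    rw [Finset.sum_apply]
    refine Finset.sum_eq_zero fun l _ => ?_
    by_cases hF : F l = F'
    · rw [if_pos hF, Pi.smul_apply, (hs l).zero (by rw [hF]; exact hne), smul_zero]
    · rw [if_neg hF]; rfl
  · have e1 : (∑ F', mu (Γ := Γ) C F' (∑ l, if F l = F' then cT k Γ (a l) • c l else 0)) =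
        ∑ l, a l • mu (Γ := Γ) C (F l) (c l) +
          ∑ l, (algebraMap k (KR k Γ) (cT k Γ (a l)) - a l) • mu (Γ := Γ) C (F l) (c l) := by
      rw [← Finset.sum_add_distrib]
      simp only [mu_sum']
      rw [Finset.sum_comm]
      refine Finset.sum_congr rfl fun l _ => ?_
      rw [Finset.sum_eq_single (F l)]
      · rw [if_pos rfl, mu_smul, ← add_smul, add_sub_cancel]
      · intro F' _ hne
        rw [if_neg hne.symm]
        have := mu_smul (Γ := Γ) C F' (0 : k) 0
        rw [zero_smul, map_zero, zero_smul] at this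
        exact this
      · intro h; exact absurd (Finset.mem_univ _) h
    have hsum : ∀ s : Finset (Fin r), MB (xv k Γ) C j
        (∑ l ∈ s, (algebraMap k (KR k Γ) (cT k Γ (a l)) - a l) • mu (Γ := Γ) C (F l) (c l)) := by
      intro s
      induction s using Finset.induction_on with
      | empty => exact ⟨0, fun G _ => by rw [map_zero, Finset.sum_empty]⟩
      | insert l s hl ih =>
        rw [Finset.sum_insert hl]
        refine MB_add _ _ _ _ _ (MB_ideal (xv k Γ) C (𝔪 := kMax k Γ) rfl j _ (hz l) _ ?_) ih
        rw [← neg_sub]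
        exact neg_mem (sub_cT_mem (a l))
    rw [e1]
    exact MB_add _ _ _ _ _ h (hsum _)

lemma soc_dep (P : Res (KR k Γ) (kMax k Γ)) (j r : ℕ) (h1 : ∀ q < j, P.DimLT (KR k Γ) q 1)
    (hr : P.DimLT (KR k Γ) j r) (F : Fin r → Finset (Fin n)) (c : Fin r → Finset (Fin n) → k)
    (hs : ∀ l, Sup (F l) (c l)) (hcoc : ∀ l, Coc Γ j (c l))
    (hcob : ∀ l, ∀ i ∈ F l, Cob Γ ((F l).erase i) j (c l)) :
    ∃ a : Fin r → k, (∃ l, a l ≠ 0) ∧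
      ∀ F', Cob Γ F' j (∑ l, if F l = F' then a l • c l else 0) :=
  soc_dep' (fun G => Localization.Away (∏ i ∈ G, xv k Γ i)) P j r h1 hr F c hs hcoc hcob

lemma exists_min (F : Finset (Fin n)) (j : ℕ) (c : Finset (Fin n) → k) (h : ¬ Cob Γ F j c) :
    ∃ F' ⊆ F, ¬ Cob Γ F' j c ∧ ∀ i ∈ F', Cob Γ (F'.erase i) j c := by
  induction F using Finset.strongInduction with
  | H F ih =>
    by_cases h1 : ∀ i ∈ F, Cob Γ (F.erase i) j c
    · exact ⟨F, subset_rfl, h, h1⟩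
    · push Not at h1
      obtain ⟨i, hi, hc⟩ := h1
      obtain ⟨F', hs, h2⟩ := ih _ (Finset.erase_ssubset hi) hc
      exact ⟨F', hs.trans (Finset.erase_subset _ _), h2⟩

lemma exists_facet (Γ : SC n) {τ : Finset (Fin n)} (h : τ ∈ Γ.faces) : ∃ G, Γ.IsFacet G ∧ τ ⊆ G := by
  obtain ⟨G, hle, hG⟩ := Finset.exists_le_maximal Γ.faces h
  exact ⟨G, ⟨hG.1, fun τ' h' hs => le_antisymm hs (hG.2 h' hs)⟩, hle⟩

/-- indicator cochain -/
def one (k : Type) [Field k] (G : Finset (Fin n)) : Finset (Fin n) → k := Pi.single G 1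

lemma one_sup {F G : Finset (Fin n)} (h : F ⊆ G) : Sup F (one k G) := by
  intro G' hG'
  by_cases e : G' = G
  · rw [e]; exact h
  · exact absurd (Pi.single_eq_of_ne e _) hG'

lemma one_not_cob {G : Finset (Fin n)} (h : G ∈ Γ.faces) : ¬ Cob Γ G G.card (one k G) := by
  rintro ⟨b, hb, h1⟩
  have := h1 G h rfl
  rw [dk_apply, Finset.sum_eq_zero] at this
  · simp [one] at this
  · intro v hv
    rw [hb.zero, smul_zero]
    intro hs
    exact Finset.notMem_erase v G (hs hv)

lemma one_coc {G : Finset (Fin n)} (h : Γ.IsFacet G) : Coc Γ G.card (one k G) := by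
  intro G' hG' hc
  rw [dk_apply, Finset.sum_eq_zero]
  intro v hv
  have : one k G (G'.erase v) = 0 := by
    refine Pi.single_eq_of_ne ?_ _
    intro he
    have h1 := h.2 G' hG' (by rw [← he]; exact Finset.erase_subset _ _)
    rw [← h1] at hc
    omega
  rw [this, smul_zero]

theorem comb (e : ℕ) (hface : ∀ τ ∈ Γ.faces, τ.card ≤ e)
    (hP : ∀ P : Res (KR k Γ) (kMax k Γ), P.Gor e) :
    ∃ F0 : Finset (Fin n), (∀ G, Γ.IsFacet G → G.card = e ∧ F0 ⊆ G) ∧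
      (∀ u w, u ≠ w → {u} ∈ Γ.faces → (∀ G, Γ.IsFacet G → u ∈ G → w ∈ G) → w ∈ F0) ∧
      (∀ j < e, ∀ c : Finset (Fin n) → k, Coc Γ j c → Cob Γ ∅ j c) ∧
      (F0 = ∅ → (∃ c : Finset (Fin n) → k, ¬ Cob Γ ∅ e c) ∧
        ∀ c c' : Finset (Fin n) → k, ∃ a a' : k, (a ≠ 0 ∨ a' ≠ 0) ∧
          Cob Γ ∅ e (a • c + a' • c')) := by
  classical
  obtain ⟨P⟩ := Res.exists_res (kMax k Γ)
  have hG := hP P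
  have hlow : ∀ j < e, ∀ (F : Finset (Fin n)) (c : Finset (Fin n) → k), Sup F c → Coc Γ j c →
      Cob Γ F j c := by
    intro j hj F c hs hc
    by_contra hn
    obtain ⟨F', hF', hn', hmin⟩ := exists_min F j c hn
    obtain ⟨a, ⟨l, hl⟩, ha⟩ := soc_dep P j 1 (fun q hq => hG.one q (by omega)) (hG.one j (by omega))
      (fun _ => F') (fun _ => c) (fun _ => hs.mono hF') (fun _ => hc) (fun _ => hmin)
    have h1 := ha F'
    obtain rfl : l = 0 := Subsingleton.elim _ _
    simp only [Finset.univ_unique, Fin.default_eq_zero, Finset.sum_singleton, if_true] at h1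
    exact hn' (h1.of_smul hl)
  have hcard : ∀ G, Γ.IsFacet G → G.card = e := by
    intro G hGf
    by_contra hne
    exact one_not_cob (k := k) hGf.1 (hlow G.card (lt_of_le_of_ne (hface G hGf.1) hne) G _
      (one_sup subset_rfl) (one_coc hGf))
  have hfac : ∀ G ∈ Γ.faces, G.card = e → Γ.IsFacet G := by
    intro G hGf hc
    refine ⟨hGf, fun τ hτ hs => Finset.eq_of_subset_of_card_le hs ?_⟩
    rw [hc]; exact hface τ hτ
  have htop : ∀ c : Finset (Fin n) → k, Coc Γ e c := by
    intro c G hGf hc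
    have := hface G hGf
    omega
  have huniq : ∀ F F' (c c' : Finset (Fin n) → k), Sup F c → Sup F' c' → ¬ Cob Γ F e c →
      ¬ Cob Γ F' e c' → (∀ i ∈ F, Cob Γ (F.erase i) e c) → (∀ i ∈ F', Cob Γ (F'.erase i) e c') →
      F = F' ∧ ∃ a a' : k, (a ≠ 0 ∨ a' ≠ 0) ∧ Cob Γ F e (a • c + a' • c') := by
    intro F F' c c' hs hs' hn hn' hm hm'
    obtain ⟨a, ⟨l, hl⟩, ha⟩ := soc_dep P e 2 (fun q hq => hG.one q (by omega)) hG.two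
      ![F, F'] ![c, c'] (by intro l; fin_cases l <;> assumption) (fun _ => htop _)
      (by intro l; fin_cases l <;> assumption)
    have hFF : F = F' := by
      by_contra hne
      have h1 := ha F
      have h2 := ha F'
      simp only [Fin.sum_univ_two, Matrix.cons_val_zero, Matrix.cons_val_one, if_true, hne,
        if_false, Ne.symm hne, add_zero, zero_add] at h1 h2
      fin_cases l
      · exact hn (h1.of_smul hl)
      · exact hn' (h2.of_smul hl)
    refine ⟨hFF, a 0, a 1, ?_, ?_⟩
    · fin_cases l
      · exact Or.inl hl
      · exact Or.inr hl
    · have h1 := ha F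
      simp only [Fin.sum_univ_two, Matrix.cons_val_zero, Matrix.cons_val_one, if_true, hFF] at h1
      rw [hFF]
      exact h1
  obtain ⟨G1, hG1, -⟩ := exists_facet Γ Γ.empty_mem
  have hnc : ∀ G, Γ.IsFacet G → ¬ Cob Γ G e (one k G) := by
    intro G hGf
    have := one_not_cob (k := k) hGf.1
    rwa [hcard G hGf] at this
  obtain ⟨F0, hF0, hF0n, hF0m⟩ := exists_min G1 e (one k G1) (hnc G1 hG1)
  have hall : ∀ G, Γ.IsFacet G → F0 ⊆ G ∧ ¬ Cob Γ F0 e (one k G) := by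
    intro G hGf
    obtain ⟨F, hF, hFn, hFm⟩ := exists_min G e (one k G) (hnc G hGf)
    obtain rfl := (huniq F0 F _ _ (one_sup hF0) (one_sup hF) hF0n hFn hF0m hFm).1
    exact ⟨hF, hFn⟩
  refine ⟨F0, fun G hGf => ⟨hcard G hGf, (hall G hGf).1⟩, ?_, ?_, ?_⟩
  · intro u w huw hu hrule
    by_contra hw
    obtain ⟨G, hGf, huG⟩ := exists_facet Γ hu
    have huG : u ∈ G := Finset.singleton_subset_iff.mp huG
    have hwG := hrule G hGf huG
    apply (hall G hGf).2
    refine ⟨sg w G • one k (G.erase w), ?_, ?_⟩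
    · intro G' hG'
      refine one_sup (k := k) (F := F0) (G := G.erase w) ?_ G' ?_
      · intro i hi
        exact Finset.mem_erase.mpr ⟨by rintro rfl; exact hw hi, (hall G hGf).1 hi⟩
      · intro h0
        apply hG'
        rw [Pi.smul_apply, h0, smul_zero]
    · intro G' hG' hc
      rw [dk_apply]
      by_cases he : G' = G
      · subst he
        rw [Finset.sum_eq_single_of_mem w hwG]
        · rw [Pi.smul_apply, smul_smul, sg_sq, one_smul]
          simp [one]
        · intro v hv hvw
          rw [Pi.smul_apply]
          have : one k (G'.erase w) (G'.erase v) = 0 := by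
            refine Pi.single_eq_of_ne ?_ _
            intro h
            have h1 : v ∉ G'.erase w := by rw [← h]; exact Finset.notMem_erase v G'
            exact h1 (Finset.mem_erase.mpr ⟨hvw, hv⟩)
          rw [this, smul_zero, smul_zero]
      · have h0 : one k G G' = 0 := Pi.single_eq_of_ne he _
        rw [h0, Finset.sum_eq_zero]
        intro v hv
        rw [Pi.smul_apply]
        have : one k (G.erase w) (G'.erase v) = 0 := by
          refine Pi.single_eq_of_ne ?_ _
          intro h
          apply he
          have hu' : u ∈ G' := Finset.mem_of_mem_erase (a := v) (by
            rw [h]; exact Finset.mem_erase.mpr ⟨huw, huG⟩)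
          have hw' := hrule G' (hfac G' hG' hc) hu'
          have hvw : v = w := by
            by_contra hvw
            have : w ∈ G'.erase v := Finset.mem_erase.mpr ⟨fun h => hvw h.symm, hw'⟩
            rw [h] at this
            exact Finset.notMem_erase w G this
          rw [hvw] at h
          rw [← Finset.insert_erase hw', h, Finset.insert_erase hwG]
        rw [this, smul_zero, smul_zero]
  · intro j hj c hc
    exact hlow j hj ∅ c (fun G _ => Finset.empty_subset G) hc
  · rintro rfl
    refine ⟨⟨_, hF0n⟩, fun c c' => ?_⟩
    by_cases h1 : Cob Γ ∅ e c
    · exact ⟨1, 0, Or.inl one_ne_zero, by rw [one_smul, zero_smul, add_zero]; exact h1⟩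
    by_cases h2 : Cob Γ ∅ e c'
    · exact ⟨0, 1, Or.inr one_ne_zero, by rw [one_smul, zero_smul, zero_add]; exact h2⟩
    exact (huniq ∅ ∅ c c' (fun G _ => Finset.empty_subset G) (fun G _ => Finset.empty_subset G) h1 h2
      (by simp) (by simp)).2

end Comb
end GP


set_option linter.unusedSectionVars false
set_option linter.unusedSimpArgs false
set_option linter.unusedVariables false

namespace GP

section LA
variable {k : Type} [Field k] {l m p : Type} [Fintype l] [Fintype m] [Fintype p]

lemma quot_finrank (N R : Submodule k (m → k)) (h : R ≤ N) :
    Module.finrank k (N ⧸ Submodule.comap N.subtype R) + Module.finrank k R =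
      Module.finrank k N := by
  rw [← (Submodule.comapSubtypeEquivOfLe h).finrank_eq]
  exact Submodule.finrank_quotient_add_finrank _

lemma quot_sub (N R : Submodule k (m → k)) (h : R ≤ N)
    (hr : Module.finrank k N ≤ Module.finrank k R) :
    Subsingleton (N ⧸ Submodule.comap N.subtype R) := by
  have := quot_finrank N R h
  exact Module.finrank_zero_iff.mp (by omega : Module.finrank k (N ⧸ Submodule.comap N.subtype R) = 0)

lemma quot_one (N R : Submodule k (m → k)) (h : R ≤ N)
    (hr : Module.finrank k N = Module.finrank k R + 1) :
    Nonempty ((N ⧸ Submodule.comap N.subtype R) ≃ₗ[k] k) := by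
  have := quot_finrank N R h
  apply FiniteDimensional.nonempty_linearEquiv_of_finrank_eq
  rw [Module.finrank_self]
  omega

lemma rank_range (A : Matrix l m k) :
    Module.finrank k (LinearMap.range A.mulVecLin) = Module.finrank k (LinearMap.range A.transpose.mulVecLin) := by
  have := A.rank_transpose
  exact this.symm

lemma ker_fin (A : Matrix l m k) :
    Module.finrank k (LinearMap.range A.transpose.mulVecLin) +
      Module.finrank k (LinearMap.ker A.mulVecLin) = Fintype.card m := by
  rw [← rank_range, LinearMap.finrank_range_add_finrank_ker, Module.finrank_fintype_fun_eq_card]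

lemma ker_le_fin (A : Matrix l m k) (B : Matrix m p k)
    (h : LinearMap.ker B.transpose.mulVecLin ≤ LinearMap.range A.transpose.mulVecLin) :
    Module.finrank k (LinearMap.ker A.mulVecLin) ≤ Module.finrank k (LinearMap.range B.mulVecLin) := by
  have h1 := ker_fin A
  have h2 := ker_fin B.transpose
  rw [Matrix.transpose_transpose] at h2
  have h3 := Submodule.finrank_mono h
  omega

lemma ker_one_fin (A : Matrix l m k) 
    (h1 : ∃ f, f ∉ LinearMap.range A.transpose.mulVecLin)
    (h2 : ∀ f f' : m → k, ∃ a a' : k, (a ≠ 0 ∨ a' ≠ 0) ∧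
      a • f + a' • f' ∈ LinearMap.range A.transpose.mulVecLin) :
    Module.finrank k (LinearMap.ker A.mulVecLin) = 1 := by
  have h := ker_fin A
  have h3 := Submodule.finrank_quotient_add_finrank (LinearMap.range A.transpose.mulVecLin)
  rw [Module.finrank_fintype_fun_eq_card] at h3
  have h4 : Module.finrank k ((m → k) ⧸ LinearMap.range A.transpose.mulVecLin) = 1 := by
    obtain ⟨f, hf⟩ := h1
    have hf0 : (Submodule.mkQ (LinearMap.range A.transpose.mulVecLin)) f ≠ 0 := by
      intro h0
      exact hf ((Submodule.Quotient.mk_eq_zero _).mp h0)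
    refine finrank_eq_one _ hf0 ?_
    intro w
    obtain ⟨f', rfl⟩ := Submodule.mkQ_surjective _ w
    obtain ⟨a, a', haa, hm⟩ := h2 f f'
    have hm' : a • (Submodule.mkQ (LinearMap.range A.transpose.mulVecLin)) f +
        a' • (Submodule.mkQ (LinearMap.range A.transpose.mulVecLin)) f' = 0 := by
      rw [← map_smul, ← map_smul, ← map_add]
      exact (Submodule.Quotient.mk_eq_zero _).mpr hm
    have ha' : a' ≠ 0 := by
      intro h0
      rw [h0, zero_smul, add_zero] at hm'
      rcases smul_eq_zero.mp hm' with h5 | h5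
      · rcases haa with h6 | h6
        · exact h6 h5
        · exact h6 h0
      · exact hf0 h5
    refine ⟨- (a'⁻¹ * a), ?_⟩
    rw [neg_smul, mul_smul, ← sub_eq_zero, ← neg_add', neg_eq_zero]
    have := congrArg (fun x => a'⁻¹ • x) hm'
    simp only [smul_add, smul_zero, smul_smul, inv_mul_cancel₀ ha', one_smul] at this
    rw [smul_smul]
    exact this
  omega
end LA

section Bridge
variable {k : Type} [Field k] {n : ℕ} {Γ : SC n}

/-- restriction of cochains -/
def rs (Γ : SC n) (q : ℕ) (c : Finset (Fin n) → k) : Γ.RFace ∅ q → k := fun ρ => c ρ.1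

open Classical in
/-- extension of cochains by zero -/
noncomputable def ex (q : ℕ) (f : Γ.RFace ∅ q → k) : Finset (Fin n) → k := fun G =>
  if h : G ∈ Γ.faces ∧ ∅ ⊆ G ∧ G.card = q then f ⟨G, h⟩ else 0

lemma rs_ex (q : ℕ) (f : Γ.RFace ∅ q → k) : rs Γ q (ex q f) = f := by
  funext ρ
  simp only [rs, ex]
  rw [dif_pos ρ.2]
  rfl

lemma bT_rs (q : ℕ) (c : Finset (Fin n) → k) :
    (Γ.relBMat k ∅ q).transpose.mulVecLin (rs Γ q c) = rs Γ (q + 1) (dk c) := by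
  classical
  funext τ
  rw [Matrix.mulVecLin_apply]
  simp only [Matrix.mulVec, dotProduct, Matrix.transpose_apply, SC.relBMat, rs, dk_apply,
    Finset.sum_mul]
  rw [Finset.sum_comm]
  refine Finset.sum_congr rfl fun v hv => ?_
  have hm : τ.1.erase v ∈ Γ.faces ∧ ∅ ⊆ τ.1.erase v ∧ (τ.1.erase v).card = q := by
    refine ⟨Γ.down_closed τ.2.1 (Finset.erase_subset _ _), Finset.empty_subset _, ?_⟩
    rw [Finset.card_erase_of_mem hv, τ.2.2.2]; rfl
  refine (Finset.sum_eq_single (⟨τ.1.erase v, hm⟩ : Γ.RFace ∅ q) ?_ ?_).trans ?_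
  · intro ρ _ hρ
    rw [if_neg, zero_mul]
    rintro ⟨_, h⟩
    exact hρ (Subtype.ext h.symm)
  · intro h
    exact absurd (Finset.mem_univ _) h
  · rw [if_pos ⟨Finset.notMem_empty _, rfl⟩, zsmul_eq_mul, sg]
    push_cast
    rfl

lemma cob_iff (q : ℕ) (c : Finset (Fin n) → k) :
    Cob Γ ∅ (q + 1) c ↔ rs Γ (q + 1) c ∈ LinearMap.range (Γ.relBMat k ∅ q).transpose.mulVecLin := by
  constructor
  · rintro ⟨b, -, h⟩
    refine ⟨rs Γ q b, ?_⟩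
    rw [bT_rs]
    funext τ
    exact (h τ.1 τ.2.1 τ.2.2.2).symm
  · rintro ⟨f, hf⟩
    refine ⟨ex q f, fun G _ => Finset.empty_subset _, fun G hG hc => ?_⟩
    rw [← rs_ex q f, bT_rs] at hf
    exact (congrFun hf ⟨G, hG, Finset.empty_subset _, hc⟩).symm

lemma coc_iff (q : ℕ) (c : Finset (Fin n) → k) :
    Coc Γ q c ↔ rs Γ q c ∈ LinearMap.ker (Γ.relBMat k ∅ q).transpose.mulVecLin := by
  rw [LinearMap.mem_ker, bT_rs]
  constructor
  · intro h
    funext τ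
    exact h τ.1 τ.2.1 τ.2.2.2
  · intro h G hG hc
    exact congrFun h ⟨G, hG, Finset.empty_subset _, hc⟩

lemma range_le_ker (q : ℕ) : LinearMap.range (Γ.relBMat k ∅ (q + 1)).mulVecLin ≤
    LinearMap.ker (Γ.relBMat k ∅ q).mulVecLin := by
  have h : (Γ.relBMat k ∅ q * Γ.relBMat k ∅ (q + 1)).transpose = 0 := by
    classical
    apply Matrix.ext_of_mulVec_single
    intro i
    rw [Matrix.transpose_mul, ← Matrix.mulVec_mulVec]
    have h1 := bT_rs (Γ := Γ) q (ex q (Pi.single i (1 : k)))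
    rw [rs_ex, Matrix.mulVecLin_apply] at h1
    rw [h1]
    have h2 := bT_rs (Γ := Γ) (q + 1) (dk (ex q (Pi.single i (1 : k))))
    rw [Matrix.mulVecLin_apply] at h2
    rw [h2, dk_dk, Matrix.zero_mulVec]
    rfl
  rw [Matrix.transpose_eq_zero] at h
  rw [LinearMap.range_le_ker_iff, ← Matrix.mulVecLin_mul, h, Matrix.mulVecLin_zero]

lemma range_zero_of_empty (q : ℕ) (h : ∀ τ ∈ Γ.faces, τ.card ≠ q + 1) :
    Module.finrank k (LinearMap.range (Γ.relBMat k ∅ q).mulVecLin) = 0 := by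
  have : IsEmpty (Γ.RFace ∅ (q + 1)) := ⟨fun τ => h τ.1 τ.2.1 τ.2.2.2⟩
  have h1 := LinearMap.finrank_range_le (Γ.relBMat k ∅ q).mulVecLin
  rw [Module.finrank_fintype_fun_eq_card, Fintype.card_eq_zero] at h1
  omega

lemma card_zero : Fintype.card (Γ.RFace ∅ 0) = 1 := by
  rw [Fintype.card_eq_one_iff]
  refine ⟨⟨∅, Γ.empty_mem, le_refl _, rfl⟩, fun y => Subtype.ext ?_⟩
  exact Finset.card_eq_zero.mp y.2.2.2

theorem sphere (e : ℕ) (hface : ∀ τ ∈ Γ.faces, τ.card ≤ e) (hex : ∃ τ ∈ Γ.faces, τ.card = e)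
    (h1 : ∀ j < e, ∀ c : Finset (Fin n) → k, Coc Γ j c → Cob Γ ∅ j c)
    (h2 : ∃ c : Finset (Fin n) → k, ¬ Cob Γ ∅ e c)
    (h3 : ∀ c c' : Finset (Fin n) → k, ∃ a a' : k, (a ≠ 0 ∨ a' ≠ 0) ∧
          Cob Γ ∅ e (a • c + a' • c')) : SC.HomologySphereCond k Γ := by
  have hdim : Γ.dim = (e : ℤ) - 1 := by
    obtain ⟨τ, hτ, hc⟩ := hex
    have : Γ.faces.sup Finset.card = e :=
      le_antisymm (Finset.sup_le hface) (hc ▸ Finset.le_sup (f := Finset.card) hτ)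
    rw [SC.dim, this]
  refine ⟨fun i => ⟨fun hi => ?_, fun hi => ?_⟩, fun hi => ?_, fun hi => ?_⟩
  · have he : e = i + 1 := by omega
    subst he
    refine quot_one (LinearMap.ker (Γ.relBMat k ∅ i).mulVecLin)
      (LinearMap.range (Γ.relBMat k ∅ (i + 1)).mulVecLin) (range_le_ker i) ?_
    rw [range_zero_of_empty (i + 1) (fun τ hτ h => by have := hface τ hτ; omega), zero_add]
    apply ker_one_fin
    · obtain ⟨c, hc⟩ := h2
      exact ⟨_, fun h => hc ((cob_iff i c).mpr h)⟩
    · intro f f'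
      obtain ⟨a, a', haa, h⟩ := h3 (ex (i + 1) f) (ex (i + 1) f')
      refine ⟨a, a', haa, ?_⟩
      have := (cob_iff i _).mp h
      have h5 : rs Γ (i + 1) (a • ex (i + 1) f + a' • ex (i + 1) f') = a • f + a' • f' := by
        conv_rhs => rw [← rs_ex (i + 1) f, ← rs_ex (i + 1) f']
        rfl
      rwa [h5] at this
  · refine quot_sub (LinearMap.ker (Γ.relBMat k ∅ i).mulVecLin)
      (LinearMap.range (Γ.relBMat k ∅ (i + 1)).mulVecLin) (range_le_ker i) ?_
    by_cases hlt : i + 1 < e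
    · apply ker_le_fin
      intro f hf
      rw [← rs_ex (i + 1) f] at hf ⊢
      exact (cob_iff i _).mp (h1 (i + 1) hlt _ ((coc_iff (i + 1) _).mpr hf))
    · have : IsEmpty (Γ.RFace ∅ (i + 1)) :=
        ⟨fun τ => by have := hface τ.1 τ.2.1; have := τ.2.2.2; omega⟩
      have h6 := Submodule.finrank_le (LinearMap.ker (Γ.relBMat k ∅ i).mulVecLin)
      rw [Module.finrank_fintype_fun_eq_card, Fintype.card_eq_zero] at h6
      omega
  · have he : e = 0 := by omega
    subst he
    refine quot_one ⊤ (LinearMap.range (Γ.relBMat k ∅ 0).mulVecLin) le_top ?_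
    rw [range_zero_of_empty 0 (fun τ hτ h => by have := hface τ hτ; omega), finrank_top,
      Module.finrank_fintype_fun_eq_card, card_zero]
  · have he : 0 < e := by omega
    refine quot_sub ⊤ (LinearMap.range (Γ.relBMat k ∅ 0).mulVecLin) le_top ?_
    have h7 : LinearMap.ker (Γ.relBMat k ∅ 0).transpose.mulVecLin = ⊥ := by
      rw [eq_bot_iff]
      intro f hf
      rw [← rs_ex 0 f] at hf
      obtain ⟨b, -, hb⟩ := h1 0 he _ ((coc_iff 0 _).mpr hf)
      rw [Submodule.mem_bot, ← rs_ex 0 f]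
      funext τ
      have h8 := hb τ.1 τ.2.1 τ.2.2.2
      rw [dk_apply, Finset.card_eq_zero.mp τ.2.2.2, Finset.sum_empty] at h8
      rw [rs, Finset.card_eq_zero.mp τ.2.2.2, h8]
      rfl
    have h8 := ker_fin (Γ.relBMat k ∅ 0).transpose
    rw [h7, finrank_bot, Matrix.transpose_transpose] at h8
    rw [finrank_top, Module.finrank_fintype_fun_eq_card]
    omega

end Bridge
end GP


set_option linter.unusedSectionVars false
set_option linter.unusedSimpArgs false
set_option linter.unusedVariables false

namespace GP

section Comb2
variable {n : ℕ} {Δ : SC n}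

lemma facet_link {σ : Finset (Fin n)} (hσ : σ ∈ Δ.faces) {G : Finset (Fin n)}
    (hG : Δ.IsFacet G) (h : σ ⊆ G) : (Δ.link σ hσ).IsFacet (G \ σ) := by
  refine ⟨mem_link.mpr ⟨Finset.sdiff_disjoint, by rw [Finset.sdiff_union_of_subset h]; exact hG.1⟩, ?_⟩
  intro τ hτ hs
  obtain ⟨h1, h2⟩ := mem_link.mp hτ
  have h3 := hG.2 _ h2 (by
    intro x hx
    by_cases hxs : x ∈ σ
    · exact Finset.mem_union_right _ hxs
    · exact Finset.mem_union_left _ (hs (Finset.mem_sdiff.mpr ⟨hx, hxs⟩)))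
  rw [h3, Finset.union_sdiff_cancel_right h1]

lemma link_facet {σ : Finset (Fin n)} (hσ : σ ∈ Δ.faces) {H : Finset (Fin n)}
    (hH : (Δ.link σ hσ).IsFacet H) : Δ.IsFacet (H ∪ σ) := by
  obtain ⟨h1, h2⟩ := mem_link.mp hH.1
  refine ⟨h2, fun τ hτ hs => ?_⟩
  have hσt : σ ⊆ τ := Finset.subset_union_right.trans hs
  have h3 := hH.2 (τ \ σ) (mem_link.mpr ⟨Finset.sdiff_disjoint, by
    rw [Finset.sdiff_union_of_subset hσt]; exact hτ⟩) (by
    intro x hx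
    exact Finset.mem_sdiff.mpr ⟨hs (Finset.mem_union_left _ hx), fun h => Finset.disjoint_left.mp h1 hx h⟩)
  rw [h3, Finset.sdiff_union_of_subset hσt]

/-- every facet containing `σ` contains `w` -/
def WW (Δ : SC n) (σ : Finset (Fin n)) (w : Fin n) : Prop :=
  w ∉ σ ∧ ∀ G, Δ.IsFacet G → σ ⊆ G → w ∈ G

/-- the rule -/
def Rule (Δ : SC n) : Prop := ∀ (σ : Finset (Fin n)) (u w : Fin n), σ ≠ ∅ → insert u σ ∈ Δ.faces →
  u ∉ σ → WW Δ (insert u σ) w → WW Δ σ w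

lemma rule_vertex (hR : Rule Δ) (w : Fin n) (σ : Finset (Fin n)) :
    σ ∈ Δ.faces → σ ≠ ∅ → WW Δ σ w → ∃ v, {v} ∈ Δ.faces ∧ WW Δ {v} w := by
  classical
  induction σ using Finset.induction_on with
  | empty => intro _ h; exact absurd rfl h
  | insert u σ hu ih =>
    intro h1 h2 h3
    by_cases hs : σ = ∅
    · subst hs
      exact ⟨u, h1, h3⟩
    · exact ih (Δ.down_closed h1 (Finset.subset_insert _ _)) hs (hR σ u w hs h1 hu h3)

lemma rule_adj (hR : Rule Δ) {u u' w : Fin n} (h : ({u, u'} : Finset (Fin n)) ∈ Δ.faces) (hw : u' ≠ w)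
    (h1 : WW Δ {u} w) : WW Δ {u'} w := by
  by_cases huu : u = u'
  · rwa [← huu]
  · refine hR {u'} u w (Finset.singleton_ne_empty _) h (by simpa using huu) ⟨?_, ?_⟩
    · have := h1.1
      simp only [Finset.mem_insert, Finset.mem_singleton] at this ⊢
      rintro (h | h)
      · exact this h
      · exact hw h.symm
    · intro G hG hs
      exact h1.2 G hG ((Finset.singleton_subset_iff.mpr (hs (Finset.mem_insert_self _ _))))

end Comb2

section Fin
variable {k : Type} [Field k] {n : ℕ} {Δ : SC n}

lemma const_nbr (w : Fin n) (hw : {w} ∈ Δ.faces) (hR : Rule Δ)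
    (hco : ∀ c : Finset (Fin n) → k, Coc (Δ.link {w} hw) 1 c → Cob (Δ.link {w} hw) ∅ 1 c)
    (v : Fin n) (hv : WW Δ {v} w) (hvw : {v, w} ∈ Δ.faces) (x : Fin n) (hx : x ≠ w)
    (hxw : {x, w} ∈ Δ.faces) : WW Δ {x} w := by
  classical
  let c : Finset (Fin n) → k := fun G => if WW Δ G w then 1 else 0
  have hc : Coc (Δ.link {w} hw) 1 c := by
    intro G hG hcard
    obtain ⟨a, b, hab, rfl⟩ := Finset.card_eq_two.mp hcard
    obtain ⟨h1, h2⟩ := mem_link.mp hG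
    have hf : ({a, b} : Finset (Fin n)) ∈ Δ.faces := Δ.down_closed h2 Finset.subset_union_left
    have hf' : ({b, a} : Finset (Fin n)) ∈ Δ.faces := by rwa [Finset.pair_comm]
    have haw : a ≠ w := by
      rintro rfl
      exact Finset.disjoint_left.mp h1 (Finset.mem_insert_self _ _) (Finset.mem_singleton_self _)
    have hbw : b ≠ w := by
      rintro rfl
      exact Finset.disjoint_left.mp h1 (Finset.mem_insert_of_mem (Finset.mem_singleton_self _))
        (Finset.mem_singleton_self _)
    have hiff : c {a} = c {b} := by
      have : WW Δ {a} w ↔ WW Δ {b} w := ⟨rule_adj hR hf hbw, rule_adj hR hf' haw⟩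
      simp only [c, this]
    have e1 : ({a, b} : Finset (Fin n)).erase a = {b} := by
      rw [Finset.erase_insert]; simpa using hab
    have e2 : ({a, b} : Finset (Fin n)).erase b = {a} := by
      rw [Finset.pair_comm, Finset.erase_insert]; simpa using hab.symm
    have hs := sg_swap a b {a, b} (by simp) (by simp) hab
    rw [e1, e2] at hs
    have s1 : ∀ y : Fin n, sg y {y} = 1 := by
      intro y
      simp [sg, Finset.filter_singleton]
    rw [s1, s1, mul_one, mul_one] at hs
    rw [dk_apply, Finset.sum_pair hab, e1, e2, hs, hiff, neg_smul, add_neg_cancel]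
  obtain ⟨b, -, hb⟩ := hco c hc
  have key : ∀ y : Fin n, y ≠ w → {y, w} ∈ Δ.faces → c {y} = b ∅ := by
    intro y hy hyw
    have := hb {y} (mem_link.mpr ⟨by simpa using hy, by simpa using hyw⟩) (Finset.card_singleton _)
    rw [this, dk_apply, Finset.sum_singleton]
    simp [sg, Finset.filter_singleton]
  have hvw' : v ≠ w := fun h => hv.1 (by simp [h])
  have h1 := (key x hx hxw).trans (key v hvw' hvw).symm
  by_contra hn
  simp only [c, hn, hv, if_true, if_false] at h1
  exact zero_ne_one h1

theorem final (hdim : 2 ≤ Δ.dim) (hconn : Δ.Connected)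
    (hnG : ¬ IsGorensteinAt (KR k Δ) (kMax k Δ))
    (hGP : GorensteinPunctured k (srIdeal k Δ)) :
    Δ.IsHomologyManifold k := by
  classical
  have D : ∀ (σ : Finset (Fin n)) (hσ : σ ∈ Δ.faces), σ ≠ ∅ → ∃ (e : ℕ) (F0 : Finset (Fin n)),
      (∀ τ ∈ (Δ.link σ hσ).faces, τ.card ≤ e) ∧
      (∀ P : Res (KR k (Δ.link σ hσ)) (kMax k (Δ.link σ hσ)), P.Gor e) ∧
      (∀ G, (Δ.link σ hσ).IsFacet G → G.card = e ∧ F0 ⊆ G) ∧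
      (∀ u w, u ≠ w → {u} ∈ (Δ.link σ hσ).faces →
        (∀ G, (Δ.link σ hσ).IsFacet G → u ∈ G → w ∈ G) → w ∈ F0) ∧
      (∀ j < e, ∀ c : Finset (Fin n) → k, Coc (Δ.link σ hσ) j c → Cob (Δ.link σ hσ) ∅ j c) ∧
      (F0 = ∅ → (∃ c : Finset (Fin n) → k, ¬ Cob (Δ.link σ hσ) ∅ e c) ∧
        ∀ c c' : Finset (Fin n) → k, ∃ a a' : k, (a ≠ 0 ∨ a' ≠ 0) ∧
          Cob (Δ.link σ hσ) ∅ e (a • c + a' • c')) := by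
    intro σ hσ hne
    obtain ⟨e, he, hP⟩ := link_gor hGP σ hσ hne
    obtain ⟨F0, h⟩ := comb e he hP
    exact ⟨e, F0, he, hP, h⟩
  choose e F0 hface hP hA hB hC hD using D
  -- elements of F0 dominate
  have hF0 : ∀ σ hσ hne w, w ∈ F0 σ hσ hne → WW Δ σ w := by
    intro σ hσ hne w hw
    constructor
    · obtain ⟨G, hG, -⟩ := exists_facet (Δ.link σ hσ) (Δ.link σ hσ).empty_mem
      have h1 := (hA σ hσ hne G hG).2 hw
      exact Finset.disjoint_left.mp (mem_link.mp hG.1).1 h1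
    · intro G hG hs
      exact (Finset.mem_sdiff.mp ((hA σ hσ hne _ (facet_link hσ hG hs)).2 hw)).1
  have hR : Rule Δ := by
    intro σ u w hne hf hu hW
    have hσ : σ ∈ Δ.faces := Δ.down_closed hf (Finset.subset_insert _ _)
    apply hF0 σ hσ hne w
    apply hB σ hσ hne u w
    · rintro rfl
      exact hW.1 (Finset.mem_insert_self _ _)
    · exact mem_link.mpr ⟨by simpa using hu, by rwa [Finset.singleton_union]⟩
    · intro H hH huH
      have := hW.2 _ (link_facet hσ hH) (Finset.insert_subset (Finset.mem_union_left _ huH)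
        Finset.subset_union_right)
      rcases Finset.mem_union.mp this with h | h
      · exact h
      · exact absurd (Finset.mem_insert_of_mem h) hW.1
  by_cases hall : ∀ σ hσ hne, F0 σ hσ hne = ∅
  · refine ⟨hconn, fun σ hσ hne => ?_⟩
    obtain ⟨G, hG, -⟩ := exists_facet (Δ.link σ hσ) (Δ.link σ hσ).empty_mem
    exact sphere (e σ hσ hne) (hface σ hσ hne) ⟨G, hG.1, (hA σ hσ hne G hG).1⟩ (hC σ hσ hne)
      (hD σ hσ hne (hall σ hσ hne)).1 (hD σ hσ hne (hall σ hσ hne)).2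
  exfalso
  simp only [not_forall] at hall
  obtain ⟨σ, hσ, hne, hF⟩ := hall
  obtain ⟨w, hwF⟩ := Finset.nonempty_iff_ne_empty.mpr hF
  obtain ⟨v, hv, hvW⟩ := rule_vertex hR w σ hσ hne (hF0 σ hσ hne w hwF)
  have sne : ∀ x : Fin n, ({x} : Finset (Fin n)) ≠ ∅ := fun x => Finset.singleton_ne_empty x
  -- facet cardinalities
  have hcard : ∀ x (hx : {x} ∈ Δ.faces) G, Δ.IsFacet G → x ∈ G →
      G.card = e {x} hx (sne x) + 1 := by
    intro x hx G hG hxG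
    have h1 := (hA {x} hx (sne x) _ (facet_link hx hG (Finset.singleton_subset_iff.mpr hxG))).1
    rw [← h1, Finset.sdiff_singleton_eq_erase, Finset.card_erase_add_one hxG]
  have hvert : ∀ {G x}, G ∈ Δ.faces → x ∈ G → {x} ∈ Δ.faces := fun hG hx =>
    Δ.down_closed hG (Finset.singleton_subset_iff.mpr hx)
  obtain ⟨G1, hG1, hvG1⟩ := exists_facet Δ hv
  have hwG1 := hvW.2 G1 hG1 hvG1
  have hw : {w} ∈ Δ.faces := hvert hG1.1 hwG1
  have hvw : ({v, w} : Finset (Fin n)) ∈ Δ.faces := Δ.down_closed hG1.1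
    (Finset.insert_subset (Finset.singleton_subset_iff.mp hvG1) (Finset.singleton_subset_iff.mpr hwG1))
  -- purity
  have hpure : ∀ x y (hx : {x} ∈ Δ.faces) , Relation.ReflTransGen
      (fun a b => ({a, b} : Finset (Fin n)) ∈ Δ.faces) x y → ∃ hy : {y} ∈ Δ.faces,
      e {x} hx (sne x) = e {y} hy (sne y) := by
    intro x y hx hxy
    induction hxy with
    | refl => exact ⟨hx, rfl⟩
    | @tail b c hab hbc ih =>
      obtain ⟨hb, h⟩ := ih
      have hc : {c} ∈ Δ.faces := hvert hbc (by simp)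
      refine ⟨hc, h.trans ?_⟩
      obtain ⟨G, hG, hs⟩ := exists_facet Δ hbc
      have h1 := hcard b hb G hG (hs (by simp))
      have h2 := hcard c hc G hG (hs (by simp))
      omega
  have hew : 2 ≤ e {w} hw (sne w) := by
    have h3 : 3 ≤ Δ.faces.sup Finset.card := by
      rw [SC.dim] at hdim
      omega
    obtain ⟨τ, hτ, h4⟩ := (Finset.le_sup_iff (by norm_num : (⊥ : ℕ) < 3)).mp h3
    obtain ⟨x, hxτ⟩ := Finset.card_pos.mp (by omega : 0 < τ.card)
    have hx := hvert hτ hxτ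
    obtain ⟨G, hG, hs⟩ := exists_facet Δ hτ
    have h5 := hcard x hx G hG (hs hxτ)
    have h6 := Finset.card_le_card hs
    obtain ⟨_, h7⟩ := hpure x w hx (hconn.2 x w hx hw)
    omega
  have hnb := const_nbr (k := k) w hw hR (hC {w} hw (sne w) 1 (by omega)) v hvW hvw
  have hev : ∀ x, {x} ∈ Δ.faces → x = w ∨ WW Δ {x} w := by
    intro x hx
    have hp := hconn.2 v x hv hx
    clear hx
    induction hp with
    | refl => exact Or.inr hvW
    | @tail b c hab hbc ih =>
      by_cases hcw : c = w
      · exact Or.inl hcw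
      · right
        rcases ih with rfl | ih
        · exact hnb c hcw (by rwa [Finset.pair_comm])
        · exact rule_adj hR hbc hcw ih
  have hcone : ∀ G, Δ.IsFacet G → w ∈ G := by
    intro G hG
    have hGn : G.Nonempty := by
      rw [Finset.nonempty_iff_ne_empty]
      rintro rfl
      exact sne v (hG.2 _ hv (Finset.empty_subset _)).symm
    obtain ⟨x, hx⟩ := hGn
    rcases hev x (hvert hG.1 hx) with rfl | h
    · exact hx
    · exact h.2 G hG (Finset.singleton_subset_iff.mpr hx)
  apply hnG
  refine cone_case w hw ?_ (e {w} hw (sne w)) (hP {w} hw (sne w)) ?_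
  · intro τ hτ
    obtain ⟨G, hG, hs⟩ := exists_facet Δ hτ
    exact Δ.down_closed hG.1 (Finset.insert_subset (hcone G hG) hs)
  · apply le_antisymm
    · apply dim_KR_le
      intro τ hτ
      obtain ⟨G, hG, hs⟩ := exists_facet Δ hτ
      rw [← hcard w hw G hG (hcone G hG)]
      exact Finset.card_le_card hs
    · rw [← hcard w hw G1 hG1 hwG1]
      exact dim_KR_ge G1 hG1.1

end Fin
end GP

set_option maxHeartbeats 1000000 in
set_option synthInstance.maxHeartbeats 1000000 in
/-- Let `Δ` be a connected simplicial complex of dimension at least `2`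
such that `k[Δ]` is not Gorenstein.  If `k[Δ]` is Gorenstein on the punctured spectrum, then
`Δ` is a `k`-homology manifold. -/
theorem homologyManifold_of_gorensteinPunctured
    (k : Type) [Field k] {n : ℕ} (Δ : SC n) (hdim : 2 ≤ Δ.dim) (hconn : Δ.Connected)
    (hnG : ¬ IsGorensteinAt (SRRing k Δ) (srMax k Δ))
    (hGP : GorensteinPunctured k (srIdeal k Δ)) :
    Δ.IsHomologyManifold k := by
  exact GP.final (k := k) hdim hconn hnG hGP
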